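/- Let K belong to the class R and let uv be an edge of K, where u is non-singular and lk(uv,K) contains at most one singular vertex. Then: (i) if d(u) = 6 then d(v) ≥ 9; (ii) if d(u) = 7 and d(uv) = 5 then d(v) ≥ 11; (iii) if d(u) = 7 and d(uv) = 4 then d(v) ≥ 8. -/

import Mathlib

/-- An abstract simplicial complex on vertex set `ℕ`: a finite, downward closed
collection of nonempty finite sets of vertices. -/
structure SComplex where
  faces : Finset (Finset ℕ)
  not_empty_mem : ∅ ∉ faces
  down_closed : ∀ s ∈ faces, ∀ t ⊆ s, t ≠ ∅ → t ∈ faces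

namespace SComplex

/-- The set of vertices of the complex. -/
def vertexSet (K : SComplex) : Finset ℕ := K.faces.sup id

/-- `fnum K i` is the number of `i`-dimensional faces of `K`. -/
def fnum (K : SComplex) (i : ℕ) : ℕ := (K.faces.filter fun s => s.card = i + 1).card

/-- `g₂` for a 3-dimensional complex: `f₁ - 4 f₀ + 10`. -/
def g2 (K : SComplex) : ℤ := (K.fnum 1 : ℤ) - 4 * (K.fnum 0 : ℤ) + 10

/-- `g₂` for a 2-dimensional complex: `f₁ - 3 f₀ + 6`. -/
def g2surf (K : SComplex) : ℤ := (K.fnum 1 : ℤ) - 3 * (K.fnum 0 : ℤ) + 6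

/-- Euler characteristic of a (2-dimensional) complex. -/
def euler (K : SComplex) : ℤ := (K.fnum 0 : ℤ) - (K.fnum 1 : ℤ) + (K.fnum 2 : ℤ)

/-- The link of a face `σ`. -/
def lk (K : SComplex) (σ : Finset ℕ) : SComplex where
  faces := K.faces.filter fun γ => γ ∩ σ = ∅ ∧ γ ∪ σ ∈ K.faces
  not_empty_mem := fun h => K.not_empty_mem (Finset.mem_filter.mp h).1
  down_closed := by
    intro s hs t hts ht
    rw [Finset.mem_filter] at hs ⊢
    refine ⟨K.down_closed s hs.1 t hts ht, ?_, ?_⟩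
    · have h1 : t ∩ σ ⊆ s ∩ σ := Finset.inter_subset_inter hts (Finset.Subset.refl σ)
      rw [hs.2.1] at h1
      exact Finset.subset_empty.mp h1
    · refine K.down_closed (s ∪ σ) hs.2.2 (t ∪ σ)
        (Finset.union_subset_union hts (Finset.Subset.refl σ)) ?_
      intro hc
      exact ht (Finset.union_eq_empty.mp hc).1

/-- The (closed) star of a face `σ`. -/
def st (K : SComplex) (σ : Finset ℕ) : SComplex where
  faces := K.faces.filter fun α => α ∪ σ ∈ K.faces
  not_empty_mem := fun h => K.not_empty_mem (Finset.mem_filter.mp h).1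
  down_closed := by
    intro s hs t hts ht
    rw [Finset.mem_filter] at hs ⊢
    refine ⟨K.down_closed s hs.1 t hts ht, ?_⟩
    refine K.down_closed (s ∪ σ) hs.2 (t ∪ σ)
      (Finset.union_subset_union hts (Finset.Subset.refl σ)) ?_
    intro hc
    exact ht (Finset.union_eq_empty.mp hc).1

/-- A facet is a maximal face. -/
def IsFacet (K : SComplex) (s : Finset ℕ) : Prop :=
  s ∈ K.faces ∧ ∀ t ∈ K.faces, s ⊆ t → s = t

/-- A pure `d`-dimensional complex: all facets have `d+1` vertices. -/
def IsPure (K : SComplex) (d : ℕ) : Prop :=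
  K.faces.Nonempty ∧ ∀ s, K.IsFacet s → s.card = d + 1

/-- Two facets are adjacent if they share a codimension-one face. -/
def FacetAdj (K : SComplex) (s t : Finset ℕ) : Prop :=
  K.IsFacet s ∧ K.IsFacet t ∧ (s ∩ t).card + 1 = s.card

/-- Strong connectedness: any two facets are joined by a chain of facets, consecutive
ones sharing a codimension-one face. -/
def StronglyConnected (K : SComplex) : Prop :=
  ∀ s t, K.IsFacet s → K.IsFacet t → Relation.ReflTransGen K.FacetAdj s t

/-- Two vertices are adjacent if they span an edge. -/
def VertAdj (K : SComplex) (u v : ℕ) : Prop := ({u, v} : Finset ℕ) ∈ K.faces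

/-- Connectedness of a complex (via its 1-skeleton). -/
def Conn (K : SComplex) : Prop :=
  K.faces.Nonempty ∧
    ∀ u v, {u} ∈ K.faces → {v} ∈ K.faces → Relation.ReflTransGen K.VertAdj u v

/-- A normal `d`-pseudomanifold: pure, strongly connected, every `(d-1)`-face is in
exactly two facets, and links of faces of dimension at most `d-2` are connected. -/
def IsNormalPseudomanifold (K : SComplex) (d : ℕ) : Prop :=
  K.IsPure d ∧ K.StronglyConnected ∧
    (∀ s ∈ K.faces, s.card = d →
      (K.faces.filter fun F => F.card = d + 1 ∧ s ⊆ F).card = 2) ∧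
    (∀ s ∈ K.faces, s.card ≤ d - 1 → (K.lk s).Conn)

/-- The geometric realization `|K|`, as a subspace of `ℕ → ℝ`. -/
def realSpace (K : SComplex) : Set (ℕ → ℝ) :=
  {w | (∀ v, 0 ≤ w v) ∧ ∃ s ∈ K.faces, (∀ v, w v ≠ 0 → v ∈ s) ∧ ∑ v ∈ s, w v = 1}

/-- The link of the vertex `v` triangulates the `(d-1)`-sphere. -/
def HasSphereLink (K : SComplex) (d : ℕ) (v : ℕ) : Prop :=
  Nonempty (↥((K.lk {v}).realSpace) ≃ₜ
    ↥(Metric.sphere (0 : EuclideanSpace ℝ (Fin d)) 1))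

/-- A singular vertex of a normal 3-pseudomanifold: its link is not a 2-sphere. -/
def IsSingular (K : SComplex) (v : ℕ) : Prop :=
  {v} ∈ K.faces ∧ ¬ K.HasSphereLink 3 v

/-- `d(σ)`: the number of vertices of the link of `σ`. -/
def deg (K : SComplex) (σ : Finset ℕ) : ℕ := (K.lk σ).fnum 0

/-- The boundary complex of the simplex on vertex set `s`: all nonempty proper subsets. -/
def properFaces (s : Finset ℕ) : Finset (Finset ℕ) :=
  s.powerset.filter fun t => t ≠ ∅ ∧ t ≠ s

/-- All nonempty faces of the simplex on vertex set `s`. -/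
def simplexFaces (s : Finset ℕ) : Finset (Finset ℕ) :=
  s.powerset.filter fun t => t ≠ ∅

/-- Operation (A): a bistellar 2-move on an edge `uv` with `lk(uv) = ∂(abc)`, `abc ∉ K`. -/
def BistellarTwoMove (K K' : SComplex) : Prop :=
  ∃ u v a b c : ℕ,
    ({u, v} : Finset ℕ) ∈ K.faces ∧ u ≠ v ∧
    ({a, b, c} : Finset ℕ).card = 3 ∧
    u ∉ ({a, b, c} : Finset ℕ) ∧ v ∉ ({a, b, c} : Finset ℕ) ∧
    (K.lk {u, v}).faces = properFaces {a, b, c} ∧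
    ({a, b, c} : Finset ℕ) ∉ K.faces ∧
    K'.faces = ((K.faces.filter fun α => ¬ ({u, v} : Finset ℕ) ⊆ α) ∪
      simplexFaces (insert u {a, b, c})) ∪ simplexFaces (insert v {a, b, c})

/-- The faces of the boundary complex of a pure `d`-dimensional complex with face set `F`:
faces contained in some `(d-1)`-face lying in exactly one facet. -/
def bdryFaces (F : Finset (Finset ℕ)) (d : ℕ) : Finset (Finset ℕ) :=
  F.filter fun s => ∃ r ∈ F, s ⊆ r ∧ r.card = d ∧
    (F.filter fun t => t.card = d + 1 ∧ r ⊆ t).card = 1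

/-- The faces of the cone with apex `w` over the complex with face set `F`. -/
def coneFaces (w : ℕ) (F : Finset (Finset ℕ)) : Finset (Finset ℕ) :=
  (F ∪ F.image (insert w)) ∪ {{w}}

/-- `K₁` is obtained from the normal `d`-pseudomanifold `K` by contracting the
edge `uv` (satisfying the link condition): delete all faces containing `u` or `v`
and cone off the boundary of the result with a new vertex `w`. -/
def EdgeContractionAt (d : ℕ) (K : SComplex) (u v : ℕ) (K₁ : SComplex) : Prop :=
  ({u, v} : Finset ℕ) ∈ K.faces ∧ u ≠ v ∧
  (K.lk {u}).faces ∩ (K.lk {v}).faces = (K.lk {u, v}).faces ∧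
  ∃ w, w ∉ K.vertexSet ∧
    K₁.faces = (K.faces.filter fun α => u ∉ α ∧ v ∉ α) ∪
      coneFaces w (bdryFaces (K.faces.filter fun α => u ∉ α ∧ v ∉ α) d)

/-- Operation (B): an edge contraction in a 3-dimensional complex. -/
def EdgeContraction (K K₁ : SComplex) : Prop := ∃ u v, EdgeContractionAt 3 K u v K₁

/-- The class `R`: normal 3-pseudomanifolds with one or two singular vertices such that
(i) if `K` contains the boundary of a 3-simplex then it contains the 3-simplex and
(ii) no normal 3-pseudomanifold with smaller `g₂` is obtained from `K` by a
bistellar 2-move, an edge contraction, an edge expansion followed by a bistellar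
2-move, or an edge expansion followed by an edge contraction. -/
def InClassR (K : SComplex) : Prop :=
  K.IsNormalPseudomanifold 3 ∧
  1 ≤ {v | K.IsSingular v}.ncard ∧ {v | K.IsSingular v}.ncard ≤ 2 ∧
  (∀ s : Finset ℕ, s.card = 4 → (∀ t ∈ properFaces s, t ∈ K.faces) → s ∈ K.faces) ∧
  (∀ K' : SComplex, K'.IsNormalPseudomanifold 3 →
    (BistellarTwoMove K K' ∨ EdgeContraction K K' ∨
      (∃ M, EdgeContraction M K ∧ BistellarTwoMove M K') ∨
      (∃ M, EdgeContraction M K ∧ EdgeContraction M K')) →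
    K.g2 ≤ K'.g2)

/-- A covering map onto a space homeomorphic to the 2-sphere has a continuous section. -/
theorem sphere_section {E X : Type*} [TopologicalSpace E] [TopologicalSpace X] {p : E → X}
    (hp : IsCoveringMap p) (f : X ≃ₜ Metric.sphere (0 : EuclideanSpace ℝ (Fin 3)) 1) (e₀ : E) :
    ∃ s : X → E, Continuous s ∧ ∀ x, p (s x) = x := by
  classical
  have : Fact (Module.finrank ℝ (EuclideanSpace ℝ (Fin 3)) = 2 + 1) :=
    ⟨by simp⟩
  set b := f (p e₀) with hb
  -- two antipodal-free points
  obtain ⟨N, S, hNS, hN, hS⟩ : ∃ N S : Metric.sphere (0 : EuclideanSpace ℝ (Fin 3)) 1,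
      N ≠ S ∧ N ≠ b ∧ S ≠ b := by
    have hmem : ∀ i, EuclideanSpace.single i (1:ℝ) ∈
        Metric.sphere (0 : EuclideanSpace ℝ (Fin 3)) 1 := by
      intro i; simp
    let e : Fin 3 → Metric.sphere (0 : EuclideanSpace ℝ (Fin 3)) 1 := fun i =>
      ⟨EuclideanSpace.single i (1:ℝ), hmem i⟩
    have he : ∀ i j, i ≠ j → e i ≠ e j := by
      intro i j hij h
      have h1 : EuclideanSpace.single i (1:ℝ) = EuclideanSpace.single j (1:ℝ) :=
        congrArg Subtype.val h
      have h2 := congrArg (fun v : EuclideanSpace ℝ (Fin 3) => v i) h1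
      simp [hij] at h2
    by_cases h0 : e 0 = b
    · exact ⟨e 1, e 2, he _ _ (by decide), h0 ▸ he _ _ (by decide), h0 ▸ he _ _ (by decide)⟩
    · by_cases h1 : e 1 = b
      · exact ⟨e 0, e 2, he _ _ (by decide), h0, h1 ▸ he _ _ (by decide)⟩
      · exact ⟨e 0, e 1, he _ _ (by decide), h0, h1⟩
  have key : ∀ Q : Metric.sphere (0 : EuclideanSpace ℝ (Fin 3)) 1, Q ≠ b →
      ∃ g : Metric.sphere (0 : EuclideanSpace ℝ (Fin 3)) 1 → E,
        ContinuousOn g {Q}ᶜ ∧ (∀ y, y ≠ Q → p (g y) = f.symm y) ∧ g b = e₀ := by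
    intro Q hQ
    let st := stereographic' 2 Q
    have hst : ∀ y, y ≠ Q → st.symm (st y) = y := by
      intro y hy
      apply st.left_inv
      simpa [st] using hy
    have hcs : Continuous st.symm := by
      rw [← continuousOn_univ]
      have := st.continuousOn_symm
      simpa [st] using this
    let j : C(EuclideanSpace ℝ (Fin 2), X) := ⟨fun z => f.symm (st.symm z), by fun_prop⟩
    obtain ⟨F, ⟨hF0, hF⟩, -⟩ := hp.existsUnique_continuousMap_lifts j (st b) e₀ (by
      change p e₀ = f.symm (st.symm (st b))
      rw [hst b hQ.symm, hb]; simp)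
    refine ⟨fun y => F (st y), ?_, ?_, hF0⟩
    · refine F.continuous.comp_continuousOn ?_
      have := st.continuousOn
      simpa [st] using this
    · intro y hy
      have := congrFun hF (st y)
      simp only [Function.comp_apply] at this
      rw [this]
      simp [j, hst y hy]
  obtain ⟨g₁, c₁, p₁, b₁⟩ := key N hN
  obtain ⟨g₂, c₂, p₂, b₂⟩ := key S hS
  have hpre : IsPreconnected ({N, S}ᶜ : Set (Metric.sphere (0 : EuclideanSpace ℝ (Fin 3)) 1)) := by
    let st := stereographic' 2 N
    have hcs : Continuous st.symm := by
      rw [← continuousOn_univ]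
      have := st.continuousOn_symm
      simpa [st] using this
    have h1 : IsPreconnected ({st S}ᶜ : Set (EuclideanSpace ℝ (Fin 2))) :=
      (isConnected_compl_singleton_of_one_lt_rank (by
        rw [← Module.finrank_eq_rank]; simp) _).isPreconnected
    have h2 := h1.image st.symm hcs.continuousOn
    have himg : st.symm '' ({st S}ᶜ) = {N, S}ᶜ := by
      ext y
      simp only [Set.mem_image, Set.mem_compl_iff, Set.mem_singleton_iff, Set.mem_insert_iff,
        not_or]
      have hsrc : st.source = {N}ᶜ := by simp [st]
      have htg : st.target = Set.univ := by simp [st]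
      constructor
      · rintro ⟨z, hz, rfl⟩
        constructor
        · intro h
          have := st.map_target (x := z) (by simp [htg])
          rw [hsrc] at this
          exact this h
        · intro h
          apply hz
          rw [← h, st.right_inv (by simp [htg])]
      · rintro ⟨h3, h4⟩
        refine ⟨st y, ?_, st.left_inv (by rw [hsrc]; exact h3)⟩
        intro h
        apply h4
        have h5 := congrArg st.symm h
        rwa [st.left_inv (by rw [hsrc]; exact h3),
          st.left_inv (by rw [hsrc]; exact hNS.symm)] at h5
    rwa [himg] at h2
  have heq : Set.EqOn g₁ g₂ ({N, S}ᶜ) := by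
    refine hp.eqOn_of_comp_eqOn hpre (c₁.mono ?_) (c₂.mono ?_) ?_ (a := b) ?_ (b₁.trans b₂.symm)
    · intro y hy; simp_all
    · intro y hy; simp_all
    · intro y hy
      simp only [Set.mem_compl_iff, Set.mem_insert_iff, Set.mem_singleton_iff, not_or] at hy
      simp [p₁ y hy.1, p₂ y hy.2]
    · simp [hN.symm, hS.symm]
  let g : Metric.sphere (0 : EuclideanSpace ℝ (Fin 3)) 1 → E := fun y => if y = N then g₂ y else g₁ y
  have hg1 : Set.EqOn g g₁ {N}ᶜ := by
    intro y hy
    have hy' : y ≠ N := hy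
    simp [g, hy']
  have hg2 : Set.EqOn g g₂ {S}ᶜ := by
    intro y hy
    have hy' : y ≠ S := hy
    by_cases h : y = N
    · simp [g, h]
    · simp only [g, h, if_false]
      exact heq (by simp [h, hy'])
  have hgc : Continuous g := by
    rw [continuous_iff_continuousAt]
    intro y
    by_cases h : y = N
    · have hy : y ∈ ({S}ᶜ : Set _) := by rw [h]; exact hNS
      exact ((c₂.congr hg2).continuousAt (isOpen_compl_singleton.mem_nhds hy))
    · have hy : y ∈ ({N}ᶜ : Set _) := h
      exact ((c₁.congr hg1).continuousAt (isOpen_compl_singleton.mem_nhds hy))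
  refine ⟨fun x => g (f x), by fun_prop, ?_⟩
  intro x
  change p (g (f x)) = x
  by_cases h : f x = N
  · rw [hg2 (x := f x) (by rw [h]; exact hNS), p₂ _ (by rw [h]; exact hNS)]; simp
  · rw [hg1 h, p₁ _ h]; simp

/-- The total space of the double cover associated with a `ℤ/2`-valued 1-cocycle. -/
def coverSet (L : SComplex) (c : ℕ → ℕ → ZMod 2) : Set (ℕ × ZMod 2 → ℝ) :=
  {w | (fun p => w (p, 0) + w (p, 1)) ∈ L.realSpace ∧
    ∀ p i q j, w (p, i) ≠ 0 → w (q, j) ≠ 0 → j = i + c p q}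

/-- The covering projection. -/
def coverProj (L : SComplex) (c : ℕ → ℕ → ZMod 2) (w : coverSet L c) : L.realSpace :=
  ⟨fun p => w.1 (p, 0) + w.1 (p, 1), w.2.1⟩

theorem zmod2_cases (i : ZMod 2) : i = 0 ∨ i = 1 := by
  revert i; decide

/-- lifting a point of the base over the open star of `p`. -/
noncomputable def liftPt (c : ℕ → ℕ → ZMod 2) (p : ℕ) (i : ZMod 2) (w : ℕ → ℝ) :
    ℕ × ZMod 2 → ℝ := fun x => if x.2 = i + c p x.1 then w x.1 else 0

theorem liftPt_sum (c : ℕ → ℕ → ZMod 2) (p : ℕ) (i : ZMod 2) (w : ℕ → ℝ) :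
    (fun q => liftPt c p i w (q, 0) + liftPt c p i w (q, 1)) = w := by
  funext q
  unfold liftPt
  rcases zmod2_cases (i + c p q) with h | h <;> simp [h]

theorem supp_face {L : SComplex} {w : ℕ → ℝ} (hw : w ∈ L.realSpace) :
    ∃ s ∈ L.faces, ∀ v, w v ≠ 0 → v ∈ s := by
  obtain ⟨_, s, hs, h, _⟩ := hw
  exact ⟨s, hs, h⟩

theorem liftPt_mem {L : SComplex} {c : ℕ → ℕ → ZMod 2}
    (hc : ∀ s ∈ L.faces, ∀ p ∈ s, ∀ q ∈ s, ∀ r ∈ s, c p q + c q r = c p r)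
    {p : ℕ} {w : ℕ → ℝ} (hw : w ∈ L.realSpace) (hp : 0 < w p) (i : ZMod 2) :
    liftPt c p i w ∈ coverSet L c := by
  refine ⟨?_, ?_⟩
  · rw [liftPt_sum]; exact hw
  · obtain ⟨s, hs, h⟩ := supp_face hw
    intro q j q' j' h1 h2
    unfold liftPt at h1 h2
    simp only [ne_eq, ite_eq_right_iff, Classical.not_imp] at h1 h2
    rw [h1.1, h2.1, ← hc s hs p (h p hp.ne') q (h q h1.2) q' (h q' h2.2)]
    ring

theorem cover_nonzero {L : SComplex} {c : ℕ → ℕ → ZMod 2} (w : coverSet L c) {p : ℕ}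
    (hp : 0 < (coverProj L c w).1 p) : w.1 (p, 0) ≠ 0 ∨ w.1 (p, 1) ≠ 0 := by
  by_contra hcon
  push Not at hcon
  simp [coverProj, hcon.1, hcon.2] at hp

theorem cover_cpp {L : SComplex} {c : ℕ → ℕ → ZMod 2}
    (hc : ∀ s ∈ L.faces, ∀ p ∈ s, ∀ q ∈ s, ∀ r ∈ s, c p q + c q r = c p r)
    {w : ℕ → ℝ} (hw : w ∈ L.realSpace) {p : ℕ} (hp : 0 < w p) : c p p = 0 := by
  obtain ⟨s, hs, h⟩ := supp_face hw
  have := hc s hs p (h p hp.ne') p (h p hp.ne') p (h p hp.ne')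
  simpa using this

theorem cover_eq_liftPt {L : SComplex} {c : ℕ → ℕ → ZMod 2} (w : coverSet L c) {p : ℕ}
    {i : ZMod 2} (hi : w.1 (p, i) ≠ 0) : w.1 = liftPt c p i (coverProj L c w).1 := by
  funext ⟨q, j⟩
  simp only [liftPt, coverProj]
  have key : ∀ j, w.1 (q, j) ≠ 0 → j = i + c p q := fun j hj => w.2.2 p i q j hi hj
  rcases zmod2_cases (i + c p q) with h | h <;> rw [h] at key ⊢
  · have h1 : w.1 (q, 1) = 0 := by
      by_contra h2; exact absurd (key 1 h2) (by decide)
    rcases zmod2_cases j with rfl | rfl <;> simp [h1]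
  · have h1 : w.1 (q, 0) = 0 := by
      by_contra h2; exact absurd (key 0 h2) (by decide)
    rcases zmod2_cases j with rfl | rfl <;> simp [h1]

theorem cover_isCovering (L : SComplex) (c : ℕ → ℕ → ZMod 2)
    (hc : ∀ s ∈ L.faces, ∀ p ∈ s, ∀ q ∈ s, ∀ r ∈ s, c p q + c q r = c p r) :
    IsCoveringMap (coverProj L c) := by
  classical
  have hcont : Continuous (coverProj L c) := by
    unfold coverProj
    exact Continuous.subtype_mk (continuous_pi fun p =>
      ((continuous_apply (p, (0 : ZMod 2))).comp continuous_subtype_val).add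
        ((continuous_apply (p, (1 : ZMod 2))).comp continuous_subtype_val)) _
  intro x
  obtain ⟨p, hp⟩ : ∃ p, 0 < x.1 p := by
    by_contra hcon
    push Not at hcon
    obtain ⟨h0, s, _, _, hsum⟩ := x.2
    have : ∑ v ∈ s, x.1 v ≤ 0 := Finset.sum_nonpos (fun v _ => hcon v)
    linarith
  apply IsEvenlyCovered.to_isEvenlyCovered_preimage (I := ZMod 2)
  have hUo : IsOpen {y : L.realSpace | 0 < y.1 p} :=
    isOpen_lt continuous_const ((continuous_apply p).comp continuous_subtype_val)
  refine ⟨inferInstance, {y | 0 < y.1 p}, hp, hUo, hUo.preimage hcont, ?_⟩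
  let idx : (coverProj L c ⁻¹' {y | 0 < y.1 p}) → ZMod 2 := fun w =>
    if w.1.1 (p, 0) ≠ 0 then 0 else 1
  have hidx : ∀ w : (coverProj L c ⁻¹' {y | 0 < y.1 p}), w.1.1 (p, idx w) ≠ 0 := by
    intro w
    by_cases h : w.1.1 (p, 0) ≠ 0
    · simp only [idx, if_pos h]; exact h
    · simp only [idx, if_neg h]
      exact (cover_nonzero w.1 w.2).resolve_left h
  have hidx' : ∀ (w : (coverProj L c ⁻¹' {y | 0 < y.1 p})) (i : ZMod 2), w.1.1 (p, i) ≠ 0 → idx w = i := by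
    intro w i hi
    have h1 := w.1.2.2 p i p (idx w) hi (hidx w)
    rw [cover_cpp hc (coverProj L c w.1).2 w.2] at h1
    simpa using h1
  have hidxc : Continuous idx := by
    rw [continuous_discrete_rng]
    intro i
    have : idx ⁻¹' {i} = {w | w.1.1 (p, i) ≠ 0} := by
      ext w
      simp only [Set.mem_preimage, Set.mem_singleton_iff, Set.mem_ofPred_eq]
      exact ⟨fun h => h ▸ hidx w, hidx' w i⟩
    rw [this]
    exact isOpen_ne_fun ((continuous_apply (p, i)).comp (continuous_subtype_val.comp continuous_subtype_val)) continuous_const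
  refine ⟨{ toFun := fun w => (⟨coverProj L c w.1, w.2⟩, idx w)
            invFun := fun y => ⟨⟨liftPt c p y.2 y.1.1.1, liftPt_mem hc y.1.1.2 y.1.2 y.2⟩, ?_⟩
            left_inv := ?_
            right_inv := ?_
            continuous_toFun := ?_
            continuous_invFun := ?_ }, fun w => rfl⟩
  · change 0 < liftPt c p y.2 y.1.1.1 (p, 0) + liftPt c p y.2 y.1.1.1 (p, 1)
    have := congrFun (liftPt_sum c p y.2 y.1.1.1) p
    rw [this]; exact y.1.2
  · intro w
    apply Subtype.ext
    apply Subtype.ext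
    exact (cover_eq_liftPt w.1 (hidx w)).symm
  · rintro ⟨y, i⟩
    have hcpp := cover_cpp hc y.1.2 y.2
    refine Prod.ext ?_ ?_
    · apply Subtype.ext
      apply Subtype.ext
      exact liftPt_sum c p i y.1.1
    · apply hidx'
      have hy : 0 < y.1.1 p := y.2
      simp [liftPt, hcpp, hy.ne']
  · exact Continuous.prodMk (Continuous.subtype_mk (hcont.comp continuous_subtype_val) _) hidxc
  · refine Continuous.subtype_mk (Continuous.subtype_mk ?_ _) _
    rw [continuous_pi_iff]
    rintro ⟨q, j⟩
    rw [continuous_iff_continuousAt]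
    rintro ⟨y, i⟩
    simp only [liftPt]
    have : Continuous fun z : ({y : L.realSpace | 0 < y.1 p}) × ZMod 2 =>
      (if j = z.2 + c p q then (1:ℝ) else 0) * z.1.1.1 q := by
      refine Continuous.mul ?_ ((continuous_apply q).comp (continuous_subtype_val.comp (continuous_subtype_val.comp continuous_fst)))
      exact (continuous_of_discreteTopology (f := fun i : ZMod 2 =>
        (if j = i + c p q then (1:ℝ) else 0))).comp continuous_snd
    refine ContinuousAt.congr this.continuousAt (Filter.Eventually.of_forall ?_)
    intro z
    simp

/-- `H¹(L; ℤ/2) = 0` for a triangulated 2-sphere. -/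
theorem sphere_cocycle (L : SComplex) (c : ℕ → ℕ → ZMod 2)
    (hc : ∀ s ∈ L.faces, ∀ p ∈ s, ∀ q ∈ s, ∀ r ∈ s, c p q + c q r = c p r)
    (f : L.realSpace ≃ₜ Metric.sphere (0 : EuclideanSpace ℝ (Fin 3)) 1) :
    ∃ g : ℕ → ZMod 2, ∀ s ∈ L.faces, ∀ p ∈ s, ∀ q ∈ s, c p q = g p + g q := by
  classical
  have hcov := cover_isCovering L c hc
  -- points of the realization
  have hvert : ∀ p, {p} ∈ L.faces → Pi.single p (1:ℝ) ∈ L.realSpace := by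
    intro p hp
    refine ⟨?_, {p}, hp, ?_, ?_⟩
    · intro v
      by_cases h : v = p
      · subst h; simp
      · simp [h]
    · intro v hv
      by_contra h
      simp at h
      simp [h] at hv
    · simp
  obtain ⟨x0⟩ : Nonempty L.realSpace := by
    obtain ⟨y⟩ : Nonempty (Metric.sphere (0 : EuclideanSpace ℝ (Fin 3)) 1) :=
      ⟨⟨EuclideanSpace.single 0 1, by simp⟩⟩
    exact ⟨f.symm y⟩
  obtain ⟨p0, hp0⟩ : ∃ p, 0 < x0.1 p := by
    by_contra hcon
    push Not at hcon
    obtain ⟨h0, s, _, _, hsum⟩ := x0.2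
    have : ∑ v ∈ s, x0.1 v ≤ 0 := Finset.sum_nonpos (fun v _ => hcon v)
    linarith
  obtain ⟨s, hs, hps⟩ := sphere_section hcov f ⟨_, liftPt_mem hc x0.2 hp0 0⟩
  -- the sheet over the open star of `p` picked by the section
  have hsheet : ∀ p, ∃ i : ZMod 2, ∀ x : L.realSpace, 0 < x.1 p → (s x).1 (p, i) ≠ 0 := by
    intro p
    by_cases hp : {p} ∈ L.faces
    swap
    · refine ⟨0, fun x hx => (hp ?_).elim⟩
      obtain ⟨t, ht, h⟩ := supp_face x.2
      exact L.down_closed t ht {p} (by simpa using h p hx.ne') (by simp)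
    let v : L.realSpace := ⟨Pi.single p 1, hvert p hp⟩
    have hv : 0 < v.1 p := by simp [v]
    have hnz : ∀ x : L.realSpace, 0 < x.1 p → (s x).1 (p, 0) ≠ 0 ∨ (s x).1 (p, 1) ≠ 0 := by
      intro x hx
      apply cover_nonzero
      rw [hps]; exact hx
    have huniq : ∀ x : L.realSpace, 0 < x.1 p → ∀ i j, (s x).1 (p, i) ≠ 0 →
        (s x).1 (p, j) ≠ 0 → j = i := by
      intro x hx i j hi hj
      have := (s x).2.2 p i p j hi hj
      rw [cover_cpp hc x.2 hx] at this
      simpa using this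
    obtain ⟨i, hi⟩ : ∃ i, (s v).1 (p, i) ≠ 0 := by
      rcases hnz v hv with h | h
      exacts [⟨_, h⟩, ⟨_, h⟩]
    refine ⟨i, fun x hx => ?_⟩
    -- the segment from `v` to `x`
    have hseg : ∀ t : unitInterval, (fun q => (1 - t.1) * x.1 q + t.1 * v.1 q) ∈ L.realSpace := by
      intro t
      obtain ⟨h0, u, hu, hsupp, hsum⟩ := x.2
      have hpu : p ∈ u := hsupp p hx.ne'
      have ht0 := t.2.1
      have ht1 := t.2.2
      refine ⟨?_, u, hu, ?_, ?_⟩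
      · intro q
        have := h0 q
        have h2 := (hvert p hp).1 q
        have : 0 ≤ (1 - t.1) * x.1 q := mul_nonneg (by linarith) this
        have : 0 ≤ t.1 * v.1 q := mul_nonneg ht0 h2
        linarith
      · intro q hq
        by_contra hqu
        have h1 : x.1 q = 0 := by
          by_contra h; exact hqu (hsupp q h)
        have h2 : q ≠ p := by rintro rfl; exact hqu hpu
        simp [h1, v, h2] at hq
      · rw [Finset.sum_add_distrib, ← Finset.mul_sum, ← Finset.mul_sum, hsum]
        have : ∑ q ∈ u, v.1 q = 1 := by
          simp [v, Finset.sum_pi_single', hpu]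
        rw [this]; ring
    let γ : unitInterval → L.realSpace := fun t => ⟨_, hseg t⟩
    have hγ : Continuous γ := by
      refine Continuous.subtype_mk ?_ _
      rw [continuous_pi_iff]; intro q; fun_prop
    have hγp : ∀ t, 0 < (γ t).1 p := by
      intro t
      have ht0 := t.2.1
      have ht1 := t.2.2
      change 0 < (1 - t.1) * x.1 p + t.1 * v.1 p
      have : v.1 p = 1 := by simp [v]
      rw [this]
      rcases eq_or_lt_of_le ht0 with h | h
      · rw [← h]; simpa using hx
      · have : 0 ≤ (1 - t.1) * x.1 p := mul_nonneg (by linarith) hx.le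
        linarith
    let A : Set unitInterval := {t | (s (γ t)).1 (p, i) ≠ 0}
    have hAo : IsOpen A := by
      refine isOpen_ne_fun ?_ continuous_const
      have : Continuous fun t => (s (γ t)).1 := continuous_subtype_val.comp (hs.comp hγ)
      exact (continuous_apply (p, i)).comp this
    have hAc : IsClosed A := by
      constructor
      have : Aᶜ = {t | (s (γ t)).1 (p, i + 1) ≠ 0} := by
        ext t
        simp only [A, Set.mem_compl_iff, Set.mem_ofPred_eq, not_not]
        constructor
        · intro h h'
          rcases hnz _ (hγp t) with h3 | h3 <;> rcases zmod2_cases i with rfl | rfl <;>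
            simp_all [show (1:ZMod 2) + 1 = 0 from by decide]
        · intro h
          by_contra h'
          have := huniq _ (hγp t) _ _ h h'
          rcases zmod2_cases i with rfl | rfl <;> revert this <;> decide
      rw [this]
      refine isOpen_ne_fun ?_ continuous_const
      have : Continuous fun t => (s (γ t)).1 := continuous_subtype_val.comp (hs.comp hγ)
      exact (continuous_apply (p, i + 1)).comp this
    have hA : A = Set.univ := by
      refine IsClopen.eq_univ ⟨hAc, hAo⟩ ⟨1, ?_⟩
      have : γ 1 = v := by
        apply Subtype.ext
        funext q
        simp [γ]
      simp only [A, Set.mem_ofPred_eq, this]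
      exact hi
    have h0 : (0 : unitInterval) ∈ A := hA ▸ Set.mem_univ _
    have : γ 0 = x := by
      apply Subtype.ext
      funext q
      simp [γ]
    simpa only [A, Set.mem_ofPred_eq, this] using h0
  choose g hg using hsheet
  refine ⟨g, fun t ht p hpt q hqt => ?_⟩
  -- a point in the interior of the edge
  have hx : (fun r => (Pi.single p (1:ℝ) r + Pi.single q (1:ℝ) r) / 2) ∈ L.realSpace := by
    refine ⟨?_, t, ht, ?_, ?_⟩
    · intro r
      have h1 : (0:ℝ) ≤ Pi.single (M := fun _ => ℝ) p (1:ℝ) r := by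
        by_cases h : r = p
        · subst h; simp
        · simp [h]
      have h2 : (0:ℝ) ≤ Pi.single (M := fun _ => ℝ) q (1:ℝ) r := by
        by_cases h : r = q
        · subst h; simp
        · simp [h]
      positivity
    · intro r hr
      by_contra hrt
      have h1 : r ≠ p := by rintro rfl; exact hrt hpt
      have h2 : r ≠ q := by rintro rfl; exact hrt hqt
      simp [h1, h2] at hr
    · rw [← Finset.sum_div, Finset.sum_add_distrib]
      simp [Finset.sum_pi_single', hpt, hqt]
  have h1 := hg p ⟨_, hx⟩ (by
    by_cases h : p = q
    · subst h; simp
    · simp [h])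
  have h2 := hg q ⟨_, hx⟩ (by
    by_cases h : q = p
    · subst h; simp
    · simp [h])
  have h3 := (s ⟨_, hx⟩).2.2 p (g p) q (g q) h1 h2
  rw [h3]
  have : g p + g p = 0 := by
    generalize g p = i
    revert i; decide
  rw [← add_assoc, this, zero_add]

/-- `s` is a subset of some member of `T`. -/
def Fc (T : Finset (Finset ℕ)) (s : Finset ℕ) : Prop := ∃ F ∈ T, s ⊆ F

theorem Fc.mono {T : Finset (Finset ℕ)} {s t : Finset ℕ} (h : Fc T t) (hs : s ⊆ t) : Fc T s := by
  obtain ⟨F, hF, hF'⟩ := h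
  exact ⟨F, hF, hs.trans hF'⟩

/-- adjacency in the link of `σ` -/
def LA (T : Finset (Finset ℕ)) (σ : Finset ℕ) (a b : ℕ) : Prop :=
  a ∉ σ ∧ b ∉ σ ∧ Fc T (insert a (insert b σ))

/-- A family of tetrahedra that form a normal 3-pseudomanifold. -/
structure Good (T : Finset (Finset ℕ)) : Prop where
  ne : T.Nonempty
  card4 : ∀ F ∈ T, F.card = 4
  two : ∀ F ∈ T, ∀ r ⊆ F, r.card = 3 → ∃ G ∈ T, G ≠ F ∧ r ⊆ G ∧ ∀ H ∈ T, r ⊆ H → H = F ∨ H = G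
  conn : ∀ σ : Finset ℕ, σ.card ≤ 2 → ∀ p q, p ∉ σ → q ∉ σ → Fc T (insert p σ) →
    Fc T (insert q σ) → Relation.ReflTransGen (LA T σ) p q

/-- The complex generated by a family of sets. -/
def gen (T : Finset (Finset ℕ)) : SComplex where
  faces := (T.biUnion Finset.powerset).filter fun s => s ≠ ∅
  not_empty_mem := by simp
  down_closed := by
    intro s hs t hts ht
    simp only [Finset.mem_filter, Finset.mem_biUnion, Finset.mem_powerset] at hs ⊢
    obtain ⟨⟨F, hF, hsF⟩, _⟩ := hs
    exact ⟨⟨F, hF, hts.trans hsF⟩, ht⟩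

theorem mem_gen {T : Finset (Finset ℕ)} {s : Finset ℕ} :
    s ∈ (gen T).faces ↔ Fc T s ∧ s ≠ ∅ := by
  simp [gen, Fc]

theorem sc_ext {K L : SComplex} (h : ∀ s, s ∈ K.faces ↔ s ∈ L.faces) : K = L := by
  cases K; cases L
  simp only [SComplex.mk.injEq]
  exact Finset.ext h

theorem LA.symm {T : Finset (Finset ℕ)} {σ : Finset ℕ} {a b : ℕ} (h : LA T σ a b) : LA T σ b a :=
  ⟨h.2.1, h.1, by rw [Finset.insert_comm]; exact h.2.2⟩

theorem path_symm {α : Type*} {R : α → α → Prop} (hR : ∀ a b, R a b → R b a) {a b : α}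
    (h : Relation.ReflTransGen R a b) : Relation.ReflTransGen R b a :=
  by
  induction h with
  | refl => exact Relation.ReflTransGen.refl
  | tail _ hbc ih => exact Relation.ReflTransGen.head (hR _ _ hbc) ih

theorem path_mono {α : Type*} {R S : α → α → Prop} (hR : ∀ a b, R a b → S a b) {a b : α}
    (h : Relation.ReflTransGen R a b) : Relation.ReflTransGen S a b := by
  induction h with
  | refl => exact Relation.ReflTransGen.refl
  | tail _ hbc ih => exact ih.tail (hR _ _ hbc)

/-- Transfer of paths along a multivalued map. -/
theorem path_transfer {α β : Type*} {R : α → α → Prop} {S : β → β → Prop} {Rep : α → β → Prop}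
    (hex : ∀ x y, R x y → ∃ y', Rep y y')
    (hsame : ∀ x x' x'', Rep x x' → Rep x x'' → Relation.ReflTransGen S x' x'')
    (hstep : ∀ x y x' y', R x y → Rep x x' → Rep y y' → Relation.ReflTransGen S x' y')
    {x y : α} (h : Relation.ReflTransGen R x y) {x' y' : β} (hx : Rep x x') (hy : Rep y y') :
    Relation.ReflTransGen S x' y' := by
  induction h generalizing y' with
  | refl => exact hsame _ _ _ hx hy
  | tail hab hbc ih =>
    rename_i b c
    rcases Relation.ReflTransGen.cases_tail hab with h | ⟨d, hd, hdb⟩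
    · subst h
      exact hstep _ _ _ _ hbc hx hy
    · obtain ⟨b', hb'⟩ := hex _ _ hdb
      exact (ih hb').trans (hstep _ _ _ _ hbc hb' hy)

theorem isFacet_gen {T : Finset (Finset ℕ)} (h4 : ∀ F ∈ T, F.card = 4) {s : Finset ℕ} :
    (gen T).IsFacet s ↔ s ∈ T := by
  constructor
  · rintro ⟨h1, h2⟩
    obtain ⟨⟨F, hF, hs⟩, _⟩ := mem_gen.1 h1
    have := h2 F (mem_gen.2 ⟨⟨F, hF, subset_rfl⟩, ?_⟩) hs
    · exact this ▸ hF
    · rintro rfl; simpa using h4 _ hF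
  · intro hs
    refine ⟨mem_gen.2 ⟨⟨s, hs, subset_rfl⟩, ?_⟩, ?_⟩
    · rintro rfl; simpa using h4 _ hs
    · intro t ht hst
      obtain ⟨⟨F, hF, htF⟩, _⟩ := mem_gen.1 ht
      have : s = F := Finset.eq_of_subset_of_card_le (hst.trans htF) (by rw [h4 _ hs, h4 _ hF])
      subst this
      exact hst.antisymm htF

theorem mem_of_card {T : Finset (Finset ℕ)} (h4 : ∀ F ∈ T, F.card = 4) {s : Finset ℕ}
    (h : Fc T s) (hs : 4 ≤ s.card) : s ∈ T := by
  obtain ⟨F, hF, hsF⟩ := h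
  rw [Finset.eq_of_subset_of_card_le hsF (by rw [h4 _ hF]; exact hs)]
  exact hF

theorem Fc.card_le {T : Finset (Finset ℕ)} (h4 : ∀ F ∈ T, F.card = 4) {s : Finset ℕ}
    (h : Fc T s) : s.card ≤ 4 := by
  obtain ⟨F, hF, hsF⟩ := h
  rw [← h4 _ hF]; exact Finset.card_le_card hsF

theorem mem_lk_gen {T : Finset (Finset ℕ)} {σ s : Finset ℕ} :
    s ∈ ((gen T).lk σ).faces ↔ s ≠ ∅ ∧ s ∩ σ = ∅ ∧ Fc T (s ∪ σ) := by
  simp only [lk, Finset.mem_filter, mem_gen]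
  constructor
  · rintro ⟨⟨_, h⟩, h1, h2, h3⟩
    exact ⟨h, h1, h2⟩
  · rintro ⟨h, h1, h2⟩
    exact ⟨⟨h2.mono Finset.subset_union_left, h⟩, h1, h2, by
      intro h3; exact h (Finset.union_eq_empty.1 h3).1⟩

theorem mem_lk_gen_singleton {T : Finset (Finset ℕ)} {σ : Finset ℕ} {p : ℕ} :
    {p} ∈ ((gen T).lk σ).faces ↔ p ∉ σ ∧ Fc T (insert p σ) := by
  rw [mem_lk_gen]
  simp [Finset.singleton_inter]

theorem vertAdj_lk_gen {T : Finset (Finset ℕ)} {σ : Finset ℕ} {p q : ℕ} :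
    ((gen T).lk σ).VertAdj p q ↔ LA T σ p q := by
  unfold VertAdj LA
  rw [mem_lk_gen]
  have e : ({p, q} : Finset ℕ) ∪ σ = insert p (insert q σ) := by
    ext x; simp
  rw [e]
  have : ({p, q} : Finset ℕ) ∩ σ = ∅ ↔ p ∉ σ ∧ q ∉ σ := by
    simp only [Finset.ext_iff, Finset.mem_inter, Finset.mem_insert, Finset.mem_singleton]
    constructor
    · intro h
      exact ⟨fun hp => by simpa using (h p).1 ⟨by simp, hp⟩,
        fun hp => by simpa using (h q).1 ⟨by simp, hp⟩⟩
    · rintro ⟨h1, h2⟩ a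
      constructor
      · rintro ⟨rfl | rfl, h⟩ <;> contradiction
      · simp
  rw [this]
  constructor
  · rintro ⟨_, ⟨h1, h2⟩, h3⟩; exact ⟨h1, h2, h3⟩
  · rintro ⟨h1, h2, h3⟩; exact ⟨by simp, ⟨h1, h2⟩, h3⟩

/-- the set of tetrahedra at a triangle -/
theorem two_card {T : Finset (Finset ℕ)} (h4 : ∀ F ∈ T, F.card = 4) (r : Finset ℕ) :
    ((gen T).faces.filter fun F => F.card = 3 + 1 ∧ r ⊆ F) = T.filter fun F => r ⊆ F := by
  ext F
  simp only [Finset.mem_filter, mem_gen]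
  constructor
  · rintro ⟨⟨h, _⟩, hc, hr⟩
    exact ⟨mem_of_card h4 h (by omega), hr⟩
  · rintro ⟨h, hr⟩
    refine ⟨⟨⟨F, h, subset_rfl⟩, ?_⟩, h4 _ h, hr⟩
    rintro rfl; simpa using h4 _ h

/-- star strong connectivity -/
def SC (T : Finset (Finset ℕ)) (σ : Finset ℕ) : Finset ℕ → Finset ℕ → Prop :=
  Relation.ReflTransGen fun F G => F ∈ T ∧ G ∈ T ∧ ∃ r, r.card = 3 ∧ σ ⊆ r ∧ r ⊆ F ∧ r ⊆ G

theorem SC.mono {T : Finset (Finset ℕ)} {σ τ : Finset ℕ} (h : σ ⊆ τ) {F G : Finset ℕ}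
    (hs : SC T τ F G) : SC T σ F G := by
  refine path_mono ?_ hs
  rintro a b ⟨h1, h2, r, h3, h4, h5, h6⟩
  exact ⟨h1, h2, r, h3, h.trans h4, h5, h6⟩

theorem Good.sc {T : Finset (Finset ℕ)} (hT : Good T) : ∀ (n : ℕ) (σ : Finset ℕ), σ.card + n = 3 →
    ∀ F ∈ T, ∀ G ∈ T, σ ⊆ F → σ ⊆ G → SC T σ F G := by
  intro n
  induction n with
  | zero =>
    intro σ hσ F hF G hG h1 h2
    exact Relation.ReflTransGen.single ⟨hF, hG, σ, by omega, subset_rfl, h1, h2⟩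
  | succ n ih =>
    intro σ hσ F hF G hG h1 h2
    have step : ∀ p, p ∉ σ → ∀ F ∈ T, ∀ G ∈ T, insert p σ ⊆ F → insert p σ ⊆ G → SC T σ F G := by
      intro p hp F hF G hG h1 h2
      exact (ih (insert p σ) (by rw [Finset.card_insert_of_notMem hp]; omega) F hF G hG h1 h2).mono
        (Finset.subset_insert _ _)
    obtain ⟨p, hpF, hp⟩ : ∃ p ∈ F, p ∉ σ :=
      Finset.exists_mem_notMem_of_card_lt_card (by rw [hT.card4 _ hF]; omega)
    obtain ⟨q, hqG, hq⟩ : ∃ p ∈ G, p ∉ σ :=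
      Finset.exists_mem_notMem_of_card_lt_card (by rw [hT.card4 _ hG]; omega)
    have hpath := hT.conn σ (by omega) p q hp hq
      ⟨F, hF, Finset.insert_subset hpF h1⟩ ⟨G, hG, Finset.insert_subset hqG h2⟩
    have : ∀ q, Relation.ReflTransGen (LA T σ) p q → ∀ G ∈ T, insert q σ ⊆ G → SC T σ F G := by
      intro q hpath
      induction hpath with
      | refl =>
        intro G hG h2
        exact step p hp F hF G hG (Finset.insert_subset hpF h1) h2
      | tail hab hbc ih2 =>
        rename_i b c
        intro G hG h3
        obtain ⟨hb, hc, H, hH, hHs⟩ := hbc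
        refine (ih2 H hH ?_).trans (step c hc H hH G hG ?_ h3)
        · refine subset_trans ?_ hHs
          exact Finset.insert_subset_insert _ (Finset.subset_insert _ _)
        · exact subset_trans (Finset.subset_insert _ _) hHs
    exact this q hpath G hG (Finset.insert_subset hqG h2)

theorem Good.npm {T : Finset (Finset ℕ)} (hT : Good T) : (gen T).IsNormalPseudomanifold 3 := by
  refine ⟨⟨?_, ?_⟩, ?_, ?_, ?_⟩
  · obtain ⟨F, hF⟩ := hT.ne
    refine ⟨F, mem_gen.2 ⟨⟨F, hF, subset_rfl⟩, ?_⟩⟩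
    rintro rfl; simpa using hT.card4 _ hF
  · intro s hs
    exact hT.card4 _ ((isFacet_gen hT.card4).1 hs)
  · intro F G hF hG
    rw [isFacet_gen hT.card4] at hF hG
    have := hT.sc 3 ∅ (by simp) F hF G hG (by simp) (by simp)
    unfold SC at this
    induction this with
    | refl => exact Relation.ReflTransGen.refl
    | tail hab hbc ih =>
      rename_i b c
      obtain ⟨hb, hc, r, hr, _, hrb, hrc⟩ := hbc
      refine (ih hb).trans ?_
      by_cases hbc : b = c
      · subst hbc; exact Relation.ReflTransGen.refl
      refine Relation.ReflTransGen.single ⟨(isFacet_gen hT.card4).2 hb, (isFacet_gen hT.card4).2 hc, ?_⟩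
      have h1 : 3 ≤ (b ∩ c).card := hr ▸ Finset.card_le_card (Finset.subset_inter hrb hrc)
      have h2 : (b ∩ c).card < 4 := by
        rw [← hT.card4 _ hb]
        apply Finset.card_lt_card
        refine ⟨Finset.inter_subset_left, fun h => hbc ?_⟩
        have := h.trans Finset.inter_subset_right
        exact Finset.eq_of_subset_of_card_le this (by rw [hT.card4 _ hb, hT.card4 _ hc])
      rw [hT.card4 _ hb]; omega
  · intro r hr hr3
    rw [two_card hT.card4]
    obtain ⟨⟨F, hF, hrF⟩, _⟩ := mem_gen.1 hr
    obtain ⟨G, hG, hGF, hrG, hall⟩ := hT.two F hF r hrF hr3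
    rw [Finset.card_eq_two]
    refine ⟨F, G, hGF.symm, ?_⟩
    ext H
    simp only [Finset.mem_filter, Finset.mem_insert, Finset.mem_singleton]
    constructor
    · rintro ⟨h1, h2⟩; exact hall H h1 h2
    · rintro (rfl | rfl)
      · exact ⟨hF, hrF⟩
      · exact ⟨hG, hrG⟩
  · intro σ hσ hσ2
    obtain ⟨⟨F, hF, hσF⟩, _⟩ := mem_gen.1 hσ
    constructor
    · obtain ⟨p, hpF, hp⟩ : ∃ p ∈ F, p ∉ σ :=
        Finset.exists_mem_notMem_of_card_lt_card (by rw [hT.card4 _ hF]; omega)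
      exact ⟨{p}, mem_lk_gen_singleton.2 ⟨hp, F, hF, Finset.insert_subset hpF hσF⟩⟩
    · intro p q hp hq
      rw [mem_lk_gen_singleton] at hp hq
      have := hT.conn σ hσ2 p q hp.1 hq.1 hp.2 hq.2
      exact path_mono (fun a b h => vertAdj_lk_gen.2 h) this

theorem exists_good {K : SComplex} (hK : K.IsNormalPseudomanifold 3) :
    ∃ T, Good T ∧ K = gen T := by
  obtain ⟨⟨hne, hpure⟩, hsc, htwo, hconn⟩ := hK
  have hface : ∀ n, ∀ s ∈ K.faces, K.faces.sup Finset.card ≤ s.card + n → ∃ F, K.IsFacet F ∧ s ⊆ F := by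
    intro n
    induction n with
    | zero =>
      intro s hs hn
      refine ⟨s, ⟨hs, fun t ht hst => ?_⟩, subset_rfl⟩
      exact Finset.eq_of_subset_of_card_le hst (le_trans (Finset.le_sup (f := Finset.card) ht) hn)
    | succ n ih =>
      intro s hs hn
      by_cases h : K.IsFacet s
      · exact ⟨s, h, subset_rfl⟩
      · have : ∃ t ∈ K.faces, s ⊆ t ∧ s ≠ t := by
          by_contra hcon
          push Not at hcon
          exact h ⟨hs, fun t ht hst => hcon t ht hst⟩
        obtain ⟨t, ht, hst, hst'⟩ := this
        have : s.card < t.card := Finset.card_lt_card (hst.ssubset_of_ne hst')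
        obtain ⟨F, hF, htF⟩ := ih t ht (by omega)
        exact ⟨F, hF, hst.trans htF⟩
  set T := K.faces.filter fun s => s.card = 4 with hTdef
  have h4 : ∀ F ∈ T, F.card = 4 := fun F hF => (Finset.mem_filter.1 hF).2
  have hKT : K = gen T := by
    apply sc_ext
    intro s
    rw [mem_gen]
    constructor
    · intro hs
      obtain ⟨F, hF, hsF⟩ := hface _ s hs (Nat.le_add_left _ _)
      refine ⟨⟨F, Finset.mem_filter.2 ⟨hF.1, hpure F hF⟩, hsF⟩, ?_⟩
      rintro rfl; exact K.not_empty_mem hs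
    · rintro ⟨⟨F, hF, hsF⟩, hs⟩
      exact K.down_closed F (Finset.mem_filter.1 hF).1 s hsF hs
  clear_value T
  subst hKT
  refine ⟨T, ?_, rfl⟩
  have hTne : T.Nonempty := by
    obtain ⟨s, hs⟩ := hne
    obtain ⟨⟨F, hF, _⟩, _⟩ := mem_gen.1 hs
    exact ⟨F, hF⟩
  have conn1 : ∀ σ : Finset ℕ, σ ≠ ∅ → σ.card ≤ 2 → ∀ p q, p ∉ σ → q ∉ σ → Fc T (insert p σ) →
    Fc T (insert q σ) → Relation.ReflTransGen (LA T σ) p q := by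
    intro σ hσ hσ2 p q hp hq hpT hqT
    have := (hconn σ (mem_gen.2 ⟨hpT.mono (Finset.subset_insert _ _), hσ⟩) hσ2).2 p q
      (mem_lk_gen_singleton.2 ⟨hp, hpT⟩) (mem_lk_gen_singleton.2 ⟨hq, hqT⟩)
    exact path_mono (fun a b h => vertAdj_lk_gen.1 h) this
  refine ⟨hTne, h4, ?_, ?_⟩
  · intro F hF r hrF hr
    have hc := htwo r (mem_gen.2 ⟨⟨F, hF, hrF⟩, by rintro rfl; simp at hr⟩) hr
    rw [two_card h4] at hc
    obtain ⟨A, B, hAB, hAB'⟩ := Finset.card_eq_two.1 hc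
    have hm : ∀ H, (H ∈ T ∧ r ⊆ H) ↔ (H = A ∨ H = B) := by
      intro H
      have := Finset.ext_iff.1 hAB' H
      simpa using this
    have hA := (hm A).2 (Or.inl rfl)
    have hB := (hm B).2 (Or.inr rfl)
    rcases (hm F).1 ⟨hF, hrF⟩ with rfl | rfl
    · exact ⟨B, hB.1, hAB.symm, hB.2, fun H h1 h2 => (hm H).1 ⟨h1, h2⟩⟩
    · exact ⟨A, hA.1, hAB, hA.2, fun H h1 h2 => ((hm H).1 ⟨h1, h2⟩).symm⟩
  · intro σ hσ2 p q hp hq hpT hqT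
    by_cases hσ : σ = ∅
    · subst hσ
      obtain ⟨F, hF, hpF⟩ := hpT
      obtain ⟨G, hG, hqG⟩ := hqT
      have hpF' : p ∈ F := hpF (by simp)
      have hqG' : q ∈ G := hqG (by simp)
      have adj : ∀ F ∈ T, ∀ a ∈ F, ∀ b ∈ F, LA T ∅ a b := by
        intro F hF a ha b hb
        refine ⟨by simp, by simp, F, hF, ?_⟩
        intro x hx
        simp at hx
        rcases hx with rfl | rfl <;> assumption
      have := hsc F G ((isFacet_gen h4).2 hF) ((isFacet_gen h4).2 hG)
      have key : ∀ G, Relation.ReflTransGen (gen T).FacetAdj F G → ∀ q ∈ G,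
          Relation.ReflTransGen (LA T ∅) p q := by
        intro G h
        induction h with
        | refl => intro q hq; exact Relation.ReflTransGen.single (adj F hF p hpF' q hq)
        | tail hab hbc ih =>
          rename_i b c
          intro q hq
          obtain ⟨hb, hc, hcard⟩ := hbc
          have hb4 := h4 b ((isFacet_gen h4).1 hb)
          obtain ⟨x, hx⟩ : (b ∩ c).Nonempty := by
            rw [← Finset.card_pos]; omega
          rw [Finset.mem_inter] at hx
          exact (ih x hx.1).tail (adj c ((isFacet_gen h4).1 hc) x hx.2 q hq)
      exact key G this q hqG'
    · exact conn1 σ hσ hσ2 p q hp hq hpT hqT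

instance (T : Finset (Finset ℕ)) : DecidablePred (Fc T) := fun s => by
  unfold Fc; infer_instance

/-- vertices of the link of `σ` -/
def nb (T : Finset (Finset ℕ)) (σ : Finset ℕ) : Finset ℕ :=
  (T.biUnion id).filter fun p => p ∉ σ ∧ Fc T (insert p σ)

theorem mem_nb {T : Finset (Finset ℕ)} {σ : Finset ℕ} {p : ℕ} :
    p ∈ nb T σ ↔ p ∉ σ ∧ Fc T (insert p σ) := by
  simp only [nb, Finset.mem_filter, Finset.mem_biUnion, id, and_iff_right_iff_imp]
  rintro ⟨_, F, hF, h⟩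
  exact ⟨F, hF, h (Finset.mem_insert_self _ _)⟩

theorem deg_gen (T : Finset (Finset ℕ)) (σ : Finset ℕ) : (gen T).deg σ = (nb T σ).card := by
  unfold deg fnum
  rw [← Finset.card_image_of_injective (nb T σ) (f := fun p => ({p} : Finset ℕ))
    (fun a b h => Finset.singleton_injective h)]
  congr 1
  ext s
  simp only [Finset.mem_filter, Finset.mem_image, zero_add]
  constructor
  · rintro ⟨h1, h2⟩
    obtain ⟨p, rfl⟩ := Finset.card_eq_one.1 h2
    exact ⟨p, mem_nb.2 (mem_lk_gen_singleton.1 h1), rfl⟩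
  · rintro ⟨p, hp, rfl⟩
    exact ⟨mem_lk_gen_singleton.2 (mem_nb.1 hp), by simp⟩

theorem fnum0_gen (T : Finset (Finset ℕ)) : (gen T).fnum 0 = (T.biUnion id).card := by
  unfold fnum
  rw [← Finset.card_image_of_injective (T.biUnion id) (f := fun p => ({p} : Finset ℕ))
    (fun a b h => Finset.singleton_injective h)]
  congr 1
  ext s
  simp only [Finset.mem_filter, Finset.mem_image, zero_add, mem_gen, Finset.mem_biUnion, id]
  constructor
  · rintro ⟨⟨⟨F, hF, h⟩, _⟩, h2⟩
    obtain ⟨p, rfl⟩ := Finset.card_eq_one.1 h2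
    exact ⟨p, ⟨F, hF, by simpa using h⟩, rfl⟩
  · rintro ⟨p, ⟨F, hF, h⟩, rfl⟩
    exact ⟨⟨⟨F, hF, by simpa using h⟩, by simp⟩, by simp⟩

/-- the edges -/
def edg (T : Finset (Finset ℕ)) : Finset (Finset ℕ) := (gen T).faces.filter fun s => s.card = 2

theorem mem_edg {T : Finset (Finset ℕ)} {e : Finset ℕ} : e ∈ edg T ↔ Fc T e ∧ e.card = 2 := by
  simp only [edg, Finset.mem_filter, mem_gen]
  constructor
  · rintro ⟨⟨h, _⟩, h2⟩; exact ⟨h, h2⟩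
  · rintro ⟨h, h2⟩; exact ⟨⟨h, by rintro rfl; simp at h2⟩, h2⟩

theorem fnum1_gen (T : Finset (Finset ℕ)) : (gen T).fnum 1 = (edg T).card := rfl

theorem edg_at (T : Finset (Finset ℕ)) (x : ℕ) :
    ((edg T).filter fun e => x ∈ e).card = (nb T {x}).card := by
  rw [← Finset.card_image_of_injOn (s := nb T {x}) (f := fun p => ({p, x} : Finset ℕ))]
  · congr 1
    ext e
    simp only [Finset.mem_filter, mem_edg, Finset.mem_image]
    constructor
    · rintro ⟨⟨h1, h2⟩, hx⟩
      obtain ⟨y, hy⟩ : ∃ y, e.erase x = {y} := by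
        rw [← Finset.card_eq_one, Finset.card_erase_of_mem hx, h2]
      have he : e = {y, x} := by
        rw [← Finset.insert_erase hx, hy, Finset.pair_comm]
      have hyx : y ≠ x := by
        rintro rfl; rw [he] at h2; simp at h2
      exact ⟨y, mem_nb.2 ⟨by simpa using hyx, he ▸ h1⟩, he.symm⟩
    · rintro ⟨p, hp, rfl⟩
      rw [mem_nb] at hp
      refine ⟨⟨hp.2, Finset.card_pair (by simpa using hp.1)⟩, by simp⟩
  · intro a ha b hb hab
    have ha' := (mem_nb.1 ha).1
    have : a ∈ ({b, x} : Finset ℕ) := by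
      have h : a ∈ ({a, x} : Finset ℕ) := by simp
      simpa using (Finset.ext_iff.1 hab a).1 h
    simp at this ha'
    exact this.resolve_right ha'

theorem edg_split (T : Finset (Finset ℕ)) {u v : ℕ} (huv : u ≠ v) (h : Fc T {u, v}) :
    (edg T).card + 1 = ((edg T).filter fun e => u ∉ e ∧ v ∉ e).card + (nb T {u}).card +
      (nb T {v}).card := by
  have h1 := Finset.card_filter_add_card_filter_not (s := edg T) (fun e => u ∈ e)
  have h2 := Finset.card_filter_add_card_filter_not (s := (edg T).filter fun e => u ∉ e) (fun e => v ∈ e)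
  have h3 := Finset.card_filter_add_card_filter_not (s := (edg T).filter fun e => v ∈ e) (fun e => u ∈ e)
  simp only [Finset.filter_filter] at h1 h2 h3
  have h4 : ((edg T).filter fun e => v ∈ e ∧ u ∈ e) = {{u, v}} := by
    ext e
    simp only [Finset.mem_filter, mem_edg, Finset.mem_singleton]
    constructor
    · rintro ⟨⟨_, hc⟩, hv, hu⟩
      symm
      apply Finset.eq_of_subset_of_card_le
      · intro x hx
        simp at hx
        rcases hx with rfl | rfl <;> assumption
      · rw [hc, Finset.card_pair huv]
    · rintro rfl
      exact ⟨⟨h, Finset.card_pair huv⟩, by simp, by simp⟩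
  rw [h4, Finset.card_singleton] at h3
  have h5 : ((edg T).filter fun e => u ∉ e ∧ v ∈ e) = ((edg T).filter fun e => v ∈ e ∧ u ∉ e) := by
    ext e; simp [and_comm]
  have := edg_at T u
  have := edg_at T v
  rw [h5] at h2
  omega

theorem edg_split1 (T : Finset (Finset ℕ)) (w : ℕ) :
    (edg T).card = ((edg T).filter fun e => w ∉ e).card + (nb T {w}).card := by
  have h1 := Finset.card_filter_add_card_filter_not (s := edg T) (fun e => w ∈ e)
  have := edg_at T w
  omega

theorem card3_of_pair {τ : Finset ℕ} (h : τ.card = 2) {y : ℕ} (hy : y ∉ τ) : (insert y τ).card = 3 := by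
  rw [Finset.card_insert_of_notMem hy, h]

/-- a tetrahedron containing a given triangle -/
theorem tet_eq_insert {F r : Finset ℕ} (hF : F.card = 4) (hr : r.card = 3) (h : r ⊆ F) :
    ∃ x, x ∉ r ∧ F = insert x r := by
  obtain ⟨x, hx, hxr⟩ := Finset.exists_mem_notMem_of_card_lt_card (s := r) (t := F) (by omega)
  refine ⟨x, hxr, ?_⟩
  symm
  apply Finset.eq_of_subset_of_card_le (Finset.insert_subset hx h)
  rw [Finset.card_insert_of_notMem hxr]; omega

theorem Good.nbrs2 {T : Finset (Finset ℕ)} (hT : Good T) {r : Finset ℕ} (hr : r.card = 3)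
    (h : Fc T r) : ∃ a b, a ≠ b ∧ a ∉ r ∧ b ∉ r ∧ insert a r ∈ T ∧ insert b r ∈ T ∧
      ∀ z, z ∉ r → Fc T (insert z r) → z = a ∨ z = b := by
  obtain ⟨F, hF, hrF⟩ := h
  obtain ⟨G, hG, hGF, hrG, hall⟩ := hT.two F hF r hrF hr
  obtain ⟨a, ha, rfl⟩ := tet_eq_insert (hT.card4 _ hF) hr hrF
  obtain ⟨b, hb, rfl⟩ := tet_eq_insert (hT.card4 _ hG) hr hrG
  refine ⟨a, b, ?_, ha, hb, hF, hG, ?_⟩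
  · rintro rfl; exact hGF rfl
  · intro z hz hzT
    have hzT' := mem_of_card hT.card4 hzT (by rw [Finset.card_insert_of_notMem hz]; omega)
    have hins : ∀ a, insert z r = insert a r → z = a := by
      intro a h
      have : z ∈ insert a r := by rw [← h]; simp
      exact (Finset.mem_insert.1 this).resolve_right hz
    exact (hall _ hzT' (Finset.subset_insert _ _)).imp (hins a) (hins b)

/-- The link of an edge or vertex stays connected after deleting one vertex. -/
theorem Good.link_minus {T : Finset (Finset ℕ)} (hT : Good T) {τ : Finset ℕ}
    (h2 : τ.card ≤ 2) {v p q : ℕ} (hp : p ∉ τ) (hq : q ∉ τ)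
    (hpv : p ≠ v) (hqv : q ≠ v) (hpT : Fc T (insert p τ)) (hqT : Fc T (insert q τ)) :
    Relation.ReflTransGen (fun x y => LA T τ x y ∧ x ≠ v ∧ y ≠ v) p q := by
  classical
  set S : ℕ → ℕ → Prop := fun x y => LA T τ x y ∧ x ≠ v ∧ y ≠ v with hS
  have hSs : ∀ a b, S a b → S b a := fun a b h => ⟨h.1.symm, h.2.2, h.2.1⟩
  have hpath := hT.conn τ h2 p q hp hq hpT hqT
  have claim : ∀ a b, LA T τ v a → LA T τ v b → a ≠ v → b ≠ v → Relation.ReflTransGen S a b := by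
    intro a b ha hb hav hbv
    have hvτ : v ∉ τ := ha.1
    have hav' : a ∉ insert v τ := by simp [hav, ha.2.1]
    have hbv' : b ∉ insert v τ := by simp [hbv, hb.2.1]
    by_cases h1 : τ.card ≤ 1
    · have := hT.conn (insert v τ) (by rw [Finset.card_insert_of_notMem hvτ]; omega) a b hav' hbv'
        (by rw [Finset.insert_comm]; exact ha.2.2) (by rw [Finset.insert_comm]; exact hb.2.2)
      refine path_mono ?_ this
      rintro x y ⟨hx, hy, hxy⟩
      simp only [Finset.mem_insert, not_or] at hx hy
      refine ⟨⟨hx.2, hy.2, hxy.mono ?_⟩, hx.1, hy.1⟩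
      exact Finset.insert_subset_insert _ (Finset.insert_subset_insert _ (Finset.subset_insert _ _))
    · have h2' : τ.card = 2 := by omega
      by_contra hcon
      set C := (nb T τ).filter fun z => Relation.ReflTransGen S a z with hC
      have hCm : ∀ z, z ∈ C ↔ Relation.ReflTransGen S a z := by
        intro z
        simp only [hC, Finset.mem_filter, and_iff_right_iff_imp]
        intro h
        rcases Relation.ReflTransGen.cases_tail h with h | ⟨y, _, hyz⟩
        · subst h
          exact mem_nb.2 ⟨ha.2.1, ha.2.2.mono (Finset.subset_insert _ _)⟩
        · exact mem_nb.2 ⟨hyz.1.2.1, hyz.1.2.2.mono (Finset.subset_insert _ _)⟩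
      have hCv : ∀ z ∈ C, z ≠ v := by
        intro z hz
        rw [hCm] at hz
        rcases Relation.ReflTransGen.cases_tail hz with h | ⟨y, _, hyz⟩
        · subst h; exact hav
        · exact hyz.2.2
      have haC : a ∈ C := (hCm a).2 Relation.ReflTransGen.refl
      have hbC : b ∉ C := fun h => hcon ((hCm b).1 h)
      have hab : a ≠ b := fun h => hbC (h ▸ haC)
      have hstep : ∀ y ∈ C, ∀ z, LA T τ y z → z ≠ v → z ∈ C := by
        intro y hy z hyz hz
        exact (hCm z).2 (((hCm y).1 hy).tail ⟨hyz, hCv y hy, hz⟩)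
      -- neighbours of v
      have hvn : ∀ y, y ≠ v → LA T τ v y → y = a ∨ y = b := by
        intro y hyv hy
        obtain ⟨c, d, hcd, hc, hd, _, _, hall⟩ := hT.nbrs2 (card3_of_pair h2' hvτ)
          (ha.2.2.mono (Finset.insert_subset_insert _ (Finset.subset_insert _ _)))
        have e1 := hall a hav' (by rw [Finset.insert_comm]; exact ha.2.2)
        have e2 := hall b hbv' (by rw [Finset.insert_comm]; exact hb.2.2)
        have e3 := hall y (by simp [hyv, hy.2.1]) (by rw [Finset.insert_comm]; exact hy.2.2)
        grind
      set P := (C ×ˢ C).filter fun x => LA T τ x.1 x.2 ∧ x.1 ≠ x.2 with hP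
      have even : ∑ _x ∈ P, (1 : ZMod 2) = 0 := by
        refine Finset.sum_involution (fun x _ => (x.2, x.1)) ?_ ?_ ?_ ?_
        · intros; decide
        · rintro ⟨x, y⟩ hx _ h
          simp only [hP, Finset.mem_filter] at hx
          simp only [Prod.mk.injEq] at h
          exact hx.2.2 h.2
        · rintro ⟨x, y⟩ hx
          simp only [hP, Finset.mem_filter, Finset.mem_product] at hx ⊢
          exact ⟨⟨hx.1.2, hx.1.1⟩, hx.2.1.symm, hx.2.2.symm⟩
        · rintro ⟨x, y⟩ _; rfl
      have hcount : ∀ y ∈ C, (∑ z ∈ C, if LA T τ y z ∧ y ≠ z then (1 : ZMod 2) else 0) =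
          if y = a then 1 else 0 := by
        intro y hy
        have hyτ : y ∉ τ ∧ Fc T (insert y τ) := mem_nb.1 (Finset.mem_filter.1 hy).1
        obtain ⟨c, d, hcd, hc, hd, hcT, hdT, hall⟩ := hT.nbrs2 (card3_of_pair h2' hyτ.1) hyτ.2
        simp only [Finset.mem_insert, not_or] at hc hd
        have hLA : ∀ z, (LA T τ y z ∧ y ≠ z) ↔ z = c ∨ z = d := by
          intro z
          constructor
          · rintro ⟨h, hyz⟩
            exact hall z (by simp [hyz.symm, h.2.1]) (by rw [Finset.insert_comm]; exact h.2.2)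
          · rintro (rfl | rfl)
            · exact ⟨⟨hyτ.1, hc.2, _, hcT, by rw [Finset.insert_comm]⟩, fun h => hc.1 h.symm⟩
            · exact ⟨⟨hyτ.1, hd.2, _, hdT, by rw [Finset.insert_comm]⟩, fun h => hd.1 h.symm⟩
        rw [Finset.sum_ite, Finset.sum_const_zero, add_zero, Finset.sum_const]
        have hvy : y ≠ v := hCv y hy
        by_cases hya : y = a
        · subst hya
          rw [if_pos rfl]
          have hv' := (hLA v).1 ⟨ha.symm, hvy⟩
          have : ∃ x, (C.filter fun z => LA T τ y z ∧ y ≠ z) = {x} := by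
            rcases hv' with rfl | rfl
            · refine ⟨d, ?_⟩
              ext z
              simp only [Finset.mem_filter, Finset.mem_singleton, hLA]
              constructor
              · rintro ⟨hz, rfl | rfl⟩
                · exact absurd rfl (hCv _ hz)
                · rfl
              · rintro rfl
                exact ⟨hstep y hy _ ((hLA _).2 (Or.inr rfl)).1 hcd.symm, Or.inr rfl⟩
            · refine ⟨c, ?_⟩
              ext z
              simp only [Finset.mem_filter, Finset.mem_singleton, hLA]
              constructor
              · rintro ⟨hz, rfl | rfl⟩
                · rfl
                · exact absurd rfl (hCv _ hz)
              · rintro rfl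
                exact ⟨hstep y hy _ ((hLA _).2 (Or.inl rfl)).1 hcd, Or.inl rfl⟩
          obtain ⟨x, hx⟩ := this
          rw [hx]; simp
        · rw [if_neg hya]
          have hnv : ∀ z, LA T τ y z → z ≠ v := by
            rintro z hz rfl
            rcases hvn y hvy hz.symm with h | h
            · exact hya h
            · exact hbC (h ▸ hy)
          have : (C.filter fun z => LA T τ y z ∧ y ≠ z) = {c, d} := by
            ext z
            simp only [Finset.mem_filter, Finset.mem_insert, Finset.mem_singleton, hLA]
            constructor
            · exact fun h => h.2
            · intro h
              have hz := ((hLA z).2 h).1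
              exact ⟨hstep y hy z hz (hnv z hz), h⟩
          rw [this, Finset.card_pair hcd]
          decide
      rw [hP, Finset.sum_filter, Finset.sum_product, Finset.sum_congr rfl hcount] at even
      simp [haC] at even
  refine path_transfer (R := LA T τ) (S := S)
    (Rep := fun x x' => (x ≠ v ∧ x' = x) ∨ (x = v ∧ x' ≠ v ∧ LA T τ v x')) ?_ ?_ ?_ hpath
    (Or.inl ⟨hpv, rfl⟩) (Or.inl ⟨hqv, rfl⟩)
  · intro x y hxy
    by_cases hy : y = v
    · subst hy
      obtain ⟨F, hF, hFs⟩ := hxy.2.2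
      have hc : (insert y τ).card < F.card := by
        rw [hT.card4 _ hF, Finset.card_insert_of_notMem hxy.2.1]; omega
      obtain ⟨z, hz, hzτ⟩ := Finset.exists_mem_notMem_of_card_lt_card hc
      simp only [Finset.mem_insert, not_or] at hzτ
      refine ⟨z, Or.inr ⟨rfl, hzτ.1, hxy.2.1, hzτ.2, F, hF, ?_⟩⟩
      have := (Finset.subset_insert _ _).trans hFs
      rw [Finset.insert_comm]
      exact Finset.insert_subset hz this
    · exact ⟨y, Or.inl ⟨hy, rfl⟩⟩
  · rintro x x' x'' (⟨_, rfl⟩ | ⟨hx, h, h'⟩) (⟨h3, rfl⟩ | ⟨h3, h4, h5⟩)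
    · exact Relation.ReflTransGen.refl
    · contradiction
    · contradiction
    · exact claim _ _ h' h5 h h4
  · rintro x y x' y' hxy (⟨h1, rfl⟩ | ⟨rfl, h, h'⟩) (⟨h3, rfl⟩ | ⟨rfl, h4, h5⟩)
    · exact Relation.ReflTransGen.single ⟨hxy, h1, h3⟩
    · exact claim _ _ hxy.symm h5 h1 h4
    · exact claim _ _ h' hxy h h3
    · exact claim _ _ h' h5 h h4

/-- the map identifying `u` and `v` to `w` -/
def cm (u v w x : ℕ) : ℕ := if x = u ∨ x = v then w else x

/-- contraction of the edge `uv` -/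
def ctr (T : Finset (Finset ℕ)) (u v w : ℕ) : Finset (Finset ℕ) :=
  (T.filter fun F => ¬ (u ∈ F ∧ v ∈ F)).image fun F => F.image (cm u v w)

/-- link condition for the pair `u`, `v` -/
def LCd (T : Finset (Finset ℕ)) (u v : ℕ) : Prop :=
  ∀ s : Finset ℕ, s ≠ ∅ → u ∉ s → v ∉ s → Fc T (insert u s) → Fc T (insert v s) →
    Fc T (insert u (insert v s))

/-- hypotheses for the contraction -/
structure CH (T : Finset (Finset ℕ)) (u v w : ℕ) : Prop where
  good : Good T
  ne : u ≠ v
  edge : Fc T {u, v}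
  fresh : ∀ F ∈ T, w ∉ F
  lc : LCd T u v

theorem path_lift {α β : Type*} {R : α → α → Prop} {S : β → β → Prop} (f : α → β)
    (hR : ∀ a b, R a b → S (f a) (f b)) {a b : α}
    (h : Relation.ReflTransGen R a b) : Relation.ReflTransGen S (f a) (f b) := by
  induction h with
  | refl => exact Relation.ReflTransGen.refl
  | tail _ hbc ih => exact ih.tail (hR _ _ hbc)

theorem cm_comm (u v w : ℕ) : cm u v w = cm v u w := by
  funext x; simp [cm, or_comm]

theorem ctr_comm (T : Finset (Finset ℕ)) (u v w : ℕ) : ctr T u v w = ctr T v u w := by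
  unfold ctr
  rw [cm_comm]
  congr 1
  ext F; simp only [Finset.mem_filter]; tauto

theorem CH.symm {T : Finset (Finset ℕ)} {u v w : ℕ} (h : CH T u v w) : CH T v u w where
  good := h.good
  ne := h.ne.symm
  edge := by rw [Finset.pair_comm]; exact h.edge
  fresh := h.fresh
  lc := by
    intro s h0 hv hu h1 h2
    rw [Finset.insert_comm]
    exact h.lc s h0 hu hv h2 h1

section
variable {T : Finset (Finset ℕ)} {u v w : ℕ} (h : CH T u v w)

theorem cm_other {x : ℕ} (hu : x ≠ u) (hv : x ≠ v) : cm u v w x = x := by simp [cm, hu, hv]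

theorem CH.freshFc (h : CH T u v w) {s : Finset ℕ} (hs : Fc T s) : w ∉ s := by
  obtain ⟨F, hF, hsF⟩ := hs
  exact fun hw => h.fresh F hF (hsF hw)

theorem CH.wu (h : CH T u v w) : w ≠ u := by
  rintro rfl; exact h.freshFc h.edge (by simp)

theorem CH.wv (h : CH T u v w) : w ≠ v := h.symm.wu

theorem CH.nonboth (h : CH T u v w) {F : Finset ℕ} (hF : F ∈ T) (_hu : u ∈ F) (hv : v ∈ F) :
    ∃ G ∈ T, v ∉ G ∧ F.erase v ⊆ G := by
  obtain ⟨G, hG, hGF, hrG, _⟩ := h.good.two F hF (F.erase v) (Finset.erase_subset _ _)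
    (by rw [Finset.card_erase_of_mem hv, h.good.card4 _ hF])
  refine ⟨G, hG, ?_, hrG⟩
  intro hvG
  apply hGF
  symm
  apply Finset.eq_of_subset_of_card_le _ (by rw [h.good.card4 _ hF, h.good.card4 _ hG])
  rw [← Finset.insert_erase hv]
  exact Finset.insert_subset hvG hrG

theorem mem_image_cm_ne {F : Finset ℕ} {x : ℕ} (hxw : x ≠ w) :
    x ∈ F.image (cm u v w) ↔ x ∈ F ∧ x ≠ u ∧ x ≠ v := by
  simp only [Finset.mem_image, cm]
  constructor
  · rintro ⟨a, ha, hax⟩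
    split_ifs at hax with h1
    · exact absurd hax.symm hxw
    · subst hax; push Not at h1; exact ⟨ha, h1.1, h1.2⟩
  · rintro ⟨h1, h2, h3⟩
    exact ⟨x, h1, by simp [h2, h3]⟩

theorem CH.mem_image_cm_w (h : CH T u v w) {F : Finset ℕ} (hF : F ∈ T) :
    w ∈ F.image (cm u v w) ↔ u ∈ F ∨ v ∈ F := by
  have hw := h.fresh F hF
  simp only [Finset.mem_image, cm]
  constructor
  · rintro ⟨a, ha, hax⟩
    split_ifs at hax with h1
    · rcases h1 with rfl | rfl <;> simp [ha]
    · subst hax; contradiction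
  · rintro (h1 | h1)
    · exact ⟨u, h1, by simp⟩
    · exact ⟨v, h1, by simp⟩

theorem CH.Fc_ctr (h : CH T u v w) {s : Finset ℕ} :
    Fc (ctr T u v w) s ↔ ∃ F ∈ T, s ⊆ F.image (cm u v w) := by
  constructor
  · rintro ⟨F', hF', hs⟩
    simp only [ctr, Finset.mem_image, Finset.mem_filter] at hF'
    obtain ⟨F, ⟨hF, _⟩, rfl⟩ := hF'
    exact ⟨F, hF, hs⟩
  · rintro ⟨F, hF, hs⟩
    by_cases hb : u ∈ F ∧ v ∈ F
    · obtain ⟨G, hG, hvG, hFG⟩ := h.nonboth hF hb.1 hb.2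
      refine ⟨G.image (cm u v w), Finset.mem_image.2 ⟨G, Finset.mem_filter.2 ⟨hG, fun h => hvG h.2⟩, rfl⟩, ?_⟩
      refine hs.trans ?_
      intro x hx
      obtain ⟨a, ha, rfl⟩ := Finset.mem_image.1 hx
      by_cases hav : a = v
      · rw [Finset.mem_image]
        exact ⟨u, hFG (Finset.mem_erase.2 ⟨h.ne, hb.1⟩), by simp [cm, hav]⟩
      · exact Finset.mem_image_of_mem _ (hFG (Finset.mem_erase.2 ⟨hav, ha⟩))
    · exact ⟨F.image (cm u v w), Finset.mem_image.2 ⟨F, Finset.mem_filter.2 ⟨hF, hb⟩, rfl⟩, hs⟩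

theorem CH.Fc_ctr_not (h : CH T u v w) {s : Finset ℕ} (hw : w ∉ s) :
    Fc (ctr T u v w) s ↔ Fc T s ∧ u ∉ s ∧ v ∉ s := by
  rw [h.Fc_ctr]
  constructor
  · rintro ⟨F, hF, hs⟩
    have : ∀ x ∈ s, x ∈ F ∧ x ≠ u ∧ x ≠ v := fun x hx =>
      (mem_image_cm_ne (ne_of_mem_of_not_mem hx hw)).1 (hs hx)
    exact ⟨⟨F, hF, fun x hx => (this x hx).1⟩, fun hu => (this u hu).2.1 rfl,
      fun hu => (this v hu).2.2 rfl⟩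
  · rintro ⟨⟨F, hF, hs⟩, hu, hv⟩
    refine ⟨F, hF, fun x hx => ?_⟩
    exact (mem_image_cm_ne (ne_of_mem_of_not_mem hx hw)).2
      ⟨hs hx, fun e => hu (e ▸ hx), fun e => hv (e ▸ hx)⟩

theorem CH.Fc_ctr_w (h : CH T u v w) {s : Finset ℕ} (hw : w ∉ s) :
    Fc (ctr T u v w) (insert w s) ↔ u ∉ s ∧ v ∉ s ∧ (Fc T (insert u s) ∨ Fc T (insert v s)) := by
  constructor
  · intro hFc
    have h1 := (h.Fc_ctr_not hw).1 (hFc.mono (Finset.subset_insert _ _))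
    refine ⟨h1.2.1, h1.2.2, ?_⟩
    obtain ⟨F, hF, hs⟩ := h.Fc_ctr.1 hFc
    have h2 := (h.mem_image_cm_w hF).1 (hs (Finset.mem_insert_self _ _))
    have h3 : s ⊆ F := fun x hx =>
      ((mem_image_cm_ne (ne_of_mem_of_not_mem hx hw)).1 (hs (Finset.mem_insert_of_mem hx))).1
    exact h2.imp (fun h => ⟨F, hF, Finset.insert_subset h h3⟩) (fun h => ⟨F, hF, Finset.insert_subset h h3⟩)
  · rintro ⟨hu, hv, hh⟩
    rw [h.Fc_ctr]
    have key : ∀ x, (x = u ∨ x = v) → Fc T (insert x s) → ∃ F ∈ T, insert w s ⊆ F.image (cm u v w) := by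
      rintro x hx ⟨F, hF, hs⟩
      refine ⟨F, hF, Finset.insert_subset ?_ ?_⟩
      · rw [h.mem_image_cm_w hF]
        exact hx.imp (fun e => hs (by simp [e])) (fun e => hs (by simp [e]))
      · intro y hy
        exact (mem_image_cm_ne (ne_of_mem_of_not_mem hy hw)).2
          ⟨hs (Finset.mem_insert_of_mem hy), fun e => hu (e ▸ hy), fun e => hv (e ▸ hy)⟩
    exact hh.elim (key u (Or.inl rfl)) (key v (Or.inr rfl))

theorem CH.card_ctr (h : CH T u v w) : ∀ F ∈ ctr T u v w, F.card = 4 := by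
  intro F' hF'
  simp only [ctr, Finset.mem_image, Finset.mem_filter] at hF'
  obtain ⟨F, ⟨hF, hb⟩, rfl⟩ := hF'
  rw [Finset.card_image_of_injOn, h.good.card4 _ hF]
  intro a ha b hb' hab
  have hwa : a ≠ w := fun e => h.fresh F hF (e ▸ ha)
  have hwb : b ≠ w := fun e => h.fresh F hF (e ▸ hb')
  simp only [cm] at hab
  simp only [Finset.mem_coe] at ha hb'
  split_ifs at hab with h1 h2 h2
  · rcases h1 with rfl | rfl <;> rcases h2 with rfl | rfl <;> first | rfl | tauto
  · exact absurd hab.symm hwb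
  · exact absurd hab hwa
  · exact hab

theorem CH.no_both3 (h : CH T u v w) {s : Finset ℕ} (hs : s.card = 3) (hu : u ∉ s) (hv : v ∉ s)
    (h1 : Fc T (insert u s)) (h2 : Fc T (insert v s)) : False := by
  have := (h.lc s (by rintro rfl; simp at hs) hu hv h1 h2).card_le h.good.card4
  rw [Finset.card_insert_of_notMem, Finset.card_insert_of_notMem hv] at this
  · omega
  · simp [h.ne, hu]

theorem CH.inj (h : CH T u v w) {F G : Finset ℕ} (hF : F ∈ T) (hG : G ∈ T) (hFb : ¬ (u ∈ F ∧ v ∈ F))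
    (hGb : ¬ (u ∈ G ∧ v ∈ G)) (he : F.image (cm u v w) = G.image (cm u v w)) : F = G := by
  have hx : ∀ x, x ≠ u → x ≠ v → (x ∈ F ↔ x ∈ G) := by
    intro x hu hv
    by_cases hxw : x = w
    · subst hxw; exact ⟨fun h1 => absurd h1 (h.fresh F hF), fun h1 => absurd h1 (h.fresh G hG)⟩
    · have := Finset.ext_iff.1 he x
      rw [mem_image_cm_ne hxw, mem_image_cm_ne hxw] at this
      simpa [hu, hv] using this
  have hw := Finset.ext_iff.1 he w
  rw [h.mem_image_cm_w hF, h.mem_image_cm_w hG] at hw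
  have key : ∀ (F G : Finset ℕ), F ∈ T → G ∈ T → ¬ (u ∈ F ∧ v ∈ F) → ¬ (u ∈ G ∧ v ∈ G) →
      (∀ x, x ≠ u → x ≠ v → (x ∈ F ↔ x ∈ G)) → u ∈ F → v ∈ G → False := by
    intro F G hF hG hFb hGb hx huF hvG
    have hvF : v ∉ F := fun h => hFb ⟨huF, h⟩
    have huG : u ∉ G := fun h => hGb ⟨h, hvG⟩
    have e : F.erase u = G.erase v := by
      ext x
      simp only [Finset.mem_erase]
      by_cases hxu : x = u
      · subst hxu; simp [huG]
      · by_cases hxv : x = v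
        · subst hxv; simp [hvF]
        · simp [hxu, hxv, hx x hxu hxv]
    refine h.no_both3 (s := F.erase u) (by rw [Finset.card_erase_of_mem huF, h.good.card4 _ hF])
      (Finset.notMem_erase _ _) (fun h => hvF (Finset.mem_of_mem_erase h))
      ⟨F, hF, by rw [Finset.insert_erase huF]⟩ ⟨G, hG, ?_⟩
    rw [e, Finset.insert_erase hvG]
  have k1 := key F G hF hG hFb hGb hx
  have k2 := key G F hG hF hGb hFb (fun x a b => (hx x a b).symm)
  ext x
  by_cases hxu : x = u
  · subst hxu; tauto
  · by_cases hxv : x = v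
    · subst hxv; tauto
    · exact hx x hxu hxv

theorem CH.two_ctr (h : CH T u v w) : ∀ F ∈ ctr T u v w, ∀ r ⊆ F, r.card = 3 →
    ∃ G ∈ ctr T u v w, G ≠ F ∧ r ⊆ G ∧ ∀ H ∈ ctr T u v w, r ⊆ H → H = F ∨ H = G := by
  -- it suffices to find two nonboth tets
  suffices hsuff : ∀ r : Finset ℕ, r.card = 3 → Fc (ctr T u v w) r → ∃ A ∈ T, ∃ B ∈ T, A ≠ B ∧
      ¬ (u ∈ A ∧ v ∈ A) ∧ ¬ (u ∈ B ∧ v ∈ B) ∧ r ⊆ A.image (cm u v w) ∧ r ⊆ B.image (cm u v w) ∧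
      ∀ H ∈ T, ¬ (u ∈ H ∧ v ∈ H) → r ⊆ H.image (cm u v w) → H = A ∨ H = B by
    intro F' hF' r hr hr3
    have hF0 := hF'
    simp only [ctr, Finset.mem_image, Finset.mem_filter] at hF'
    obtain ⟨F, ⟨hF, hFb⟩, rfl⟩ := hF'
    obtain ⟨A, hA, B, hB, hAB, hAb, hBb, hrA, hrB, hall⟩ := hsuff r hr3 ⟨_, hF0, hr⟩
    have mem : ∀ A ∈ T, ¬ (u ∈ A ∧ v ∈ A) → A.image (cm u v w) ∈ ctr T u v w := fun A h1 h2 =>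
      Finset.mem_image.2 ⟨A, Finset.mem_filter.2 ⟨h1, h2⟩, rfl⟩
    have hne : A.image (cm u v w) ≠ B.image (cm u v w) := fun e => hAB (h.inj hA hB hAb hBb e)
    have hall' : ∀ H ∈ ctr T u v w, r ⊆ H → H = A.image (cm u v w) ∨ H = B.image (cm u v w) := by
      intro H' hH' hrH
      simp only [ctr, Finset.mem_image, Finset.mem_filter] at hH'
      obtain ⟨H, ⟨hH, hHb⟩, rfl⟩ := hH'
      exact (hall H hH hHb hrH).imp (fun e => by rw [e]) (fun e => by rw [e])
    rcases hall F hF hFb hr with rfl | rfl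
    · exact ⟨_, mem B hB hBb, hne.symm, hrB, hall'⟩
    · exact ⟨_, mem A hA hAb, hne, hrA, fun H a b => (hall' H a b).symm⟩
  intro r hr3 hFc
  by_cases hw : w ∈ r
  · -- r = insert w e
    obtain ⟨e, hwe, rfl⟩ : ∃ e, w ∉ e ∧ r = insert w e :=
      ⟨r.erase w, Finset.notMem_erase _ _, (Finset.insert_erase hw).symm⟩
    have he2 : e.card = 2 := by rw [Finset.card_insert_of_notMem hwe] at hr3; omega
    have he0 : e ≠ ∅ := by rintro rfl; simp at he2
    obtain ⟨hu, hv, hor⟩ := (h.Fc_ctr_w hwe).1 hFc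
    have hsub : ∀ H ∈ T, (insert w e ⊆ H.image (cm u v w) ↔ (insert u e ⊆ H ∨ insert v e ⊆ H)) := by
      intro H hH
      rw [Finset.insert_subset_iff, Finset.insert_subset_iff, Finset.insert_subset_iff,
        h.mem_image_cm_w hH, ← or_and_right]
      refine and_congr_right fun _ => ⟨fun hs x hx => ?_, fun hs x hx => ?_⟩
      · exact ((mem_image_cm_ne (ne_of_mem_of_not_mem hx hwe)).1 (hs hx)).1
      · exact (mem_image_cm_ne (ne_of_mem_of_not_mem hx hwe)).2
          ⟨hs hx, fun e => hu (e ▸ hx), fun e => hv (e ▸ hx)⟩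
    have single : ∀ u v, CH T u v w → u ∉ e → v ∉ e → Fc T (insert u e) → ¬ Fc T (insert v e) →
        ∃ A ∈ T, ∃ B ∈ T, A ≠ B ∧ v ∉ A ∧ v ∉ B ∧ insert u e ⊆ A ∧ insert u e ⊆ B ∧
        ∀ H ∈ T, insert u e ⊆ H → H = A ∨ H = B := by
      intro u v h hu hv h1 h2
      obtain ⟨A, hA, hAs⟩ := h1
      obtain ⟨B, hB, hBA, hBs, hall⟩ := h.good.two A hA _ hAs (card3_of_pair he2 hu)
      refine ⟨A, hA, B, hB, hBA.symm, ?_, ?_, hAs, hBs, hall⟩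
      · exact fun hvA => h2 ⟨A, hA, Finset.insert_subset hvA ((Finset.subset_insert _ _).trans hAs)⟩
      · exact fun hvA => h2 ⟨B, hB, Finset.insert_subset hvA ((Finset.subset_insert _ _).trans hBs)⟩
    by_cases h1 : Fc T (insert u e)
    · by_cases h2 : Fc T (insert v e)
      · -- both
        have hF0 : insert u (insert v e) ∈ T := by
          refine mem_of_card h.good.card4 (h.lc e he0 hu hv h1 h2) ?_
          rw [Finset.card_insert_of_notMem (by simp [h.ne, hu]), card3_of_pair he2 hv]
        have hF0' : insert v (insert u e) ∈ T := by rw [Finset.insert_comm]; exact hF0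
        obtain ⟨A, hA, hAF, hAs, hAall⟩ := h.good.two _ hF0' (insert u e)
          (Finset.subset_insert _ _) (card3_of_pair he2 hu)
        obtain ⟨B, hB, hBF, hBs, hBall⟩ := h.good.two _ hF0 (insert v e)
          (Finset.subset_insert _ _) (card3_of_pair he2 hv)
        have c4 : ∀ A ∈ T, ∀ B ∈ T, A ⊆ B → B = A := fun A hA B hB hs =>
          (Finset.eq_of_subset_of_card_le hs (by rw [h.good.card4 _ hA, h.good.card4 _ hB])).symm
        have hvA : v ∉ A := fun hv => hAF (c4 _ hF0' _ hA (Finset.insert_subset hv hAs))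
        have huB : u ∉ B := fun hu => hBF (c4 _ hF0 _ hB (Finset.insert_subset hu hBs))
        refine ⟨A, hA, B, hB, ?_, fun h => hvA h.2, fun h => huB h.1, ?_, ?_, ?_⟩
        · rintro rfl; exact hvA (hBs (by simp))
        · exact (hsub A hA).2 (Or.inl hAs)
        · exact (hsub B hB).2 (Or.inr hBs)
        · intro H hH hHb hHs
          rcases (hsub H hH).1 hHs with h3 | h3
          · rcases hAall H hH h3 with rfl | rfl
            · exact absurd ⟨by simp, by simp⟩ hHb
            · exact Or.inl rfl
          · rcases hBall H hH h3 with rfl | rfl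
            · exact absurd ⟨by simp, by simp⟩ hHb
            · exact Or.inr rfl
      · obtain ⟨A, hA, B, hB, hAB, hvA, hvB, hAs, hBs, hall⟩ := single u v h hu hv h1 h2
        refine ⟨A, hA, B, hB, hAB, fun h => hvA h.2, fun h => hvB h.2, (hsub A hA).2 (Or.inl hAs),
          (hsub B hB).2 (Or.inl hBs), ?_⟩
        intro H hH _ hHs
        rcases (hsub H hH).1 hHs with h3 | h3
        · exact hall H hH h3
        · exact absurd ⟨H, hH, h3⟩ h2
    · have h2 := hor.resolve_left h1
      obtain ⟨A, hA, B, hB, hAB, hvA, hvB, hAs, hBs, hall⟩ := single v u h.symm hv hu h2 h1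
      refine ⟨A, hA, B, hB, hAB, fun h => hvA h.1, fun h => hvB h.1, (hsub A hA).2 (Or.inr hAs),
        (hsub B hB).2 (Or.inr hBs), ?_⟩
      intro H hH _ hHs
      rcases (hsub H hH).1 hHs with h3 | h3
      · exact absurd ⟨H, hH, h3⟩ h1
      · exact hall H hH h3
  · obtain ⟨⟨A, hA, hAs⟩, hu, hv⟩ := (h.Fc_ctr_not hw).1 hFc
    obtain ⟨B, hB, hBA, hBs, hall⟩ := h.good.two A hA r hAs hr3
    have hsub : ∀ H ∈ T, (r ⊆ H.image (cm u v w) ↔ r ⊆ H) := by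
      intro H hH
      refine ⟨fun hs x hx => ?_, fun hs x hx => ?_⟩
      · exact ((mem_image_cm_ne (ne_of_mem_of_not_mem hx hw)).1 (hs hx)).1
      · exact (mem_image_cm_ne (ne_of_mem_of_not_mem hx hw)).2
          ⟨hs hx, fun e => hu (e ▸ hx), fun e => hv (e ▸ hx)⟩
    have nb : ∀ H ∈ T, r ⊆ H → ¬ (u ∈ H ∧ v ∈ H) := by
      rintro H hH hs ⟨h1, h2⟩
      have := Finset.card_le_card (Finset.insert_subset h1 (Finset.insert_subset h2 hs))
      rw [Finset.card_insert_of_notMem (by simp [h.ne, hu]), Finset.card_insert_of_notMem hv,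
        h.good.card4 _ hH] at this
      omega
    exact ⟨A, hA, B, hB, hBA.symm, nb A hA hAs, nb B hB hBs, (hsub A hA).2 hAs, (hsub B hB).2 hBs,
      fun H hH _ hs => hall H hH ((hsub H hH).1 hs)⟩

theorem CH.oneside (h : CH T u v w) {σ : Finset ℕ} (hσ : σ.card ≤ 1) (hwσ : w ∉ σ) (hu : u ∉ σ)
    (hv : v ∉ σ) {p q : ℕ} (hp : p ∉ insert u σ) (hq : q ∉ insert u σ) (hpv : p ≠ v) (hqv : q ≠ v)
    (hpT : Fc T (insert p (insert u σ))) (hqT : Fc T (insert q (insert u σ))) :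
    Relation.ReflTransGen (LA (ctr T u v w) (insert w σ)) p q := by
  have := h.good.link_minus (τ := insert u σ)
    (by rw [Finset.card_insert_of_notMem hu]; omega) hp hq hpv hqv hpT hqT
  refine path_mono ?_ this
  rintro x y ⟨⟨hx, hy, hxy⟩, hxv, hyv⟩
  have hwxy := h.freshFc hxy
  simp only [Finset.mem_insert, not_or] at hx hy hwxy
  refine ⟨by simp only [Finset.mem_insert, not_or]; exact ⟨fun e => hwxy.1 e.symm, hx.2⟩,
    by simp only [Finset.mem_insert, not_or]; exact ⟨fun e => hwxy.2.1 e.symm, hy.2⟩, ?_⟩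
  have e1 : insert x (insert y (insert w σ)) = insert w (insert x (insert y σ)) := by
    ext z; simp only [Finset.mem_insert]; tauto
  have e2 : insert x (insert y (insert u σ)) = insert u (insert x (insert y σ)) := by
    ext z; simp only [Finset.mem_insert]; tauto
  rw [e1, h.Fc_ctr_w (by simp only [Finset.mem_insert, not_or]; exact ⟨hwxy.1, hwxy.2.1, hwσ⟩)]
  refine ⟨?_, ?_, Or.inl (e2 ▸ hxy)⟩
  · simp only [Finset.mem_insert, not_or]; exact ⟨fun e => hx.1 e.symm, fun e => hy.1 e.symm, hu⟩
  · simp only [Finset.mem_insert, not_or]; exact ⟨fun e => hxv e.symm, fun e => hyv e.symm, hv⟩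

theorem CH.conn_ctr (h : CH T u v w) : ∀ σ : Finset ℕ, σ.card ≤ 2 → ∀ p q, p ∉ σ → q ∉ σ →
    Fc (ctr T u v w) (insert p σ) → Fc (ctr T u v w) (insert q σ) →
    Relation.ReflTransGen (LA (ctr T u v w) σ) p q := by
  intro σ' hσ' p q hp hq hpT hqT
  by_cases hw : w ∈ σ'
  · obtain ⟨σ, hwσ, rfl⟩ : ∃ e, w ∉ e ∧ σ' = insert w e :=
      ⟨σ'.erase w, Finset.notMem_erase _ _, (Finset.insert_erase hw).symm⟩
    have hσ : σ.card ≤ 1 := by rw [Finset.card_insert_of_notMem hwσ] at hσ'; omega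
    have conv : ∀ p, p ∉ insert w σ → Fc (ctr T u v w) (insert p (insert w σ)) →
        u ∉ σ ∧ v ∉ σ ∧ p ∉ insert u σ ∧ p ∉ insert v σ ∧ p ≠ u ∧ p ≠ v ∧
        (Fc T (insert p (insert u σ)) ∨ Fc T (insert p (insert v σ))) := by
      intro p hp hpT
      simp only [Finset.mem_insert, not_or] at hp
      rw [Finset.insert_comm, h.Fc_ctr_w (by
        simp only [Finset.mem_insert, not_or]; exact ⟨fun e => hp.1 e.symm, hwσ⟩)] at hpT
      simp only [Finset.mem_insert, not_or] at hpT ⊢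
      rw [Finset.insert_comm p u, Finset.insert_comm p v]
      refine ⟨hpT.1.2, hpT.2.1.2, ⟨?_, hp.2⟩, ⟨?_, hp.2⟩, ?_, ?_, hpT.2.2⟩
      · exact fun e => hpT.1.1 e.symm
      · exact fun e => hpT.2.1.1 e.symm
      · exact fun e => hpT.1.1 e.symm
      · exact fun e => hpT.2.1.1 e.symm
    obtain ⟨hu, hv, hpu, hpv, hpu', hpv', hpor⟩ := conv p hp hpT
    obtain ⟨-, -, hqu, hqv, hqu', hqv', hqor⟩ := conv q hq hqT
    have mixed : ∀ p q, p ∉ insert u σ → q ∉ insert v σ → p ≠ v → q ≠ u → 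
        Fc T (insert p (insert u σ)) → Fc T (insert q (insert v σ)) →
        Relation.ReflTransGen (LA (ctr T u v w) (insert w σ)) p q := by
      intro p q hp hq hpv hqu h1 h2
      have huv : Fc T (insert u (insert v σ)) := by
        by_cases h0 : σ = ∅
        · subst h0; exact h.edge
        · exact h.lc σ h0 hu hv (h1.mono (Finset.subset_insert _ _)) (h2.mono (Finset.subset_insert _ _))
      obtain ⟨F, hF, hFs⟩ := huv
      obtain ⟨z, hzF, hz⟩ := Finset.exists_mem_notMem_of_card_lt_card
        (s := insert u (insert v σ)) (t := F) (by
          rw [h.good.card4 _ hF]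
          have := Finset.card_insert_le u (insert v σ)
          have := Finset.card_insert_le v σ
          omega)
      simp only [Finset.mem_insert, not_or] at hz
      have s1 : insert z (insert u σ) ⊆ F := Finset.insert_subset hzF
        (subset_trans (Finset.insert_subset_insert _ (Finset.subset_insert _ _)) hFs)
      have s2 : insert z (insert v σ) ⊆ F := Finset.insert_subset hzF
        (subset_trans (Finset.subset_insert _ _) hFs)
      have e1 := h.oneside hσ hwσ hu hv hp (q := z) (by simp [hz.1, hz.2.2]) hpv hz.2.1 h1 ⟨F, hF, s1⟩
      have e2 := h.symm.oneside hσ hwσ hv hu (p := z) (by simp [hz.2.1, hz.2.2]) hq hz.1 hqu ⟨F, hF, s2⟩ h2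
      rw [ctr_comm] at e2
      exact e1.trans e2
    rcases hpor with h1 | h1 <;> rcases hqor with h2 | h2
    · exact h.oneside hσ hwσ hu hv hpu hqu hpv' hqv' h1 h2
    · exact mixed p q hpu hqv hpv' hqu' h1 h2
    · exact path_symm (fun a b => LA.symm) (mixed q p hqu hpv hqv' hpu' h2 h1)
    · have := h.symm.oneside hσ hwσ hv hu hpv hqv hpu' hqu' h1 h2
      rwa [ctr_comm] at this
  · have lift : ∀ p, p ∉ σ' → Fc (ctr T u v w) (insert p σ') →
        ∃ p', p' ∉ σ' ∧ Fc T (insert p' σ') ∧ cm u v w p' = p := by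
      intro p hp hpT
      by_cases hpw : p = w
      · subst hpw
        rw [h.Fc_ctr_w hw] at hpT
        rcases hpT.2.2 with h1 | h1
        · exact ⟨u, hpT.1, h1, by simp [cm]⟩
        · exact ⟨v, hpT.2.1, h1, by simp [cm]⟩
      · rw [h.Fc_ctr_not (by
          simp only [Finset.mem_insert, not_or]; exact ⟨fun e => hpw e.symm, hw⟩)] at hpT
        simp only [Finset.mem_insert, not_or] at hpT
        exact ⟨p, hp, hpT.1, cm_other (fun e => hpT.2.1.1 e.symm) (fun e => hpT.2.2.1 e.symm)⟩
    have huv := (h.Fc_ctr_not hw).1 (hpT.mono (Finset.subset_insert _ _))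
    obtain ⟨p', hp', hpT', rfl⟩ := lift p hp hpT
    obtain ⟨q', hq', hqT', rfl⟩ := lift q hq hqT
    refine path_lift (cm u v w) ?_ (h.good.conn σ' hσ' p' q' hp' hq' hpT' hqT')
    rintro x y ⟨hx, hy, F, hF, hs⟩
    have hn : ∀ x, x ∉ σ' → cm u v w x ∉ σ' := by
      intro x hx
      unfold cm
      split_ifs
      · exact hw
      · exact hx
    refine ⟨hn x hx, hn y hy, h.Fc_ctr.2 ⟨F, hF, ?_⟩⟩
    intro z hz
    simp only [Finset.mem_insert] at hz
    rcases hz with rfl | rfl | hz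
    · exact Finset.mem_image_of_mem _ (hs (by simp))
    · exact Finset.mem_image_of_mem _ (hs (by simp))
    · exact (mem_image_cm_ne (ne_of_mem_of_not_mem hz hw)).2
        ⟨hs (by simp [hz]), fun e => huv.2.1 (e ▸ hz), fun e => huv.2.2 (e ▸ hz)⟩

theorem CH.good_ctr (h : CH T u v w) : Good (ctr T u v w) where
  ne := by
    have : Fc (ctr T u v w) {w} := by
      rw [← insert_empty_eq w, h.Fc_ctr_w (by simp)]
      exact ⟨by simp, by simp, Or.inl (h.edge.mono (by simp))⟩
    obtain ⟨F, hF, _⟩ := this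
    exact ⟨F, hF⟩
  card4 := h.card_ctr
  two := h.two_ctr
  conn := h.conn_ctr

end

theorem mem_vertexSet_gen {T : Finset (Finset ℕ)} {x : ℕ} :
    x ∈ (gen T).vertexSet ↔ Fc T {x} := by
  unfold vertexSet
  rw [Finset.mem_sup]
  constructor
  · rintro ⟨s, hs, hx⟩
    exact (mem_gen.1 hs).1.mono (by simpa using hx)
  · intro h
    exact ⟨{x}, mem_gen.2 ⟨h, by simp⟩, by simp⟩

section
variable {T : Finset (Finset ℕ)} {u v w : ℕ}

theorem CH.bdry (h : CH T u v w) {s : Finset ℕ} (hs : s ≠ ∅) :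
    s ∈ bdryFaces ((gen T).faces.filter fun α => u ∉ α ∧ v ∉ α) 3 ↔
      u ∉ s ∧ v ∉ s ∧ (Fc T (insert u s) ∨ Fc T (insert v s)) := by
  have cnt : ∀ r : Finset ℕ, (((gen T).faces.filter fun α => u ∉ α ∧ v ∉ α).filter
      fun t => t.card = 3 + 1 ∧ r ⊆ t) = T.filter fun t => (u ∉ t ∧ v ∉ t) ∧ r ⊆ t := by
    intro r
    ext t
    simp only [Finset.mem_filter, mem_gen]
    constructor
    · rintro ⟨⟨⟨h1, _⟩, h2⟩, h3, h4⟩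
      exact ⟨mem_of_card h.good.card4 h1 (by omega), h2, h4⟩
    · rintro ⟨h1, h2, h3⟩
      refine ⟨⟨⟨⟨t, h1, subset_rfl⟩, ?_⟩, h2⟩, h.good.card4 _ h1, h3⟩
      rintro rfl; simpa using h.good.card4 _ h1
  unfold bdryFaces
  simp only [Finset.mem_filter, cnt]
  constructor
  · rintro ⟨⟨_, hu, hv⟩, r, ⟨hr, hur, hvr⟩, hsr, hr3, hc⟩
    refine ⟨hu, hv, ?_⟩
    obtain ⟨A, hA⟩ := Finset.card_eq_one.1 hc
    have hm : ∀ H, (H ∈ T ∧ (u ∉ H ∧ v ∉ H) ∧ r ⊆ H) ↔ H = A := by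
      intro H
      have := Finset.ext_iff.1 hA H
      simpa using this
    have hA' := (hm A).2 rfl
    obtain ⟨B, hB, hBA, hBs, _⟩ := h.good.two A hA'.1 r hA'.2.2 hr3
    by_cases huB : u ∈ B
    · exact Or.inl ⟨B, hB, Finset.insert_subset huB (hsr.trans hBs)⟩
    · by_cases hvB : v ∈ B
      · exact Or.inr ⟨B, hB, Finset.insert_subset hvB (hsr.trans hBs)⟩
      · exact absurd ((hm B).1 ⟨hB, ⟨huB, hvB⟩, hBs⟩) hBA
  · rintro ⟨hu, hv, hor⟩
    have key : ∀ u v, CH T u v w → u ∉ s → v ∉ s → Fc T (insert u s) →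
        ∃ r, Fc T r ∧ r ≠ ∅ ∧ u ∉ r ∧ v ∉ r ∧ s ⊆ r ∧ r.card = 3 ∧
        ∃ A, (T.filter fun t => (u ∉ t ∧ v ∉ t) ∧ r ⊆ t) = {A} := by
      intro u v h hu hv hus
      obtain ⟨F, hF, huF, hvF, hFs⟩ : ∃ F ∈ T, u ∈ F ∧ v ∉ F ∧ s ⊆ F := by
        obtain ⟨F, hF, hFs⟩ := hus
        have huF : u ∈ F := hFs (by simp)
        have hsF : s ⊆ F := (Finset.subset_insert _ _).trans hFs
        by_cases hvF : v ∈ F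
        · obtain ⟨G, hG, hvG, hFG⟩ := h.nonboth hF huF hvF
          refine ⟨G, hG, hFG (Finset.mem_erase.2 ⟨h.ne, huF⟩), hvG, ?_⟩
          intro x hx
          exact hFG (Finset.mem_erase.2 ⟨ne_of_mem_of_not_mem hx hv, hsF hx⟩)
        · exact ⟨F, hF, huF, hvF, hsF⟩
      have hr3 : (F.erase u).card = 3 := by rw [Finset.card_erase_of_mem huF, h.good.card4 _ hF]
      have hvr : v ∉ F.erase u := fun h => hvF (Finset.mem_of_mem_erase h)
      refine ⟨F.erase u, ⟨F, hF, Finset.erase_subset _ _⟩, ?_, Finset.notMem_erase _ _, hvr, ?_, hr3, ?_⟩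
      · intro e; rw [e] at hr3; simp at hr3
      · intro x hx
        exact Finset.mem_erase.2 ⟨ne_of_mem_of_not_mem hx hu, hFs hx⟩
      · obtain ⟨G, hG, hGF, hGs, hall⟩ := h.good.two F hF _ (Finset.erase_subset u F) hr3
        refine ⟨G, ?_⟩
        ext H
        simp only [Finset.mem_filter, Finset.mem_singleton]
        constructor
        · rintro ⟨h1, h2, h3⟩
          rcases hall H h1 h3 with rfl | rfl
          · exact absurd huF h2.1
          · rfl
        · rintro rfl
          refine ⟨hG, ⟨?_, ?_⟩, hGs⟩
          · intro huG
            apply hGF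
            symm
            apply Finset.eq_of_subset_of_card_le _ (by rw [h.good.card4 _ hF, h.good.card4 _ hG])
            rw [← Finset.insert_erase huF]
            exact Finset.insert_subset huG hGs
          · intro hvG
            exact h.no_both3 hr3 (Finset.notMem_erase _ _) hvr
              ⟨F, hF, by rw [Finset.insert_erase huF]⟩ ⟨H, hG, Finset.insert_subset hvG hGs⟩
    rcases hor with h1 | h1
    · obtain ⟨r, hr, hr0, hur, hvr, hsr, hr3, A, hA⟩ := key u v h hu hv h1
      exact ⟨⟨mem_gen.2 ⟨hr.mono hsr, hs⟩, hu, hv⟩, r, ⟨mem_gen.2 ⟨hr, hr0⟩, hur, hvr⟩, hsr, hr3,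
        by rw [hA]; simp⟩
    · obtain ⟨r, hr, hr0, hur, hvr, hsr, hr3, A, hA⟩ := key v u h.symm hv hu h1
      refine ⟨⟨mem_gen.2 ⟨hr.mono hsr, hs⟩, hu, hv⟩, r, ⟨mem_gen.2 ⟨hr, hr0⟩, hvr, hur⟩, hsr, hr3, ?_⟩
      have : (T.filter fun t => (u ∉ t ∧ v ∉ t) ∧ r ⊆ t) = T.filter fun t => (v ∉ t ∧ u ∉ t) ∧ r ⊆ t := by
        ext t; simp only [Finset.mem_filter]; tauto
      rw [this, hA]; simp

theorem CH.contraction (h : CH T u v w) :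
    EdgeContractionAt 3 (gen T) u v (gen (ctr T u v w)) := by
  refine ⟨mem_gen.2 ⟨h.edge, by simp⟩, h.ne, ?_, w, ?_, ?_⟩
  · ext s
    simp only [Finset.mem_inter, mem_lk_gen, Finset.inter_singleton]
    have e1 : ∀ x, s ∪ {x} = insert x s := fun x => by
      rw [Finset.union_comm]; rfl
    have e2 : s ∪ {u, v} = insert u (insert v s) := by
      ext x; simp only [Finset.mem_union, Finset.mem_insert, Finset.mem_singleton]; tauto
    have e3 : s ∩ {u, v} = ∅ ↔ u ∉ s ∧ v ∉ s := by
      rw [← Finset.disjoint_iff_inter_eq_empty]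
      simp [Finset.disjoint_insert_right]
    have e4 : ∀ x, (if x ∈ s then ({x} : Finset ℕ) else ∅) = ∅ ↔ x ∉ s := by
      intro x; split_ifs with h1 <;> simp [h1]
    rw [e1, e1, e2, e3, e4, e4]
    constructor
    · rintro ⟨⟨h0, hu, h1⟩, _, hv, h2⟩
      exact ⟨h0, ⟨hu, hv⟩, h.lc s h0 hu hv h1 h2⟩
    · rintro ⟨h0, ⟨hu, hv⟩, h1⟩
      exact ⟨⟨h0, hu, h1.mono (Finset.insert_subset_insert _ (Finset.subset_insert _ _))⟩,
        h0, hv, h1.mono (Finset.subset_insert _ _)⟩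
  · rw [mem_vertexSet_gen]
    intro hw
    exact h.freshFc hw (by simp)
  · ext s
    unfold coneFaces
    simp only [Finset.mem_union, Finset.mem_image, Finset.mem_singleton]
    have hsubF : ∀ s, s ∈ bdryFaces ((gen T).faces.filter fun α => u ∉ α ∧ v ∉ α) 3 →
        s ∈ (gen T).faces.filter fun α => u ∉ α ∧ v ∉ α := fun s hs => (Finset.mem_filter.1 hs).1
    have hwF : ∀ s, s ∈ (gen T).faces.filter (fun α => u ∉ α ∧ v ∉ α) → w ∉ s := fun s hs =>
      h.freshFc (mem_gen.1 (Finset.mem_filter.1 hs).1).1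
    rw [mem_gen]
    by_cases hw : w ∈ s
    · obtain ⟨t, hwt, rfl⟩ : ∃ e, w ∉ e ∧ s = insert w e :=
        ⟨s.erase w, Finset.notMem_erase _ _, (Finset.insert_erase hw).symm⟩
      rw [h.Fc_ctr_w hwt]
      constructor
      · rintro ⟨h1, _⟩
        by_cases ht : t = ∅
        · subst ht; exact Or.inr (Or.inr rfl)
        · exact Or.inr (Or.inl (Or.inr ⟨t, (h.bdry ht).2 h1, rfl⟩))
      · intro h1
        refine ⟨?_, by simp⟩
        rcases h1 with h1 | (h1 | ⟨t', h1, h2⟩) | h1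
        · exact absurd hw (hwF _ h1)
        · exact absurd hw (hwF _ (hsubF _ h1))
        · have hwt' := hwF _ (hsubF _ h1)
          have : t' = t := by
            rw [← Finset.erase_insert hwt', h2, Finset.erase_insert hwt]
          subst this
          refine (h.bdry ?_).1 h1
          rintro rfl
          exact (gen T).not_empty_mem (Finset.mem_filter.1 (hsubF _ h1)).1
        · have : t = ∅ := by
            rw [← Finset.erase_insert hwt, h1]; simp
          subst this
          exact ⟨by simp, by simp, Or.inl (h.edge.mono (by simp))⟩
    · rw [h.Fc_ctr_not hw]
      constructor
      · rintro ⟨⟨h1, h2⟩, h3⟩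
        exact Or.inl (Finset.mem_filter.2 ⟨mem_gen.2 ⟨h1, h3⟩, h2⟩)
      · intro h1
        have : s ∈ (gen T).faces.filter (fun α => u ∉ α ∧ v ∉ α) := by
          rcases h1 with h1 | (h1 | ⟨t', h1, rfl⟩) | rfl
          · exact h1
          · exact hsubF _ h1
          · simp at hw
          · simp at hw
        rw [Finset.mem_filter, mem_gen] at this
        exact ⟨⟨this.1.1, this.2⟩, this.1.2⟩

theorem mem_biUnion_Fc {T : Finset (Finset ℕ)} {x : ℕ} : x ∈ T.biUnion id ↔ Fc T {x} := by
  simp [Fc]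

theorem CH.f0 (h : CH T u v w) : (gen (ctr T u v w)).fnum 0 + 1 = (gen T).fnum 0 := by
  rw [fnum0_gen, fnum0_gen]
  have hu : Fc T {u} := h.edge.mono (by simp)
  have hv : Fc T {v} := h.edge.mono (by simp)
  have e : (ctr T u v w).biUnion id = insert w (((T.biUnion id).erase u).erase v) := by
    ext x
    rw [mem_biUnion_Fc]
    by_cases hx : x = w
    · subst hx
      rw [← insert_empty_eq x, h.Fc_ctr_w (by simp)]
      simp only [Finset.mem_insert, true_or, iff_true]
      exact ⟨by simp, by simp, Or.inl hu⟩
    · rw [h.Fc_ctr_not (by simpa using Ne.symm hx)]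
      simp only [Finset.mem_insert, Finset.mem_erase, mem_biUnion_Fc, Finset.mem_singleton, hx, false_or]
      constructor
      · rintro ⟨a, b, c⟩; exact ⟨Ne.symm c, Ne.symm b, a⟩
      · rintro ⟨a, b, c⟩; exact ⟨c, Ne.symm b, Ne.symm a⟩
  have hw : w ∉ ((T.biUnion id).erase u).erase v := by
    simp only [Finset.mem_erase, mem_biUnion_Fc, not_and]
    intro _ _ h1
    exact h.freshFc h1 (by simp)
  have hu' : u ∈ T.biUnion id := mem_biUnion_Fc.2 hu
  have hv' : v ∈ (T.biUnion id).erase u := Finset.mem_erase.2 ⟨h.ne.symm, mem_biUnion_Fc.2 hv⟩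
  rw [e, Finset.card_insert_of_notMem hw]
  have := Finset.card_erase_add_one hu'
  have := Finset.card_erase_add_one hv'
  omega

theorem CH.f1 (h : CH T u v w) :
    (gen (ctr T u v w)).fnum 1 + 1 + (nb T {u, v}).card = (gen T).fnum 1 := by
  rw [fnum1_gen, fnum1_gen]
  have e1 := edg_split T h.ne h.edge
  have e2 := edg_split1 (ctr T u v w) w
  have e3 : ((edg (ctr T u v w)).filter fun e => w ∉ e) = (edg T).filter fun e => u ∉ e ∧ v ∉ e := by
    ext e
    simp only [Finset.mem_filter, mem_edg]
    constructor
    · rintro ⟨⟨h1, h2⟩, h3⟩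
      rw [h.Fc_ctr_not h3] at h1
      exact ⟨⟨h1.1, h2⟩, h1.2⟩
    · rintro ⟨⟨h1, h2⟩, h3⟩
      have hw := h.freshFc h1
      exact ⟨⟨(h.Fc_ctr_not hw).2 ⟨h1, h3⟩, h2⟩, hw⟩
  have e4 : nb (ctr T u v w) {w} = (nb T {u}).erase v ∪ (nb T {v}).erase u := by
    ext p
    rw [mem_nb, Finset.mem_union, Finset.mem_erase, Finset.mem_erase, mem_nb, mem_nb]
    simp only [Finset.mem_singleton]
    constructor
    · rintro ⟨h1, h2⟩
      rw [Finset.pair_comm, h.Fc_ctr_w (by simpa using Ne.symm h1)] at h2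
      simp only [Finset.mem_singleton] at h2
      rw [Finset.pair_comm p u, Finset.pair_comm p v]
      exact h2.2.2.imp (fun a => ⟨Ne.symm h2.2.1, Ne.symm h2.1, a⟩)
        (fun a => ⟨Ne.symm h2.1, Ne.symm h2.2.1, a⟩)
    · intro h1
      have hpw : p ≠ w := by
        rintro rfl
        rcases h1 with h1 | h1 <;> exact h.freshFc h1.2.2 (by simp)
      refine ⟨hpw, ?_⟩
      rw [Finset.pair_comm, h.Fc_ctr_w (by simpa using Ne.symm hpw)]
      simp only [Finset.mem_singleton]
      rw [Finset.pair_comm p u, Finset.pair_comm p v] at h1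
      rcases h1 with h1 | h1
      · exact ⟨Ne.symm h1.2.1, Ne.symm h1.1, Or.inl h1.2.2⟩
      · exact ⟨Ne.symm h1.1, Ne.symm h1.2.1, Or.inr h1.2.2⟩
  have e5 : (nb T {u}).erase v ∩ (nb T {v}).erase u = nb T {u, v} := by
    ext p
    rw [mem_nb, Finset.mem_inter, Finset.mem_erase, Finset.mem_erase, mem_nb, mem_nb]
    simp only [Finset.mem_singleton, Finset.mem_insert, not_or]
    have e : ({p, u, v} : Finset ℕ) = insert u (insert v {p}) := by
      ext z; simp only [Finset.mem_insert, Finset.mem_singleton]; tauto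
    rw [e, Finset.pair_comm p u, Finset.pair_comm p v]
    constructor
    · rintro ⟨⟨a, b, c⟩, a', b', c'⟩
      exact ⟨⟨b, a⟩, h.lc {p} (by simp) (by simpa using Ne.symm b) (by simpa using Ne.symm a) c c'⟩
    · rintro ⟨⟨a, b⟩, c⟩
      exact ⟨⟨b, a, c.mono (Finset.insert_subset_insert _ (Finset.subset_insert _ _))⟩,
        a, b, c.mono (Finset.subset_insert _ _)⟩
  have e6 := Finset.card_union_add_card_inter ((nb T {u}).erase v) ((nb T {v}).erase u)
  have hvu : v ∈ nb T {u} := mem_nb.2 ⟨by simpa using h.ne.symm, by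
    rw [Finset.pair_comm]; exact h.edge⟩
  have huv : u ∈ nb T {v} := mem_nb.2 ⟨by simpa using h.ne, h.edge⟩
  have := Finset.card_erase_add_one hvu
  have := Finset.card_erase_add_one huv
  rw [e3, e4] at e2
  rw [e5] at e6
  omega

theorem CH.g2 (h : CH T u v w) :
    (gen (ctr T u v w)).g2 = (gen T).g2 + 3 - (nb T {u, v}).card := by
  have h0 := h.f0
  have h1 := h.f1
  unfold SComplex.g2
  omega

end

theorem two_of {T : Finset (Finset ℕ)}
    (h : ∀ r : Finset ℕ, r.card = 3 → Fc T r → ∃ A ∈ T, ∃ B ∈ T, A ≠ B ∧ r ⊆ A ∧ r ⊆ B ∧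
      ∀ H ∈ T, r ⊆ H → H = A ∨ H = B) :
    ∀ F ∈ T, ∀ r ⊆ F, r.card = 3 → ∃ G ∈ T, G ≠ F ∧ r ⊆ G ∧ ∀ H ∈ T, r ⊆ H → H = F ∨ H = G := by
  intro F hF r hr hr3
  obtain ⟨A, hA, B, hB, hAB, hrA, hrB, hall⟩ := h r hr3 ⟨F, hF, hr⟩
  rcases hall F hF hr with rfl | rfl
  · exact ⟨B, hB, hAB.symm, hrB, hall⟩
  · exact ⟨A, hA, hAB, hrA, fun H a b => (hall H a b).symm⟩

theorem Good.two' {T : Finset (Finset ℕ)} (hT : Good T) {r : Finset ℕ} (hr3 : r.card = 3)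
    (hr : Fc T r) : ∃ A ∈ T, ∃ B ∈ T, A ≠ B ∧ r ⊆ A ∧ r ⊆ B ∧ ∀ H ∈ T, r ⊆ H → H = A ∨ H = B := by
  obtain ⟨F, hF, hrF⟩ := hr
  obtain ⟨G, hG, hGF, hrG, hall⟩ := hT.two F hF r hrF hr3
  exact ⟨F, hF, G, hG, hGF.symm, hrF, hrG, hall⟩

/-- bistellar 2-move -/
def bs (T : Finset (Finset ℕ)) (u v : ℕ) (A : Finset ℕ) : Finset (Finset ℕ) :=
  (T.filter fun F => ¬ (u ∈ F ∧ v ∈ F)) ∪ {insert u A, insert v A}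

structure BH (T : Finset (Finset ℕ)) (u v : ℕ) (A : Finset ℕ) : Prop where
  good : Good T
  ne : u ≠ v
  card3 : A.card = 3
  hu : u ∉ A
  hv : v ∉ A
  hA : ¬ Fc T A
  hl : ∀ s : Finset ℕ, u ∉ s → v ∉ s → (Fc T (insert u (insert v s)) ↔ s ⊆ A ∧ s ≠ A)

theorem bs_comm (T : Finset (Finset ℕ)) (u v : ℕ) (A : Finset ℕ) : bs T u v A = bs T v u A := by
  unfold bs
  rw [Finset.pair_comm]
  congr 1
  ext F; simp only [Finset.mem_filter]; tauto

section
variable {T : Finset (Finset ℕ)} {u v : ℕ} {A : Finset ℕ}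

theorem BH.symm (h : BH T u v A) : BH T v u A where
  good := h.good
  ne := h.ne.symm
  card3 := h.card3
  hu := h.hv
  hv := h.hu
  hA := h.hA
  hl := fun s a b => by rw [Finset.insert_comm]; exact h.hl s b a

theorem mem_bs {F : Finset ℕ} : F ∈ bs T u v A ↔
    (F ∈ T ∧ ¬ (u ∈ F ∧ v ∈ F)) ∨ F = insert u A ∨ F = insert v A := by
  simp only [bs, Finset.mem_union, Finset.mem_filter, Finset.mem_insert, Finset.mem_singleton]

theorem BH.both (h : BH T u v A) {F : Finset ℕ} (hF : F ∈ T) (hu : u ∈ F) (hv : v ∈ F) :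
    F.erase v ⊆ insert u A := by
  have h1 := (h.hl ((F.erase v).erase u) (by simp) (by simp)).1 ⟨F, hF, by
    intro x hx
    simp only [Finset.mem_insert, Finset.mem_erase] at hx
    rcases hx with e | e | e
    · rw [e]; exact hu
    · rw [e]; exact hv
    · exact e.2.2⟩
  intro x hx
  by_cases hxu : x = u
  · simp [hxu]
  · exact Finset.mem_insert_of_mem (h1.1 (Finset.mem_erase.2 ⟨hxu, hx⟩))

theorem BH.Fc_bs (h : BH T u v A) {s : Finset ℕ} :
    Fc (bs T u v A) s ↔ (Fc T s ∧ ¬ (u ∈ s ∧ v ∈ s)) ∨ s ⊆ insert u A ∨ s ⊆ insert v A := by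
  constructor
  · rintro ⟨F, hF, hs⟩
    rcases mem_bs.1 hF with ⟨h1, h2⟩ | rfl | rfl
    · exact Or.inl ⟨⟨F, h1, hs⟩, fun h3 => h2 ⟨hs h3.1, hs h3.2⟩⟩
    · exact Or.inr (Or.inl hs)
    · exact Or.inr (Or.inr hs)
  · rintro (⟨⟨F, hF, hs⟩, hb⟩ | hs | hs)
    · by_cases hFb : u ∈ F ∧ v ∈ F
      · by_cases hvs : v ∈ s
        · have hus : u ∉ s := fun h3 => hb ⟨h3, hvs⟩
          refine ⟨insert v A, mem_bs.2 (Or.inr (Or.inr rfl)), ?_⟩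
          refine subset_trans ?_ (h.symm.both hF hFb.2 hFb.1)
          exact fun x hx => Finset.mem_erase.2 ⟨ne_of_mem_of_not_mem hx hus, hs hx⟩
        · refine ⟨insert u A, mem_bs.2 (Or.inr (Or.inl rfl)), ?_⟩
          refine subset_trans ?_ (h.both hF hFb.1 hFb.2)
          exact fun x hx => Finset.mem_erase.2 ⟨ne_of_mem_of_not_mem hx hvs, hs hx⟩
      · exact ⟨F, mem_bs.2 (Or.inl ⟨hF, hFb⟩), hs⟩
    · exact ⟨_, mem_bs.2 (Or.inr (Or.inl rfl)), hs⟩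
    · exact ⟨_, mem_bs.2 (Or.inr (Or.inr rfl)), hs⟩

theorem BH.small (h : BH T u v A) {s : Finset ℕ} (hs : s ⊆ insert u A) (hsA : s.erase u ≠ A) :
    Fc T s := by
  have h1 : s.erase u ⊆ A := by
    intro x hx
    rw [Finset.mem_erase] at hx
    exact (Finset.mem_insert.1 (hs hx.2)).resolve_left hx.1
  have h2 := (h.hl (s.erase u) (by simp) (fun hv => h.hv (h1 hv))).2 ⟨h1, hsA⟩
  refine h2.mono ?_
  intro x hx
  by_cases hxu : x = u
  · simp [hxu]
  · simp [hxu, hx]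

theorem BH.two_u (h : BH T u v A) {r : Finset ℕ} (hr3 : r.card = 3) (hr : r ⊆ insert u A)
    (hrA : r ≠ A) : ∃ B ∈ bs T u v A, ∃ C ∈ bs T u v A, B ≠ C ∧ r ⊆ B ∧ r ⊆ C ∧
      ∀ H ∈ bs T u v A, r ⊆ H → H = B ∨ H = C := by
  have hur : u ∈ r := by
    by_contra hur
    apply hrA
    apply Finset.eq_of_subset_of_card_le _ (by rw [hr3, h.card3])
    intro x hx
    exact (Finset.mem_insert.1 (hr hx)).resolve_left (ne_of_mem_of_not_mem hx hur)
  have hvr : v ∉ r := by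
    intro hvr
    have := hr hvr
    simp [h.ne.symm, h.hv] at this
  have he : r.erase u ⊆ A := by
    intro x hx
    rw [Finset.mem_erase] at hx
    exact (Finset.mem_insert.1 (hr hx.2)).resolve_left hx.1
  have heA : r.erase u ≠ A := by
    intro e
    have := congrArg Finset.card e
    rw [Finset.card_erase_of_mem hur, h.card3] at this
    omega
  have hF0 : insert v r ∈ T := by
    have := (h.hl (r.erase u) (by simp) (fun hv => h.hv (he hv))).2 ⟨he, heA⟩
    rw [Finset.insert_comm, Finset.insert_erase hur] at this
    exact mem_of_card h.good.card4 this (by rw [Finset.card_insert_of_notMem hvr]; omega)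
  obtain ⟨G, hG, hGF, hrG, hall⟩ := h.good.two _ hF0 r (Finset.subset_insert _ _) hr3
  have hvG : v ∉ G := by
    intro hv
    apply hGF
    symm
    exact Finset.eq_of_subset_of_card_le (Finset.insert_subset hv hrG)
      (by rw [h.good.card4 _ hF0, h.good.card4 _ hG])
  refine ⟨G, mem_bs.2 (Or.inl ⟨hG, fun h => hvG h.2⟩), insert u A, mem_bs.2 (Or.inr (Or.inl rfl)),
    ?_, hrG, hr, ?_⟩
  · rintro rfl
    exact h.hA ⟨_, hG, Finset.subset_insert _ _⟩
  · intro H hH hrH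
    rcases mem_bs.1 hH with ⟨h1, h2⟩ | rfl | rfl
    · rcases hall H h1 hrH with rfl | rfl
      · exact absurd ⟨by simp [hur], by simp⟩ h2
      · exact Or.inl rfl
    · exact Or.inr rfl
    · have := hrH hur
      simp [h.ne, h.hu] at this

theorem BH.conn_bs (h : BH T u v A) : ∀ σ : Finset ℕ, σ.card ≤ 2 → ∀ p q, p ∉ σ → q ∉ σ →
    Fc (bs T u v A) (insert p σ) → Fc (bs T u v A) (insert q σ) →
    Relation.ReflTransGen (LA (bs T u v A) σ) p q := by
  intro σ hσ p q hp hq hpT hqT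
  have hnb : ¬ (u ∈ σ ∧ v ∈ σ) := by
    rintro ⟨h1, h2⟩
    rcases h.Fc_bs.1 hpT with h3 | h3 | h3
    · exact h3.2 (by simp [h1, h2])
    · have := h3 (Finset.mem_insert_of_mem h2); simp [h.ne.symm, h.hv] at this
    · have := h3 (Finset.mem_insert_of_mem h1); simp [h.ne, h.hu] at this
  set bad : ℕ → Prop := fun x => (x = u ∧ v ∈ σ) ∨ (x = v ∧ u ∈ σ) with hbad
  set Rep : ℕ → ℕ → Prop := fun x x' => (¬ bad x ∧ x' = x) ∨
    (bad x ∧ x' ∈ A ∧ x' ∉ σ ∧ (σ ⊆ insert u A ∨ σ ⊆ insert v A)) with hRep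
  have hAA : ∀ x ∈ A, ∀ y ∈ A, x ∉ σ → y ∉ σ → (σ ⊆ insert u A ∨ σ ⊆ insert v A) →
      LA (bs T u v A) σ x y := by
    intro x hx y hy hxσ hyσ hor
    refine ⟨hxσ, hyσ, h.Fc_bs.2 (Or.inr ?_)⟩
    exact hor.imp
      (fun hs => Finset.insert_subset (by simp [hx]) (Finset.insert_subset (by simp [hy]) hs))
      (fun hs => Finset.insert_subset (by simp [hx]) (Finset.insert_subset (by simp [hy]) hs))
  -- the star of a bad vertex
  have hbadst : ∀ x, bad x → ∀ s, Fc T (insert x s) → σ ⊆ s → x ∉ s → 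
      (σ ⊆ insert u A ∨ σ ⊆ insert v A) ∧ (∀ y ∈ s, y ∉ σ → y ∈ A) ∧ ∃ z ∈ A, z ∉ s := by
    have key : ∀ u v, BH T u v A → v ∈ σ → ∀ s, Fc T (insert u s) → σ ⊆ s → u ∉ s →
        σ ⊆ insert v A ∧ (∀ y ∈ s, y ∉ σ → y ∈ A) ∧ ∃ z ∈ A, z ∉ s := by
      intro u v h hv s hs hσs hus
      have hvs : v ∈ s := hσs hv
      have h1 := (h.hl (s.erase v) (fun h => hus (Finset.mem_of_mem_erase h)) (by simp)).1
        (by rw [Finset.insert_erase hvs]; exact hs)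
      refine ⟨?_, ?_, ?_⟩
      · intro x hx
        by_cases hxv : x = v
        · simp [hxv]
        · exact Finset.mem_insert_of_mem (h1.1 (Finset.mem_erase.2 ⟨hxv, hσs hx⟩))
      · intro y hy hyσ
        exact h1.1 (Finset.mem_erase.2 ⟨(ne_of_mem_of_not_mem hv hyσ).symm, hy⟩)
      · by_contra hcon
        push Not at hcon
        apply h1.2
        apply h1.1.antisymm
        intro z hz
        exact Finset.mem_erase.2 ⟨fun e => h.hv (e ▸ hz), hcon z hz⟩
    rintro x (⟨rfl, hv⟩ | ⟨rfl, hv⟩) s hs hσs hxs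
    · obtain ⟨a, b, c⟩ := key x v h hv s hs hσs hxs
      exact ⟨Or.inr a, b, c⟩
    · obtain ⟨a, b, c⟩ := key x u h.symm hv s hs hσs hxs
      exact ⟨Or.inl a, b, c⟩
  have hend : ∀ p, p ∉ σ → Fc (bs T u v A) (insert p σ) → ∃ p0, p0 ∉ σ ∧ Fc T (insert p0 σ) ∧
      Rep p0 p0 ∧ Relation.ReflTransGen (LA (bs T u v A) σ) p p0 := by
    intro p hp hpT
    by_cases hpF : Fc T (insert p σ)
    · refine ⟨p, hp, hpF, Or.inl ⟨?_, rfl⟩, Relation.ReflTransGen.refl⟩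
      have hnb' : ¬ (u ∈ insert p σ ∧ v ∈ insert p σ) := by
        rcases h.Fc_bs.1 hpT with h3 | h3 | h3
        · exact h3.2
        · rintro ⟨h1, h2⟩
          have := h3 h2; simp [h.ne.symm, h.hv] at this
        · rintro ⟨h1, h2⟩
          have := h3 h1; simp [h.ne, h.hu] at this
      rintro (⟨rfl, h1⟩ | ⟨rfl, h1⟩)
      · exact hnb' ⟨by simp, by simp [h1]⟩
      · exact hnb' ⟨by simp [h1], by simp⟩
    · have key : ∀ u v, BH T u v A → insert p σ ⊆ insert u A → insert p σ = A := by
        intro u v h hs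
        have h1 : (insert p σ).erase u = A := by
          by_contra hcon
          exact hpF (h.small hs hcon)
        apply (Finset.eq_of_subset_of_card_le _ _).symm
        · rw [← h1]; exact Finset.erase_subset _ _
        · rw [h.card3, Finset.card_insert_of_notMem hp]; omega
      have hpA : insert p σ = A := by
        rcases h.Fc_bs.1 hpT with h3 | h3 | h3
        · exact absurd h3.1 hpF
        · exact key u v h h3
        · exact key v u h.symm h3
      have hσA : σ ⊆ A := by rw [← hpA]; exact Finset.subset_insert _ _
      have huσ : u ∉ σ := fun hu => h.hu (hσA hu)
      have hvσ : v ∉ σ := fun hu => h.hv (hσA hu)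
      refine ⟨u, huσ, ?_, Or.inl ⟨?_, rfl⟩, Relation.ReflTransGen.single ⟨hp, huσ, ?_⟩⟩
      · refine ((h.hl σ huσ hvσ).2 ⟨hσA, ?_⟩).mono
          (Finset.insert_subset_insert _ (Finset.subset_insert _ _))
        rintro rfl; exact hp (hpA ▸ Finset.mem_insert_self _ _)
      · rintro (⟨_, h1⟩ | ⟨_, h1⟩)
        · exact hvσ h1
        · exact huσ h1
      · rw [Finset.insert_comm, hpA]
        exact h.Fc_bs.2 (Or.inr (Or.inl subset_rfl))
  obtain ⟨p0, hp0, hp0T, hp0R, hpp⟩ := hend p hp hpT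
  obtain ⟨q0, hq0, hq0T, hq0R, hqq⟩ := hend q hq hqT
  refine hpp.trans (Relation.ReflTransGen.trans ?_ (path_symm (fun a b => LA.symm) hqq))
  refine path_transfer (R := LA T σ) (Rep := Rep) ?_ ?_ ?_
    (h.good.conn σ hσ p0 q0 hp0 hq0 hp0T hq0T) hp0R hq0R
  · intro x y hxy
    by_cases hy : bad y
    · obtain ⟨h1, _, z, hz, hzs⟩ := hbadst y hy σ (hxy.2.2.mono (Finset.subset_insert _ _)) subset_rfl hxy.2.1
      exact ⟨z, Or.inr ⟨hy, hz, hzs, h1⟩⟩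
    · exact ⟨y, Or.inl ⟨hy, rfl⟩⟩
  · rintro x x' x'' (⟨h1, rfl⟩ | ⟨h1, h2, h3, h4⟩) (⟨h5, rfl⟩ | ⟨h5, h6, h7, h8⟩)
    · exact Relation.ReflTransGen.refl
    · contradiction
    · contradiction
    · exact Relation.ReflTransGen.single (hAA _ h2 _ h6 h3 h7 h4)
  · have mixed : ∀ x y x', LA T σ x y → bad x → ¬ bad y → x' ∈ A → x' ∉ σ →
        (σ ⊆ insert u A ∨ σ ⊆ insert v A) → LA (bs T u v A) σ x' y := by
      intro x y x' hxy hx hy hx' hx'σ hor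
      have hne : x ∉ insert y σ := by
        simp only [Finset.mem_insert, not_or]
        exact ⟨fun e => hy (e ▸ hx), hxy.1⟩
      have := (hbadst x hx (insert y σ) hxy.2.2 (Finset.subset_insert _ _) hne).2.1 y (by simp) hxy.2.1
      exact hAA _ hx' _ this hx'σ hxy.2.1 hor
    rintro x y x' y' hxy (⟨h1, rfl⟩ | ⟨h1, h2, h3, h4⟩) (⟨h5, rfl⟩ | ⟨h5, h6, h7, h8⟩)
    · by_cases hb : u ∈ insert x' (insert y' σ) ∧ v ∈ insert x' (insert y' σ)
      · have key : ∀ u v, BH T u v A → Fc T (insert u (insert v σ)) → u ∉ σ → v ∉ σ →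
            ∃ z ∈ A, z ∉ σ ∧ σ ⊆ A := by
          intro u v h h1 hu hv
          have h2 := (h.hl σ hu hv).1 h1
          by_contra hcon
          push Not at hcon
          apply h2.2
          apply h2.1.antisymm
          intro z hz
          by_contra hzσ
          exact hcon z hz hzσ h2.1
        have hcase : (x' = u ∧ y' = v) ∨ (x' = v ∧ y' = u) := by
          simp only [Finset.mem_insert] at hb
          have h11 := h.ne
          simp only [hbad] at h1 h5
          obtain ⟨hx1, hy1, _⟩ := hxy
          grind
        have step : ∀ z ∈ A, z ∉ σ → σ ⊆ A → ∀ x, (x = u ∨ x = v) → x ∉ σ → LA (bs T u v A) σ x z := by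
          intro z hz hzσ hσA x hx hxσ
          refine ⟨hxσ, hzσ, h.Fc_bs.2 (Or.inr ?_)⟩
          have hs := Finset.insert_subset hz hσA
          exact hx.imp (fun e => by rw [e]; exact Finset.insert_subset_insert _ hs) (fun e => by rw [e]; exact Finset.insert_subset_insert _ hs)
        rcases hcase with ⟨e1, e2⟩ | ⟨e1, e2⟩
        · obtain ⟨z, hz, hzσ, hσA⟩ := key u v h (e1 ▸ e2 ▸ hxy.2.2) (e1 ▸ hxy.1) (e2 ▸ hxy.2.1)
          exact (Relation.ReflTransGen.single (step z hz hzσ hσA x' (Or.inl e1) hxy.1)).tail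
            (step z hz hzσ hσA y' (Or.inr e2) hxy.2.1).symm
        · obtain ⟨z, hz, hzσ, hσA⟩ := key v u h.symm (e1 ▸ e2 ▸ hxy.2.2) (e1 ▸ hxy.1) (e2 ▸ hxy.2.1)
          exact (Relation.ReflTransGen.single (step z hz hzσ hσA x' (Or.inr e1) hxy.1)).tail
            (step z hz hzσ hσA y' (Or.inl e2) hxy.2.1).symm
      · exact Relation.ReflTransGen.single ⟨hxy.1, hxy.2.1, h.Fc_bs.2 (Or.inl ⟨hxy.2.2, hb⟩)⟩
    · exact Relation.ReflTransGen.single (mixed _ _ _ hxy.symm h5 h1 h6 h7 h8).symm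
    · exact Relation.ReflTransGen.single (mixed _ _ _ hxy h1 h5 h2 h3 h4)
    · exact Relation.ReflTransGen.single (hAA _ h2 _ h6 h3 h7 h4)

theorem BH.good_bs (h : BH T u v A) : Good (bs T u v A) where
  ne := ⟨insert u A, mem_bs.2 (Or.inr (Or.inl rfl))⟩
  card4 := by
    intro F hF
    rcases mem_bs.1 hF with ⟨h1, _⟩ | rfl | rfl
    · exact h.good.card4 _ h1
    · rw [Finset.card_insert_of_notMem h.hu, h.card3]
    · rw [Finset.card_insert_of_notMem h.hv, h.card3]
  two := by
    apply two_of
    intro r hr3 hr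
    by_cases hrA : r = A
    · subst hrA
      refine ⟨_, mem_bs.2 (Or.inr (Or.inl rfl)), _, mem_bs.2 (Or.inr (Or.inr rfl)), ?_,
        Finset.subset_insert _ _, Finset.subset_insert _ _, ?_⟩
      · intro e
        have : u ∈ insert v r := by rw [← e]; simp
        simp [h.ne, h.hu] at this
      · intro H hH hrH
        rcases mem_bs.1 hH with ⟨h1, _⟩ | rfl | rfl
        · exact absurd ⟨H, h1, hrH⟩ h.hA
        · exact Or.inl rfl
        · exact Or.inr rfl
    by_cases h1 : r ⊆ insert u A
    · exact h.two_u hr3 h1 hrA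
    by_cases h2 : r ⊆ insert v A
    · have := h.symm.two_u hr3 h2 hrA
      rwa [bs_comm] at this
    rcases h.Fc_bs.1 hr with ⟨hrT, hb⟩ | h3 | h3
    · obtain ⟨B, hB, C, hC, hBC, hrB, hrC, hall⟩ := h.good.two' hr3 hrT
      have nb : ∀ B ∈ T, r ⊆ B → B ∈ bs T u v A := by
        intro B hB hrB
        refine mem_bs.2 (Or.inl ⟨hB, ?_⟩)
        rintro ⟨hu, hv⟩
        by_cases hvr : v ∈ r
        · have hur : u ∉ r := fun h => hb ⟨h, hvr⟩
          apply h2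
          refine subset_trans ?_ (h.symm.both hB hv hu)
          exact fun x hx => Finset.mem_erase.2 ⟨ne_of_mem_of_not_mem hx hur, hrB hx⟩
        · apply h1
          refine subset_trans ?_ (h.both hB hu hv)
          exact fun x hx => Finset.mem_erase.2 ⟨ne_of_mem_of_not_mem hx hvr, hrB hx⟩
      refine ⟨B, nb B hB hrB, C, nb C hC hrC, hBC, hrB, hrC, ?_⟩
      intro H hH hrH
      rcases mem_bs.1 hH with ⟨h3, _⟩ | rfl | rfl
      · exact hall H h3 hrH
      · exact absurd hrH h1
      · exact absurd hrH h2
    · exact absurd h3 h1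
    · exact absurd h3 h2
  conn := h.conn_bs

theorem BH.move (h : BH T u v A) : BistellarTwoMove (gen T) (gen (bs T u v A)) := by
  obtain ⟨a, b, c, hab, hac, hbc, hA⟩ := Finset.card_eq_three.1 h.card3
  subst hA
  have hA0 : ({a, b, c} : Finset ℕ) ≠ ∅ := by simp
  refine ⟨u, v, a, b, c, mem_gen.2 ⟨?_, by simp⟩, h.ne, h.card3, h.hu, h.hv, ?_, ?_, ?_⟩
  · exact (h.hl ∅ (by simp) (by simp)).2 ⟨by simp, hA0.symm⟩
  · ext s
    rw [mem_lk_gen]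
    simp only [properFaces, Finset.mem_filter, Finset.mem_powerset]
    have e2 : s ∪ {u, v} = insert u (insert v s) := by
      ext x; simp only [Finset.mem_union, Finset.mem_insert, Finset.mem_singleton]; tauto
    have e3 : s ∩ {u, v} = ∅ ↔ u ∉ s ∧ v ∉ s := by
      rw [← Finset.disjoint_iff_inter_eq_empty]
      simp [Finset.disjoint_insert_right]
    rw [e2, e3]
    constructor
    · rintro ⟨h1, ⟨h2, h3⟩, h4⟩
      have := (h.hl s h2 h3).1 h4
      exact ⟨this.1, h1, this.2⟩
    · rintro ⟨h1, h2, h3⟩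
      have hu : u ∉ s := fun hu => h.hu (h1 hu)
      have hv : v ∉ s := fun hu => h.hv (h1 hu)
      exact ⟨h2, ⟨hu, hv⟩, (h.hl s hu hv).2 ⟨h1, h3⟩⟩
  · rw [mem_gen]; exact fun hh => h.hA hh.1
  · ext s
    simp only [mem_gen, Finset.mem_union, Finset.mem_filter, simplexFaces, Finset.mem_powerset, h.Fc_bs]
    have : ({u, v} : Finset ℕ) ⊆ s ↔ u ∈ s ∧ v ∈ s := by
      rw [Finset.insert_subset_iff, Finset.singleton_subset_iff]
    rw [this]
    tauto

theorem BH.smallc (h : BH T u v A) {s : Finset ℕ} (hs : Fc (bs T u v A) s) (hc : s.card ≤ 2) :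
    Fc T s ∧ ¬ (u ∈ s ∧ v ∈ s) := by
  have key : ∀ u v, BH T u v A → s ⊆ insert u A → Fc T s ∧ v ∉ s := by
    intro u v h hs
    refine ⟨h.small hs ?_, ?_⟩
    · intro e
      have := Finset.card_erase_le (s := s) (a := u)
      rw [e, h.card3] at this
      omega
    · intro hv
      have := hs hv
      simp [h.ne.symm, h.hv] at this
  rcases h.Fc_bs.1 hs with h1 | h1 | h1
  · exact h1
  · exact ⟨(key u v h h1).1, fun h2 => (key u v h h1).2 h2.2⟩
  · exact ⟨(key v u h.symm h1).1, fun h2 => (key v u h.symm h1).2 h2.1⟩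

theorem BH.g2 (h : BH T u v A) : (gen (bs T u v A)).g2 = (gen T).g2 - 1 := by
  have hA0 : A ≠ ∅ := by intro e; have := h.card3; rw [e] at this; simp at this
  have huv : Fc T {u, v} := (h.hl ∅ (by simp) (by simp)).2 ⟨by simp, hA0.symm⟩
  have h0 : (gen (bs T u v A)).fnum 0 = (gen T).fnum 0 := by
    rw [fnum0_gen, fnum0_gen]
    congr 1
    ext x
    rw [mem_biUnion_Fc, mem_biUnion_Fc]
    constructor
    · intro h1; exact (h.smallc h1 (by simp)).1
    · intro h1
      refine h.Fc_bs.2 (Or.inl ⟨h1, ?_⟩)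
      simp only [Finset.mem_singleton]
      rintro ⟨rfl, h2⟩
      exact h.ne h2.symm
  have h1 : (gen T).fnum 1 = (gen (bs T u v A)).fnum 1 + 1 := by
    rw [fnum1_gen, fnum1_gen]
    have hn : ({u, v} : Finset ℕ) ∉ edg (bs T u v A) := by
      rw [mem_edg]
      rintro ⟨h1, h2⟩
      exact (h.smallc h1 h2.le).2 (by simp)
    rw [← Finset.card_insert_of_notMem hn]
    congr 1
    ext e
    rw [Finset.mem_insert, mem_edg, mem_edg]
    constructor
    · rintro ⟨h1, h2⟩
      by_cases hb : u ∈ e ∧ v ∈ e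
      · left
        symm
        apply Finset.eq_of_subset_of_card_le
        · exact Finset.insert_subset hb.1 (by simpa using hb.2)
        · rw [h2, Finset.card_pair h.ne]
      · exact Or.inr ⟨h.Fc_bs.2 (Or.inl ⟨h1, hb⟩), h2⟩
    · rintro (rfl | ⟨h1, h2⟩)
      · exact ⟨huv, Finset.card_pair h.ne⟩
      · exact ⟨(h.smallc h1 h2.le).1, h2⟩
  unfold SComplex.g2
  omega

end

theorem two_of_nbrs {T : Finset (Finset ℕ)} (h4 : ∀ F ∈ T, F.card = 4)
    (h : ∀ r : Finset ℕ, r.card = 3 → Fc T r → ∃ x y, x ≠ y ∧ x ∉ r ∧ y ∉ r ∧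
      Fc T (insert x r) ∧ Fc T (insert y r) ∧ ∀ z, z ∉ r → Fc T (insert z r) → z = x ∨ z = y) :
    ∀ F ∈ T, ∀ r ⊆ F, r.card = 3 → ∃ G ∈ T, G ≠ F ∧ r ⊆ G ∧ ∀ H ∈ T, r ⊆ H → H = F ∨ H = G := by
  apply two_of
  intro r hr3 hr
  obtain ⟨x, y, hxy, hx, hy, h1, h2, h3⟩ := h r hr3 hr
  refine ⟨insert x r, mem_of_card h4 h1 (by rw [Finset.card_insert_of_notMem hx]; omega),
    insert y r, mem_of_card h4 h2 (by rw [Finset.card_insert_of_notMem hy]; omega), ?_,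
    Finset.subset_insert _ _, Finset.subset_insert _ _, ?_⟩
  · intro e
    have := e ▸ Finset.mem_insert_self x r
    rcases Finset.mem_insert.1 this with e | e
    · exact hxy e
    · exact hx e
  · intro H hH hrH
    obtain ⟨z, hz, rfl⟩ := tet_eq_insert (h4 _ hH) hr3 hrH
    rcases h3 z hz ⟨_, hH, subset_rfl⟩ with rfl | rfl
    · exact Or.inl rfl
    · exact Or.inr rfl

/-- data for an edge expansion at `a`: the tetrahedra at `a` are coloured by `D`, and `Z` is the
set of edges of the link of `a` across which the colour changes. -/
structure EH (T : Finset (Finset ℕ)) (a : ℕ) (b : Bool → ℕ) (D : Finset ℕ → Bool)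
    (Z : Finset (Finset ℕ)) : Prop where
  good : Good T
  bne : b true ≠ b false
  ba : ∀ i, b i ≠ a
  fresh : ∀ i, ∀ F ∈ T, b i ∉ F
  hZ : ∀ e, e ∈ Z ↔ e.card = 2 ∧ a ∉ e ∧ ∀ i, ∃ F ∈ T, D F = i ∧ insert a e ⊆ F
  Zne : Z.Nonempty
  Z2 : ∀ p, (∃ e ∈ Z, p ∈ e) → ∃ x y, x ≠ y ∧ ({p, x} : Finset ℕ) ∈ Z ∧ ({p, y} : Finset ℕ) ∈ Z ∧
    ∀ z, ({p, z} : Finset ℕ) ∈ Z → z = x ∨ z = y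
  Zc : ∀ p q, (∃ e ∈ Z, p ∈ e) → (∃ e ∈ Z, q ∈ e) →
    Relation.ReflTransGen (fun x y => ({x, y} : Finset ℕ) ∈ Z) p q

def exN (a : ℕ) (b : Bool → ℕ) (D : Finset ℕ → Bool) (F : Finset ℕ) : Finset ℕ :=
  if a ∈ F then insert (b (D F)) (F.erase a) else F

/-- the edge expansion -/
def expn (T : Finset (Finset ℕ)) (a : ℕ) (b : Bool → ℕ) (D : Finset ℕ → Bool)
    (Z : Finset (Finset ℕ)) : Finset (Finset ℕ) :=
  T.image (exN a b D) ∪ Z.image fun e => insert (b true) (insert (b false) e)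

section
variable {T : Finset (Finset ℕ)} {a : ℕ} {b : Bool → ℕ} {D : Finset ℕ → Bool}
  {Z : Finset (Finset ℕ)}

theorem EH.bne' (h : EH T a b D Z) {i j : Bool} : b i = b j ↔ i = j := by
  have := h.bne
  cases i <;> cases j <;> simp [this, this.symm]

theorem EH.bFc (h : EH T a b D Z) {s : Finset ℕ} (hs : Fc T s) (i : Bool) : b i ∉ s := by
  obtain ⟨F, hF, hsF⟩ := hs
  exact fun hw => h.fresh i F hF (hsF hw)

theorem EH.bZ (h : EH T a b D Z) {e : Finset ℕ} (he : e ∈ Z) (i : Bool) : b i ∉ e := by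
  obtain ⟨F, hF, _, hs⟩ := ((h.hZ e).1 he).2.2 true
  exact fun h1 => h.fresh i F hF (hs (Finset.mem_insert_of_mem h1))

theorem EH.Fc_tet (h : EH T a b D Z) {s : Finset ℕ} : Fc (expn T a b D Z) s ↔
    (∃ F ∈ T, s ⊆ exN a b D F) ∨ ∃ e ∈ Z, s ⊆ insert (b true) (insert (b false) e) := by
  unfold Fc expn
  constructor
  · rintro ⟨F, hF, hs⟩
    simp only [Finset.mem_union, Finset.mem_image] at hF
    rcases hF with ⟨G, hG, rfl⟩ | ⟨e, he, rfl⟩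
    · exact Or.inl ⟨G, hG, hs⟩
    · exact Or.inr ⟨e, he, hs⟩
  · rintro (⟨F, hF, hs⟩ | ⟨e, he, hs⟩)
    · exact ⟨_, Finset.mem_union_left _ (Finset.mem_image_of_mem _ hF), hs⟩
    · refine ⟨insert (b true) (insert (b false) e), Finset.mem_union_right _ ?_, hs⟩
      exact Finset.mem_image.2 ⟨e, he, rfl⟩

theorem EH.a_fresh (h : EH T a b D Z) : ∀ F ∈ expn T a b D Z, a ∉ F := by
  intro F hF
  simp only [expn, Finset.mem_union, Finset.mem_image] at hF
  rcases hF with ⟨G, hG, rfl⟩ | ⟨e, he, rfl⟩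
  · unfold exN
    split_ifs with h1
    · simp [(h.ba _).symm]
    · exact h1
  · simp [(h.ba _).symm, ((h.hZ e).1 he).2.1]

theorem EH.aFc (h : EH T a b D Z) {s : Finset ℕ} (hs : Fc (expn T a b D Z) s) : a ∉ s := by
  obtain ⟨F, hF, hsF⟩ := hs
  exact fun hw => h.a_fresh F hF (hsF hw)

theorem EH.card4 (h : EH T a b D Z) : ∀ F ∈ expn T a b D Z, F.card = 4 := by
  intro F hF
  simp only [expn, Finset.mem_union, Finset.mem_image] at hF
  rcases hF with ⟨G, hG, rfl⟩ | ⟨e, he, rfl⟩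
  · unfold exN
    split_ifs with h1
    · rw [Finset.card_insert_of_notMem, Finset.card_erase_of_mem h1, h.good.card4 _ hG]
      exact fun h2 => h.fresh _ G hG (Finset.mem_of_mem_erase h2)
    · exact h.good.card4 _ hG
  · rw [Finset.card_insert_of_notMem, Finset.card_insert_of_notMem (h.bZ he _), ((h.hZ e).1 he).1]
    simp [h.bne, h.bZ he]

theorem EH.M0 (h : EH T a b D Z) {s : Finset ℕ} (hb : ∀ i, b i ∉ s) :
    Fc (expn T a b D Z) s ↔ a ∉ s ∧ Fc T s := by
  constructor
  · intro hs
    refine ⟨h.aFc hs, ?_⟩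
    rcases h.Fc_tet.1 hs with ⟨F, hF, hsF⟩ | ⟨e, he, hse⟩
    · refine ⟨F, hF, fun x hx => ?_⟩
      have := hsF hx
      unfold exN at this
      split_ifs at this
      · rcases Finset.mem_insert.1 this with e | e
        · exact absurd (e ▸ hx) (hb _)
        · exact Finset.mem_of_mem_erase e
      · exact this
    · obtain ⟨F, hF, _, hs⟩ := ((h.hZ e).1 he).2.2 true
      refine ⟨F, hF, fun x hx => hs ?_⟩
      have := hse hx
      simp only [Finset.mem_insert] at this
      rcases this with e | e | e
      · exact absurd (e ▸ hx) (hb _)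
      · exact absurd (e ▸ hx) (hb _)
      · exact Finset.mem_insert_of_mem e
  · rintro ⟨ha, F, hF, hs⟩
    refine h.Fc_tet.2 (Or.inl ⟨F, hF, fun x hx => ?_⟩)
    unfold exN
    split_ifs
    · exact Finset.mem_insert_of_mem (Finset.mem_erase.2 ⟨fun e => ha (e ▸ hx), hs hx⟩)
    · exact hs hx

theorem EH.M1 (h : EH T a b D Z) {s : Finset ℕ} (hb : ∀ i, b i ∉ s) (i : Bool) :
    Fc (expn T a b D Z) (insert (b i) s) ↔ a ∉ s ∧ ∃ F ∈ T, D F = i ∧ insert a s ⊆ F := by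
  constructor
  · intro hs
    refine ⟨fun h1 => h.aFc hs (Finset.mem_insert_of_mem h1), ?_⟩
    rcases h.Fc_tet.1 hs with ⟨F, hF, hsF⟩ | ⟨e, he, hse⟩
    · have h1 := hsF (Finset.mem_insert_self _ _)
      unfold exN at h1 hsF
      split_ifs at h1 hsF with h2
      · rcases Finset.mem_insert.1 h1 with e | e
        · refine ⟨F, hF, (h.bne'.1 e).symm, ?_⟩
          apply Finset.insert_subset h2
          intro x hx
          rcases Finset.mem_insert.1 (hsF (Finset.mem_insert_of_mem hx)) with e | e
          · exact absurd (e ▸ hx) (hb _)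
          · exact Finset.mem_of_mem_erase e
        · exact absurd (Finset.mem_of_mem_erase e) (h.fresh _ _ hF)
      · exact absurd h1 (h.fresh _ _ hF)
    · obtain ⟨F, hF, hD, hs⟩ := ((h.hZ e).1 he).2.2 i
      refine ⟨F, hF, hD, fun x hx => hs ?_⟩
      rcases Finset.mem_insert.1 hx with e1 | e1
      · simp [e1]
      have := hse (Finset.mem_insert_of_mem e1)
      simp only [Finset.mem_insert] at this
      rcases this with e | e | e
      · exact absurd (e ▸ e1) (hb _)
      · exact absurd (e ▸ e1) (hb _)
      · exact Finset.mem_insert_of_mem e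
  · rintro ⟨ha, F, hF, hD, hs⟩
    refine h.Fc_tet.2 (Or.inl ⟨F, hF, ?_⟩)
    unfold exN
    rw [if_pos (hs (Finset.mem_insert_self _ _)), hD]
    apply Finset.insert_subset_insert
    intro x hx
    exact Finset.mem_erase.2 ⟨fun e => ha (e ▸ hx), hs (Finset.mem_insert_of_mem hx)⟩

theorem EH.M2 (h : EH T a b D Z) {s : Finset ℕ} (hb : ∀ i, b i ∉ s) (i : Bool) :
    Fc (expn T a b D Z) (insert (b i) (insert (b !i) s)) ↔ ∃ e ∈ Z, s ⊆ e := by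
  have key : Fc (expn T a b D Z) (insert (b true) (insert (b false) s)) ↔ ∃ e ∈ Z, s ⊆ e := by
    constructor
    · intro hs
      rcases h.Fc_tet.1 hs with ⟨F, hF, hsF⟩ | ⟨e, he, hse⟩
      · exfalso
        have h0 := hsF (Finset.mem_insert_self _ _)
        have h1 := hsF (Finset.mem_insert_of_mem (Finset.mem_insert_self _ _))
        unfold exN at h0 h1
        have f0 := h.fresh true F hF
        have f1 := h.fresh false F hF
        split_ifs at h0 h1
        · simp only [Finset.mem_insert, Finset.mem_erase, f0, f1, and_false, or_false,
            h.bne'] at h0 h1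
          rw [← h0] at h1
          exact absurd h1 (by simp)
        · exact f0 h0
      · refine ⟨e, he, fun x hx => ?_⟩
        have := hse (Finset.mem_insert_of_mem (Finset.mem_insert_of_mem hx))
        simp only [Finset.mem_insert] at this
        rcases this with e | e | e
        · exact absurd (e ▸ hx) (hb _)
        · exact absurd (e ▸ hx) (hb _)
        · exact e
    · rintro ⟨e, he, hs⟩
      exact h.Fc_tet.2 (Or.inr ⟨e, he, Finset.insert_subset_insert _ (Finset.insert_subset_insert _ hs)⟩)
  cases i
  · rw [Finset.insert_comm]; exact key
  · exact key

/-- the key separation property -/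
theorem EH.sep (h : EH T a b D Z) {s : Finset ℕ} (ha : a ∉ s)
    (hs : ∀ i, ∃ F ∈ T, D F = i ∧ insert a s ⊆ F) : ∃ e ∈ Z, s ⊆ e := by
  obtain ⟨F, hF, hDF, hsF⟩ := hs true
  obtain ⟨G, hG, hDG, hsG⟩ := hs false
  have hc : (insert a s).card ≤ 3 := by
    by_contra hc
    have e1 := Finset.eq_of_subset_of_card_le hsF (by rw [h.good.card4 _ hF]; omega)
    have e2 := Finset.eq_of_subset_of_card_le hsG (by rw [h.good.card4 _ hG]; omega)
    rw [← e1] at hDF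
    rw [← e2, hDF] at hDG
    exact absurd hDG (by simp)
  have hsc := h.good.sc (3 - (insert a s).card) (insert a s) (by omega) F hF G hG hsF hsG
  by_contra hcon
  have : ∀ G, SC T (insert a s) F G → D G = true := by
    intro G hG
    induction hG with
    | refl => exact hDF
    | tail _ hbc ih =>
      obtain ⟨h1, h2, r, hr3, hsr, hr1, hr2⟩ := hbc
      by_contra hD
      apply hcon
      have har : a ∈ r := hsr (Finset.mem_insert_self _ _)
      refine ⟨r.erase a, (h.hZ _).2 ⟨by rw [Finset.card_erase_of_mem har, hr3], by simp, ?_⟩, ?_⟩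
      · rw [Finset.insert_erase har]
        intro i
        cases i
        · exact ⟨_, h2, by simpa using hD, hr2⟩
        · exact ⟨_, h1, ih, hr1⟩
      · intro x hx
        exact Finset.mem_erase.2 ⟨fun e => ha (e ▸ hx), hsr (Finset.mem_insert_of_mem hx)⟩
  rw [this G hsc] at hDG
  exact absurd hDG (by simp)

theorem EH.lc' (h : EH T a b D Z) {s : Finset ℕ} (hb : ∀ i, b i ∉ s) (i : Bool)
    (h1 : Fc (expn T a b D Z) (insert (b i) s)) (h2 : Fc (expn T a b D Z) (insert (b !i) s)) :
    Fc (expn T a b D Z) (insert (b i) (insert (b !i) s)) := by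
  rw [h.M2 hb]
  rw [h.M1 hb] at h1 h2
  apply h.sep h1.1
  intro j
  by_cases hj : j = i
  · exact hj ▸ h1.2
  · have : j = !i := by cases i <;> cases j <;> simp_all
    exact this ▸ h2.2

theorem EH.lc (h : EH T a b D Z) (i : Bool) : LCd (expn T a b D Z) (b i) (b !i) := by
  intro s _ h1 h2 h3 h4
  refine h.lc' (fun j => ?_) i h3 h4
  by_cases hj : j = i
  · exact hj ▸ h1
  · have : j = !i := by cases i <;> cases j <;> simp_all
    exact this ▸ h2

/-- trichotomy -/
theorem EH.tri (_h : EH T a b D Z) (s : Finset ℕ) : (∀ i, b i ∉ s) ∨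
    (∃ i t, s = insert (b i) t ∧ b i ∉ t ∧ b (!i) ∉ t) ∨
    (∃ t, s = insert (b true) (insert (b false) t) ∧ b true ∉ t ∧ b false ∉ t) := by
  by_cases h1 : b true ∈ s <;> by_cases h2 : b false ∈ s
  · refine Or.inr (Or.inr ⟨(s.erase (b true)).erase (b false), ?_, by simp, by simp⟩)
    ext x
    simp only [Finset.mem_insert, Finset.mem_erase]
    grind
  · exact Or.inr (Or.inl ⟨true, s.erase (b true), (Finset.insert_erase h1).symm, by simp, by simp [h2]⟩)
  · exact Or.inr (Or.inl ⟨false, s.erase (b false), (Finset.insert_erase h2).symm, by simp, by simp [h1]⟩)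
  · left
    intro i; cases i <;> assumption

theorem allb {s : Finset ℕ} {i : Bool} (h1 : b i ∉ s) (h2 : b (!i) ∉ s) : ∀ j, b j ∉ s := by
  intro j
  cases i <;> cases j <;> simp_all

end

section
variable {T : Finset (Finset ℕ)} {a : ℕ} {b : Bool → ℕ} {D : Finset ℕ → Bool}
  {Z : Finset (Finset ℕ)}

theorem not_b_insert {s : Finset ℕ} {z : ℕ} (hs : ∀ i, b i ∉ s) (hz : ∀ i, z ≠ b i) :
    ∀ i, b i ∉ insert z s := by
  intro i hi
  rcases Finset.mem_insert.1 hi with e | e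
  · exact hz i e.symm
  · exact hs i e

theorem EH.tetD (h : EH T a b D Z) {s F : Finset ℕ} (hF : F ∈ T) (hs : s.card = 4) (hsF : s ⊆ F) :
    F = s :=
  (Finset.eq_of_subset_of_card_le hsF (by rw [h.good.card4 _ hF]; omega)).symm

theorem EH.nbrs (h : EH T a b D Z) : ∀ r : Finset ℕ, r.card = 3 → Fc (expn T a b D Z) r →
    ∃ x y, x ≠ y ∧ x ∉ r ∧ y ∉ r ∧
      Fc (expn T a b D Z) (insert x r) ∧ Fc (expn T a b D Z) (insert y r) ∧
      ∀ z, z ∉ r → Fc (expn T a b D Z) (insert z r) → z = x ∨ z = y := by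
  intro r hr3 hr
  rcases h.tri r with hb | ⟨i, t, rfl, hi1, hi2⟩ | ⟨t, rfl, ht1, ht2⟩
  · obtain ⟨har, hTr⟩ := (h.M0 hb).1 hr
    obtain ⟨x, y, hxy, hx, hy, hx1, hy1, hall⟩ := h.good.nbrs2 hr3 hTr
    have nbx : ∀ x, insert x r ∈ T → ∀ i, x ≠ b i := by
      intro x hx i e
      exact h.fresh i _ hx (by rw [e]; simp)
    let f : ℕ → ℕ := fun x => if x = a then b (D (insert a r)) else x
    have fF : ∀ x, x ∉ r → insert x r ∈ T → f x ∉ r ∧ Fc (expn T a b D Z) (insert (f x) r) := by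
      intro x hx hxT
      by_cases hxa : x = a
      · subst hxa
        simp only [f, if_true]
        exact ⟨hb _, (h.M1 hb _).2 ⟨hx, _, hxT, rfl, subset_rfl⟩⟩
      · simp only [f, hxa, if_false]
        refine ⟨hx, (h.M0 (not_b_insert hb (nbx x hxT))).2 ⟨?_, _, hxT, subset_rfl⟩⟩
        simp [har, Ne.symm hxa]
    refine ⟨f x, f y, ?_, (fF x hx hx1).1, (fF y hy hy1).1, (fF x hx hx1).2, (fF y hy hy1).2, ?_⟩
    · simp only [f]
      have := nbx x hx1
      have := nbx y hy1
      split_ifs with e1 e2 e2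
      · exact absurd (e1.trans e2.symm) hxy
      · exact (this _).symm
      · exact nbx x hx1 _
      · exact hxy
    · intro z hz hzF
      by_cases hzb : ∃ i, z = b i
      · obtain ⟨i, rfl⟩ := hzb
        obtain ⟨_, F, hF, hD, hs⟩ := (h.M1 hb i).1 hzF
        have e := h.tetD hF (by rw [Finset.card_insert_of_notMem har]; omega) hs
        subst e
        have fa : f a = b i := by simp [f, hD]
        rcases hall a har ⟨_, hF, subset_rfl⟩ with e | e
        · left; rw [← e, fa]
        · right; rw [← e, fa]
      · push Not at hzb
        obtain ⟨h1, h2⟩ := (h.M0 (not_b_insert hb hzb)).1 hzF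
        have hza : z ≠ a := fun e => h1 (by simp [e])
        have fz : f z = z := by simp [f, hza]
        rcases hall z hz h2 with e | e
        · left; rw [← e, fz]
        · right; rw [← e, fz]
  · have hb := allb hi1 hi2
    rw [Finset.card_insert_of_notMem hi1] at hr3
    have ht2 : t.card = 2 := by omega
    obtain ⟨hat, F, hF, hDF, hsF⟩ := (h.M1 hb i).1 hr
    obtain ⟨x, y, hxy, hx, hy, hx1, hy1, hall⟩ := h.good.nbrs2 (card3_of_pair ht2 hat) ⟨F, hF, hsF⟩
    have nbx : ∀ x, insert x (insert a t) ∈ T → ∀ i, x ≠ b i := by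
      intro x hx i e
      exact h.fresh i _ hx (by rw [e]; simp)
    have c4 : ∀ x, x ∉ insert a t → (insert x (insert a t)).card = 4 := by
      intro x hx
      rw [Finset.card_insert_of_notMem hx, card3_of_pair ht2 hat]
    -- membership for ordinary vertices
    have ord : ∀ z, z ∉ t → (∀ i, z ≠ b i) → (Fc (expn T a b D Z) (insert z (insert (b i) t)) ↔
        z ≠ a ∧ insert z (insert a t) ∈ T ∧ D (insert z (insert a t)) = i) := by
      intro z hz hzb
      rw [Finset.insert_comm, h.M1 (not_b_insert hb hzb), Finset.insert_comm a z]
      constructor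
      · rintro ⟨h1, G, hG, hD, hs⟩
        have hza : z ≠ a := fun e => h1 (by simp [e])
        have e := h.tetD hG (c4 z (by simp [hza, hz])) hs
        subst e
        exact ⟨hza, hG, hD⟩
      · rintro ⟨hza, h2, h3⟩
        exact ⟨by simp [hat, Ne.symm hza], _, h2, h3, subset_rfl⟩
    have spe : Fc (expn T a b D Z) (insert (b !i) (insert (b i) t)) ↔ t ∈ Z := by
      rw [Finset.insert_comm, h.M2 hb]
      constructor
      · rintro ⟨e, he, hte⟩
        rw [Finset.eq_of_subset_of_card_le hte (by rw [((h.hZ e).1 he).1, ht2])]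
        exact he
      · intro ht; exact ⟨t, ht, subset_rfl⟩
    have nin : ∀ z, z ∉ t → (∀ i, z ≠ b i) → z ∉ insert (b i) t := by
      intro z hz hzb
      simp [hz, hzb i]
    have bnin : b (!i) ∉ insert (b i) t := by
      simp [hi2, h.bne']
    have hxt : x ∉ t := fun h1 => hx (by simp [h1])
    have hyt : y ∉ t := fun h1 => hy (by simp [h1])
    have hxa : x ≠ a := fun h1 => hx (by simp [h1])
    have hya : y ≠ a := fun h1 => hy (by simp [h1])
    -- which colours
    have tz : t ∈ Z ↔ D (insert x (insert a t)) ≠ D (insert y (insert a t)) := by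
      rw [h.hZ]
      constructor
      · rintro ⟨_, _, h3⟩
        obtain ⟨G, hG, hDG, hsG⟩ := h3 true
        obtain ⟨H, hH, hDH, hsH⟩ := h3 false
        obtain ⟨z, hz, rfl⟩ := tet_eq_insert (h.good.card4 _ hG) (card3_of_pair ht2 hat) hsG
        obtain ⟨z', hz', rfl⟩ := tet_eq_insert (h.good.card4 _ hH) (card3_of_pair ht2 hat) hsH
        rcases hall z hz ⟨_, hG, subset_rfl⟩ with e | e <;>
          rcases hall z' hz' ⟨_, hH, subset_rfl⟩ with e' | e' <;> rw [e] at hDG <;>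
          rw [e'] at hDH <;>
          first | (rw [hDG] at hDH; exact absurd hDH (by simp)) | (rw [hDG, hDH]; simp)
      · intro hne
        refine ⟨ht2, hat, fun j => ?_⟩
        by_cases hj : D (insert x (insert a t)) = j
        · exact ⟨_, hx1, hj, Finset.subset_insert _ _⟩
        · refine ⟨_, hy1, ?_, Finset.subset_insert _ _⟩
          cases j <;> simp_all
    have hor : D (insert x (insert a t)) = i ∨ D (insert y (insert a t)) = i := by
      obtain ⟨z, hz, rfl⟩ := tet_eq_insert (h.good.card4 _ hF) (card3_of_pair ht2 hat) hsF
      rcases hall z hz ⟨_, hF, subset_rfl⟩ with rfl | rfl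
      · exact Or.inl hDF
      · exact Or.inr hDF
    have zcase : ∀ z, z ∉ insert (b i) t → z = b (!i) ∨ (z ∉ t ∧ ∀ j, z ≠ b j) := by
      intro z hz
      by_cases e : z = b (!i)
      · exact Or.inl e
      · right
        refine ⟨fun h1 => hz (by simp [h1]), fun j hj => ?_⟩
        have : z ≠ b i := fun e => hz (by simp [e])
        cases i <;> cases j <;> simp_all
    have one : ∀ x y, insert x (insert a t) ∈ T → x ∉ t → x ≠ a →
        (∀ z, z ∉ insert a t → Fc T (insert z (insert a t)) → z = x ∨ z = y) →
        D (insert x (insert a t)) = i → D (insert y (insert a t)) ≠ i → t ∈ Z →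
        ∃ x y, x ≠ y ∧ x ∉ insert (b i) t ∧ y ∉ insert (b i) t ∧
      Fc (expn T a b D Z) (insert x (insert (b i) t)) ∧
      Fc (expn T a b D Z) (insert y (insert (b i) t)) ∧
      ∀ z, z ∉ insert (b i) t → Fc (expn T a b D Z) (insert z (insert (b i) t)) → z = x ∨ z = y := by
      intro x y hx1 hxt hxa hall hDx hDy htZ
      refine ⟨x, b (!i), nbx x hx1 _, nin x hxt (nbx x hx1), bnin,
        (ord x hxt (nbx x hx1)).2 ⟨hxa, hx1, hDx⟩, spe.2 htZ, ?_⟩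
      intro z hz hzF
      rcases zcase z hz with e | ⟨e1, e2⟩
      · exact Or.inr e
      · obtain ⟨hza, h1, h2⟩ := (ord z e1 e2).1 hzF
        rcases hall z (by simp [hza, e1]) ⟨_, h1, subset_rfl⟩ with rfl | rfl
        · exact Or.inl rfl
        · exact absurd h2 hDy
    by_cases hDx : D (insert x (insert a t)) = i
    · by_cases hDy : D (insert y (insert a t)) = i
      · refine ⟨x, y, hxy, nin x hxt (nbx x hx1), nin y hyt (nbx y hy1),
          (ord x hxt (nbx x hx1)).2 ⟨hxa, hx1, hDx⟩, (ord y hyt (nbx y hy1)).2 ⟨hya, hy1, hDy⟩, ?_⟩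
        intro z hz hzF
        rcases zcase z hz with e | ⟨e1, e2⟩
        · subst e
          exact absurd (hDx.trans hDy.symm) (tz.1 (spe.1 hzF))
        · obtain ⟨hza, h1, h2⟩ := (ord z e1 e2).1 hzF
          exact hall z (by simp [hza, e1]) ⟨_, h1, subset_rfl⟩
      · exact one x y hx1 hxt hxa hall hDx hDy (tz.2 (by rw [hDx]; exact Ne.symm hDy))
    · have hDy := hor.resolve_left hDx
      exact one y x hy1 hyt hya (fun z a b => (hall z a b).symm) hDy hDx
        (tz.2 (by rw [hDy]; exact hDx))
  · have hb : ∀ i, b i ∉ t := allb (i := true) ht1 ht2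
    rw [Finset.card_insert_of_notMem (by simp [h.bne, ht1]), Finset.card_insert_of_notMem ht2] at hr3
    obtain ⟨p, rfl⟩ := Finset.card_eq_one.1 (show t.card = 1 by omega)
    obtain ⟨e, he, hpe⟩ := (h.M2 hb true).1 hr
    obtain ⟨x, y, hxy, hx, hy, hall⟩ := h.Z2 p ⟨e, he, by simpa using hpe⟩
    have key : ∀ z, z ≠ p → (∀ i, z ≠ b i) →
        (Fc (expn T a b D Z) (insert z (insert (b true) (insert (b false) {p}))) ↔
        ({p, z} : Finset ℕ) ∈ Z) := by
      intro z hzp hzb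
      rw [Finset.insert_comm z, Finset.insert_comm z]
      have := h.M2 (not_b_insert hb hzb) true
      simp only [Bool.not_true] at this
      rw [this, Finset.pair_comm]
      constructor
      · rintro ⟨e, he, hs⟩
        rw [Finset.eq_of_subset_of_card_le hs (by rw [((h.hZ e).1 he).1, Finset.card_pair hzp.symm])]
        exact he
      · intro h1; exact ⟨_, h1, subset_rfl⟩
    have Zp : ∀ x, ({p, x} : Finset ℕ) ∈ Z → x ≠ p ∧ ∀ i, x ≠ b i := by
      intro x hx
      constructor
      · rintro rfl
        have := ((h.hZ _).1 hx).1
        simp at this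
      · intro i e
        exact h.bZ hx i (by simp [e])
    have nin : ∀ x, x ≠ p → (∀ i, x ≠ b i) → x ∉ insert (b true) (insert (b false) ({p} : Finset ℕ)) := by
      intro x h1 h2
      simp [h1, h2]
    refine ⟨x, y, hxy, nin x (Zp x hx).1 (Zp x hx).2, nin y (Zp y hy).1 (Zp y hy).2,
      (key x (Zp x hx).1 (Zp x hx).2).2 hx, (key y (Zp y hy).1 (Zp y hy).2).2 hy, ?_⟩
    intro z hz hzF
    simp only [Finset.mem_insert, Finset.mem_singleton, not_or] at hz
    refine hall z ((key z hz.2.2 ?_).1 hzF)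
    intro i; cases i
    · exact hz.2.1
    · exact hz.1

theorem EH.conn (h : EH T a b D Z) : ∀ σ : Finset ℕ, σ.card ≤ 2 → ∀ p q, p ∉ σ → q ∉ σ →
    Fc (expn T a b D Z) (insert p σ) →
    Fc (expn T a b D Z) (insert q σ) → Relation.ReflTransGen (LA (expn T a b D Z) σ) p q := by
  intro σ hσ p q hp hq hpF hqF
  rcases h.tri σ with hb | ⟨i, τ, rfl, hi1, hi2⟩ | ⟨t, rfl, ht1, ht2⟩
  · have haσ : a ∉ σ := fun h1 => h.aFc hpF (by simp [h1])
    let π : ℕ → ℕ := fun x => if ∃ i, x = b i then a else x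
    let Rep : ℕ → ℕ → Prop := fun x x' => x = π x' ∧ x' ∉ σ ∧ Fc (expn T a b D Z) (insert x' σ)
    have πb : ∀ i, π (b i) = a := fun i => if_pos ⟨i, rfl⟩
    have πn : ∀ x, (∀ i, x ≠ b i) → π x = x := fun x hx => if_neg (by push Not; exact hx)
    have hsame : ∀ x x' x'', Rep x x' → Rep x x'' →
        Relation.ReflTransGen (LA (expn T a b D Z) σ) x' x'' := by
      rintro x x' x'' ⟨h1, h2, h3⟩ ⟨h4, h5, h6⟩
      by_cases hx' : ∃ i, x' = b i
      · obtain ⟨i, rfl⟩ := hx'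
        by_cases hx'' : ∃ i, x'' = b i
        · obtain ⟨j, rfl⟩ := hx''
          by_cases hij : j = i
          · subst hij; exact Relation.ReflTransGen.refl
          · have : j = !i := by cases i <;> cases j <;> simp_all
            subst this
            exact Relation.ReflTransGen.single ⟨h2, h5, h.lc' hb i h3 h6⟩
        · push Not at hx''
          rw [h1, πb, πn _ hx''] at h4
          exact absurd (h4 ▸ Finset.mem_insert_self _ _) (h.aFc h6)
      · push Not at hx'
        by_cases hx'' : ∃ i, x'' = b i
        · obtain ⟨j, rfl⟩ := hx''
          rw [h4, πb, πn _ hx'] at h1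
          exact absurd (h1 ▸ Finset.mem_insert_self _ _) (h.aFc h3)
        · push Not at hx''
          rw [πn _ hx'] at h1
          rw [πn _ hx''] at h4
          rw [← h1, ← h4]
    -- representatives in the image of a tet
    let ν : Finset ℕ → ℕ → ℕ := fun F x => if x = a then b (D F) else x
    have νπ : ∀ F ∈ T, ∀ x ∈ F, π (ν F x) = x := by
      intro F hF x hx
      by_cases hxa : x = a
      · simp only [ν, hxa, if_true, πb]
      · simp only [ν, hxa, if_false]
        exact πn x (fun i e => h.fresh i F hF (e ▸ hx))
    have νσ : ∀ F ∈ T, ∀ x ∉ σ, ν F x ∉ σ := by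
      intro F hF x hx
      simp only [ν]
      split_ifs
      · exact hb _
      · exact hx
    have νN : ∀ F ∈ T, ∀ x ∈ F, ν F x ∈ exN a b D F := by
      intro F hF x hx
      simp only [ν, exN]
      by_cases h1 : x = a
      · have h2 : a ∈ F := h1 ▸ hx
        simp [h1, h2]
      · rw [if_neg h1]
        split_ifs
        · simp [h1, hx]
        · exact hx
    have σN : ∀ F ∈ T, σ ⊆ F → σ ⊆ exN a b D F := by
      intro F hF hs x hx
      have := νN F hF x (hs hx)
      simpa [ν, show x ≠ a from fun e => haσ (e ▸ hx)] using this
    have NF : ∀ F ∈ T, ∀ s, s ⊆ exN a b D F → Fc (expn T a b D Z) s :=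
      fun F hF s hs => h.Fc_tet.2 (Or.inl ⟨F, hF, hs⟩)
    have hstep0 : ∀ x y, LA T σ x y → ∃ x' y', Rep x x' ∧ Rep y y' ∧ LA (expn T a b D Z) σ x' y' := by
      rintro x y ⟨h1, h2, F, hF, hs⟩
      have hxF : x ∈ F := hs (by simp)
      have hyF : y ∈ F := hs (by simp)
      have hσF : σ ⊆ F := fun z hz => hs (by simp [hz])
      have hL : LA (expn T a b D Z) σ (ν F x) (ν F y) := ⟨νσ F hF x h1, νσ F hF y h2,
        NF F hF _ (Finset.insert_subset (νN F hF x hxF) (Finset.insert_subset (νN F hF y hyF)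
          (σN F hF hσF)))⟩
      exact ⟨_, _, ⟨(νπ F hF x hxF).symm, hL.1, hL.2.2.mono (Finset.insert_subset_insert _
        (Finset.subset_insert _ _))⟩, ⟨(νπ F hF y hyF).symm, hL.2.1, hL.2.2.mono
        (Finset.subset_insert _ _)⟩, hL⟩
    have repT : ∀ x', x' ∉ σ → Fc (expn T a b D Z) (insert x' σ) → π x' ∉ σ ∧ Fc T (insert (π x') σ) := by
      intro x' h1 h2
      by_cases hx' : ∃ i, x' = b i
      · obtain ⟨i, rfl⟩ := hx'
        rw [πb]
        obtain ⟨_, F, hF, _, hs⟩ := (h.M1 hb i).1 h2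
        exact ⟨haσ, F, hF, hs⟩
      · push Not at hx'
        rw [πn _ hx']
        exact ⟨h1, ((h.M0 (not_b_insert hb hx')).1 h2).2⟩
    have path := h.good.conn σ hσ (π p) (π q) (repT p hp hpF).1 (repT q hq hqF).1
      (repT p hp hpF).2 (repT q hq hqF).2
    refine path_transfer (Rep := Rep) ?_ hsame ?_ path ⟨rfl, hp, hpF⟩ ⟨rfl, hq, hqF⟩
    · intro x y hxy
      obtain ⟨_, y', _, h2, _⟩ := hstep0 x y hxy
      exact ⟨y', h2⟩
    · intro x y x' y' hxy hx hy
      obtain ⟨x0, y0, h1, h2, h3⟩ := hstep0 x y hxy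
      exact ((hsame _ _ _ hx h1).tail h3).trans (hsame _ _ _ h2 hy)
  · have hb := allb hi1 hi2
    rw [Finset.card_insert_of_notMem hi1] at hσ
    have haτ : a ∉ τ := fun h1 => h.aFc hpF (by simp [h1])
    let Rep : ℕ → ℕ → Prop := fun x x' => x ∉ insert a τ ∧ (∀ j, x ≠ b j) ∧
      ((x' = x ∧ ∃ F ∈ T, D F = i ∧ insert a (insert x τ) ⊆ F) ∨
       (x' = b (!i) ∧ ∃ F ∈ T, D F = !i ∧ insert a (insert x τ) ⊆ F))
    have bnin : b (!i) ∉ insert (b i) τ := by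
      simp [hi2, h.bne']
    have nin : ∀ x, x ∉ insert a τ → (∀ j, x ≠ b j) → x ∉ insert (b i) τ := by
      intro x h1 h2
      simp only [Finset.mem_insert, not_or] at h1 ⊢
      exact ⟨h2 i, h1.2⟩
    have hsame1 : ∀ x, x ∉ insert a τ → (∀ j, x ≠ b j) →
        (∃ F ∈ T, D F = i ∧ insert a (insert x τ) ⊆ F) →
        (∃ F ∈ T, D F = !i ∧ insert a (insert x τ) ⊆ F) →
        LA (expn T a b D Z) (insert (b i) τ) x (b !i) := by
      intro x h1 h2 h3 h4
      refine ⟨nin x h1 h2, bnin, ?_⟩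
      rw [Finset.insert_comm, Finset.insert_comm x, Finset.insert_comm]
      have ha' : a ∉ insert x τ := by
        simp only [Finset.mem_insert, not_or] at h1 ⊢
        exact ⟨fun e => h1.1 e.symm, haτ⟩
      exact h.lc' (not_b_insert hb h2) i ((h.M1 (not_b_insert hb h2) _).2 ⟨ha', h3⟩)
        ((h.M1 (not_b_insert hb h2) _).2 ⟨ha', h4⟩)
    have hsame : ∀ x x' x'', Rep x x' → Rep x x'' →
        Relation.ReflTransGen (LA (expn T a b D Z) (insert (b i) τ)) x' x'' := by
      rintro x x' x'' ⟨h1, h2, ⟨e, h3⟩ | ⟨e, h3⟩⟩ ⟨_, _, ⟨e', h4⟩ | ⟨e', h4⟩⟩ <;> rw [e, e']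
      · exact Relation.ReflTransGen.single (hsame1 x h1 h2 h3 h4)
      · exact Relation.ReflTransGen.single (hsame1 x h1 h2 h4 h3).symm
    have hstep0 : ∀ x y, LA T (insert a τ) x y → ∃ x' y', Rep x x' ∧ Rep y y' ∧
        Relation.ReflTransGen (LA (expn T a b D Z) (insert (b i) τ)) x' y' := by
      rintro x y ⟨h1, h2, F, hF, hs⟩
      have hxF : x ∈ F := hs (by simp)
      have hyF : y ∈ F := hs (by simp)
      have hxb : ∀ j, x ≠ b j := fun j e => h.fresh j F hF (e ▸ hxF)
      have hyb : ∀ j, y ≠ b j := fun j e => h.fresh j F hF (e ▸ hyF)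
      have sx : insert a (insert x τ) ⊆ F := fun z hz => hs (by
        simp only [Finset.mem_insert] at hz ⊢; tauto)
      have sy : insert a (insert y τ) ⊆ F := fun z hz => hs (by
        simp only [Finset.mem_insert] at hz ⊢; tauto)
      by_cases hD : D F = i
      · refine ⟨x, y, ⟨h1, hxb, Or.inl ⟨rfl, F, hF, hD, sx⟩⟩, ⟨h2, hyb, Or.inl ⟨rfl, F, hF, hD, sy⟩⟩,
          Relation.ReflTransGen.single ⟨nin x h1 hxb, nin y h2 hyb, ?_⟩⟩
        rw [Finset.insert_comm y, Finset.insert_comm x]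
        refine (h.M1 (not_b_insert (not_b_insert hb hyb) hxb) i).2 ⟨?_, F, hF, hD, ?_⟩
        · simp only [Finset.mem_insert, not_or] at h1 h2 ⊢
          exact ⟨fun e => h1.1 e.symm, fun e => h2.1 e.symm, haτ⟩
        · intro z hz
          exact hs (by simp only [Finset.mem_insert] at hz ⊢; tauto)
      · have hD' : D F = !i := by cases i <;> simp_all
        exact ⟨_, _, ⟨h1, hxb, Or.inr ⟨rfl, F, hF, hD', sx⟩⟩, ⟨h2, hyb, Or.inr ⟨rfl, F, hF, hD', sy⟩⟩,
          Relation.ReflTransGen.refl⟩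
    have start : ∀ p, p ∉ insert (b i) τ → Fc (expn T a b D Z) (insert p (insert (b i) τ)) →
        ∃ x, Rep x p ∧ Fc T (insert x (insert a τ)) := by
      intro p hp hpF
      by_cases hpb : p = b (!i)
      · subst hpb
        rw [Finset.insert_comm, h.M2 hb] at hpF
        obtain ⟨e, he, hτe⟩ := hpF
        obtain ⟨he2, hae, heD⟩ := (h.hZ e).1 he
        obtain ⟨x, hxe, hxτ⟩ := Finset.exists_mem_notMem_of_card_lt_card (s := τ) (t := e) (by omega)
        obtain ⟨F, hF, hD, hs⟩ := heD (!i)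
        have sx : insert a (insert x τ) ⊆ F := fun z hz => hs (by
          simp only [Finset.mem_insert] at hz ⊢
          rcases hz with hz | hz | hz
          · exact Or.inl hz
          · exact Or.inr (hz ▸ hxe)
          · exact Or.inr (hτe hz))
        refine ⟨x, ⟨?_, fun j e' => h.bZ he j (e' ▸ hxe), Or.inr ⟨rfl, F, hF, hD, sx⟩⟩, F, hF, ?_⟩
        · simp only [Finset.mem_insert, not_or]
          exact ⟨fun e' => hae (e' ▸ hxe), hxτ⟩
        · rw [Finset.insert_comm]; exact sx
      · simp only [Finset.mem_insert, not_or] at hp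
        have hpb' : ∀ j, p ≠ b j := by
          intro j; cases i <;> cases j <;> simp_all
        have hpF' := hpF
        rw [Finset.insert_comm, h.M1 (not_b_insert hb hpb')] at hpF
        obtain ⟨h1, F, hF, hD, hs⟩ := hpF
        refine ⟨p, ⟨?_, hpb', Or.inl ⟨rfl, F, hF, hD, hs⟩⟩, F, hF, by rw [Finset.insert_comm]; exact hs⟩
        simp only [Finset.mem_insert, not_or] at h1 ⊢
        exact ⟨fun e => h1.1 e.symm, hp.2⟩
    obtain ⟨x, hx1, hx2⟩ := start p hp hpF
    obtain ⟨y, hy1, hy2⟩ := start q hq hqF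
    have path := h.good.conn (insert a τ) (by rw [Finset.card_insert_of_notMem haτ]; exact hσ) x y
      hx1.1 hy1.1 hx2 hy2
    refine path_transfer (Rep := Rep) ?_ hsame ?_ path hx1 hy1
    · intro x y hxy
      obtain ⟨_, y', _, h2, _⟩ := hstep0 x y hxy
      exact ⟨y', h2⟩
    · intro x y x' y' hxy hx hy
      obtain ⟨x0, y0, h1, h2, h3⟩ := hstep0 x y hxy
      exact ((hsame _ _ _ hx h1).trans h3).trans (hsame _ _ _ h2 hy)
  · rw [Finset.card_insert_of_notMem (by simp [h.bne, ht1]), Finset.card_insert_of_notMem ht2] at hσ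
    have ht : t = ∅ := Finset.card_eq_zero.1 (by omega)
    subst ht
    have pz : ∀ p, p ∉ insert (b true) (insert (b false) (∅ : Finset ℕ)) →
        Fc (expn T a b D Z) (insert p (insert (b true) (insert (b false) ∅))) → ∃ e ∈ Z, p ∈ e := by
      intro p hp hF
      simp only [Finset.mem_insert, not_or] at hp
      rw [Finset.insert_comm p, Finset.insert_comm p] at hF
      have := (h.M2 (s := insert p ∅) (not_b_insert (by simp) (by
        intro i; cases i
        · exact hp.2.1
        · exact hp.1)) true).1 hF
      obtain ⟨e, he, hs⟩ := this
      exact ⟨e, he, hs (by simp)⟩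
    refine path_mono ?_ (h.Zc p q (pz p hp hpF) (pz q hq hqF))
    intro x y hxy
    have hx : ∀ i, x ≠ b i := fun i e => h.bZ hxy i (by simp [e])
    have hy : ∀ i, y ≠ b i := fun i e => h.bZ hxy i (by simp [e])
    refine ⟨by simp [hx], by simp [hy], ?_⟩
    rw [Finset.insert_comm y, Finset.insert_comm y, Finset.insert_comm x, Finset.insert_comm x]
    exact (h.M2 (s := insert x (insert y ∅)) (not_b_insert (not_b_insert (by simp) hy) hx) true).2
      ⟨_, hxy, by simp⟩

theorem EH.good_expn (h : EH T a b D Z) : Good (expn T a b D Z) where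
  ne := by
    obtain ⟨F, hF⟩ := h.good.ne
    exact ⟨_, Finset.mem_union_left _ (Finset.mem_image_of_mem _ hF)⟩
  card4 := h.card4
  two := two_of_nbrs h.card4 h.nbrs
  conn := h.conn

theorem EH.ch (h : EH T a b D Z) : CH (expn T a b D Z) (b true) (b false) a where
  good := h.good_expn
  ne := h.bne
  edge := by
    obtain ⟨e, he⟩ := h.Zne
    exact (h.M2 (s := ∅) (by simp) true).2 ⟨e, he, by simp⟩
  fresh := h.a_fresh
  lc := h.lc true

theorem EH.ctr_eq (h : EH T a b D Z) : gen (ctr (expn T a b D Z) (b true) (b false) a) = gen T := by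
  apply sc_ext
  intro s
  rw [mem_gen, mem_gen]
  apply and_congr_left
  intro _
  by_cases ha : a ∈ s
  · obtain ⟨t, hat, rfl⟩ : ∃ t, a ∉ t ∧ s = insert a t :=
      ⟨s.erase a, by simp, (Finset.insert_erase ha).symm⟩
    rw [h.ch.Fc_ctr_w hat]
    constructor
    · rintro ⟨h1, h2, h3⟩
      have hb : ∀ i, b i ∉ t := allb (i := true) h1 h2
      rw [h.M1 hb, h.M1 hb] at h3
      rcases h3 with ⟨_, F, hF, _, hs⟩ | ⟨_, F, hF, _, hs⟩ <;> exact ⟨F, hF, hs⟩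
    · intro h1
      have hb : ∀ i, b i ∉ t := fun i h2 => h.bFc h1 i (by simp [h2])
      refine ⟨hb _, hb _, ?_⟩
      rw [h.M1 hb, h.M1 hb]
      obtain ⟨F, hF, hs⟩ := h1
      cases hD : D F
      · exact Or.inr ⟨hat, F, hF, hD, hs⟩
      · exact Or.inl ⟨hat, F, hF, hD, hs⟩
  · rw [h.ch.Fc_ctr_not ha]
    constructor
    · rintro ⟨h1, h2, h3⟩
      exact ((h.M0 (allb (i := true) h2 h3)).1 h1).2
    · intro h1
      exact ⟨(h.M0 (h.bFc h1)).2 ⟨ha, h1⟩, h.bFc h1 _, h.bFc h1 _⟩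

theorem EH.contraction (h : EH T a b D Z) : EdgeContraction (gen (expn T a b D Z)) (gen T) :=
  ⟨_, _, h.ctr_eq ▸ h.ch.contraction⟩

theorem EH.nb_eq (h : EH T a b D Z) : nb (expn T a b D Z) {b true, b false} = Z.biUnion id := by
  ext p
  rw [mem_nb]
  simp only [Finset.mem_biUnion, id]
  constructor
  · rintro ⟨h1, h2⟩
    simp only [Finset.mem_insert, Finset.mem_singleton, not_or] at h1
    rw [Finset.insert_comm p, Finset.pair_comm p, ← insert_empty_eq p] at h2
    have := (h.M2 (s := insert p ∅) (not_b_insert (by simp) (by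
        intro i; cases i
        · exact h1.2
        · exact h1.1)) true).1 h2
    obtain ⟨e, he, hs⟩ := this
    exact ⟨e, he, hs (by simp)⟩
  · rintro ⟨e, he, hpe⟩
    have hp : ∀ i, p ≠ b i := fun i e' => h.bZ he i (e' ▸ hpe)
    refine ⟨by simp [hp], ?_⟩
    rw [Finset.insert_comm p, Finset.pair_comm p, ← insert_empty_eq p]
    exact (h.M2 (s := insert p ∅) (not_b_insert (by simp) hp) true).2 ⟨e, he, by simpa using hpe⟩

theorem EH.g2 (h : EH T a b D Z) :
    (gen (expn T a b D Z)).g2 = (gen T).g2 - 3 + (Z.biUnion id).card := by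
  have := h.ch.g2
  rw [h.ctr_eq, h.nb_eq] at this
  omega

end

/-- the properties of class `R` in terms of tetrahedra -/
structure RT (T : Finset (Finset ℕ)) : Prop where
  good : Good T
  tet4 : ∀ s : Finset ℕ, s.card = 4 → (∀ y ∈ s, Fc T (s.erase y)) → Fc T s
  red : ∀ K' : SComplex, K'.IsNormalPseudomanifold 3 →
    (BistellarTwoMove (gen T) K' ∨ EdgeContraction (gen T) K' ∨
      (∃ M, EdgeContraction M (gen T) ∧ BistellarTwoMove M K') ∨
      (∃ M, EdgeContraction M (gen T) ∧ EdgeContraction M K')) →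
    (gen T).g2 ≤ K'.g2
  big : ∃ z, 5 ≤ (nb T {z}).card

theorem InClassR.rt {T : Finset (Finset ℕ)} (hT : Good T) (h : InClassR (gen T))
    (hbig : ∃ z, 5 ≤ (nb T {z}).card) : RT T where
  good := hT
  tet4 := by
    intro s hs h1
    refine (mem_gen.1 (h.2.2.2.1 s hs ?_)).1
    intro t ht
    simp only [properFaces, Finset.mem_filter, Finset.mem_powerset] at ht
    obtain ⟨hts, ht0, htne⟩ := ht
    refine mem_gen.2 ⟨?_, ht0⟩
    obtain ⟨y, hy, hyt⟩ : ∃ y ∈ s, y ∉ t := by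
      by_contra hcon
      push Not at hcon
      exact htne (hts.antisymm hcon)
    exact (h1 y hy).mono fun x hx => Finset.mem_erase.2 ⟨fun e => hyt (e ▸ hx), hts hx⟩
  red := h.2.2.2.2
  big := hbig

section
variable {T : Finset (Finset ℕ)}

theorem exists_fresh (T : Finset (Finset ℕ)) (A : Finset ℕ) : ∃ w, w ∉ A ∧ ∀ F ∈ T, w ∉ F := by
  obtain ⟨w, hw⟩ := Infinite.exists_notMem_finset (A ∪ T.biUnion id)
  simp only [Finset.mem_union, Finset.mem_biUnion, id, not_or, not_exists, not_and] at hw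
  exact ⟨w, hw.1, hw.2⟩

theorem RT.no_bs (h : RT T) {u v : ℕ} {A : Finset ℕ} (hb : BH T u v A) : False := by
  have h1 := h.red _ hb.good_bs.npm (Or.inl hb.move)
  have := hb.g2
  omega

theorem RT.no_ctr (h : RT T) {u v w : ℕ} (hb : CH T u v w) : (nb T {u, v}).card ≤ 3 := by
  have h1 := h.red _ hb.good_ctr.npm (Or.inr (Or.inl ⟨u, v, hb.contraction⟩))
  have := hb.g2
  omega

theorem RT.no_exp_bs (h : RT T) {a : ℕ} {b : Bool → ℕ} {D : Finset ℕ → Bool}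
    {Z : Finset (Finset ℕ)} (he : EH T a b D Z) {u v : ℕ} {A : Finset ℕ}
    (hb : BH (expn T a b D Z) u v A) : 4 ≤ (Z.biUnion id).card := by
  have h1 := h.red _ hb.good_bs.npm (Or.inr (Or.inr (Or.inl ⟨_, he.contraction, hb.move⟩)))
  have := hb.g2
  have := he.g2
  omega

theorem RT.no_exp_ctr (h : RT T) {a : ℕ} {b : Bool → ℕ} {D : Finset ℕ → Bool}
    {Z : Finset (Finset ℕ)} (he : EH T a b D Z) {u v w : ℕ}
    (hb : CH (expn T a b D Z) u v w) : (nb (expn T a b D Z) {u, v}).card ≤ (Z.biUnion id).card := by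
  have h1 := h.red _ hb.good_ctr.npm (Or.inr (Or.inr (Or.inr ⟨_, he.contraction, u, v, hb.contraction⟩)))
  have := hb.g2
  have := he.g2
  omega

/-- neighbours in the link of an edge -/
theorem Good.edge_nb (hT : Good T) {x y : ℕ} (hxy : x ≠ y) {p : ℕ} (hp : p ∈ nb T {x, y}) :
    ∃ q r, q ≠ r ∧ q ≠ p ∧ r ≠ p ∧ q ∈ nb T {x, y} ∧ r ∈ nb T {x, y} ∧
      Fc T {x, y, p, q} ∧ Fc T {x, y, p, r} ∧
      ∀ z, z ≠ x → z ≠ y → z ≠ p → Fc T {x, y, p, z} → z = q ∨ z = r := by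
  obtain ⟨hp1, hp2⟩ := mem_nb.1 hp
  simp only [Finset.mem_insert, Finset.mem_singleton, not_or] at hp1
  have c3 : (insert p {x, y} : Finset ℕ).card = 3 := by
    rw [Finset.card_insert_of_notMem (by simp [hp1]), Finset.card_pair hxy]
  obtain ⟨q, r, hqr, hq, hr, hq1, hr1, hall⟩ := hT.nbrs2 c3 hp2
  simp only [Finset.mem_insert, Finset.mem_singleton, not_or] at hq hr
  have per : ∀ z : ℕ, (insert z (insert p {x, y}) : Finset ℕ) = {x, y, p, z} := by
    intro z; ext w; simp only [Finset.mem_insert, Finset.mem_singleton]; tauto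
  refine ⟨q, r, hqr, hq.1, hr.1, mem_nb.2 ⟨by simp [hq], ?_⟩, mem_nb.2 ⟨by simp [hr], ?_⟩,
    per q ▸ ⟨_, hq1, subset_rfl⟩, per r ▸ ⟨_, hr1, subset_rfl⟩, ?_⟩
  · exact ⟨_, hq1, Finset.insert_subset_insert _ (Finset.subset_insert _ _)⟩
  · exact ⟨_, hr1, Finset.insert_subset_insert _ (Finset.subset_insert _ _)⟩
  · intro z h1 h2 h3 h4
    exact hall z (by simp [h1, h2, h3]) (per z ▸ h4)

theorem Good.nb_nonempty (hT : Good T) {x y : ℕ} (h : Fc T {x, y}) : (nb T {x, y}).Nonempty := by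
  obtain ⟨F, hF, hs⟩ := h
  obtain ⟨z, hz, hzn⟩ := Finset.exists_mem_notMem_of_card_lt_card (s := {x, y}) (t := F) (by
    rw [hT.card4 _ hF]; exact lt_of_le_of_lt Finset.card_le_two (by norm_num))
  exact ⟨z, mem_nb.2 ⟨hzn, F, hF, Finset.insert_subset hz hs⟩⟩

theorem Good.small_edge (hT : Good T) {x y : ℕ} (hxy : x ≠ y) (h : Fc T {x, y})
    (h3 : (nb T {x, y}).card ≤ 3) : (nb T {x, y}).card = 3 ∧
      ∀ s : Finset ℕ, x ∉ s → y ∉ s → (Fc T (insert x (insert y s)) ↔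
        s ⊆ nb T {x, y} ∧ s ≠ nb T {x, y}) := by
  set A := nb T {x, y} with hA
  have ge : A.card = 3 := by
    obtain ⟨p, hp⟩ := hT.nb_nonempty h
    obtain ⟨q, r, hqr, hqp, hrp, hq, hr, -⟩ := hT.edge_nb hxy hp
    have : ({p, q, r} : Finset ℕ) ⊆ A := by
      intro z hz
      simp only [Finset.mem_insert, Finset.mem_singleton] at hz
      rcases hz with e | e | e <;> rw [e] <;> assumption
    have c := Finset.card_le_card this
    rw [Finset.card_eq_three.2 ⟨p, q, r, hqp.symm, hrp.symm, hqr, rfl⟩] at c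
    omega
  refine ⟨ge, fun s hx hy => ⟨fun hs => ⟨?_, ?_⟩, ?_⟩⟩
  · intro z hz
    refine mem_nb.2 ⟨?_, hs.mono ?_⟩
    · simp only [Finset.mem_insert, Finset.mem_singleton, not_or]
      exact ⟨fun e => hx (e ▸ hz), fun e => hy (e ▸ hz)⟩
    · intro w hw
      simp only [Finset.mem_insert, Finset.mem_singleton] at hw ⊢
      rcases hw with e | e | e
      · exact Or.inr (Or.inr (e ▸ hz))
      · exact Or.inl e
      · exact Or.inr (Or.inl e)
  · intro e
    have := hs.card_le hT.card4
    rw [Finset.card_insert_of_notMem (by simp [hxy, hx]), Finset.card_insert_of_notMem hy, e] at this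
    omega
  · rintro ⟨hsA, hsne⟩
    obtain ⟨z, hz, hzs⟩ : ∃ z ∈ A, z ∉ s := by
      by_contra hcon
      push Not at hcon
      exact hsne (hsA.antisymm hcon)
    obtain ⟨w, hw, hwz⟩ := Finset.exists_mem_ne (s := A) (by omega) z
    obtain ⟨q, r, hqr, hqp, hrp, hq, hr, hq1, hr1, -⟩ := hT.edge_nb hxy hw
    have e : A = {w, q, r} := by
      symm
      apply Finset.eq_of_subset_of_card_le
      · intro z hz
        simp only [Finset.mem_insert, Finset.mem_singleton] at hz
        rcases hz with e | e | e <;> rw [e] <;> assumption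
      · rw [Finset.card_eq_three.2 ⟨w, q, r, hqp.symm, hrp.symm, hqr, rfl⟩]; omega
    have hsub : ∀ x ∈ s, x = w ∨ x = q ∨ x = r := by
      intro x hx
      have := hsA hx
      rw [e] at this
      simpa using this
    rw [e] at hz
    simp only [Finset.mem_insert, Finset.mem_singleton] at hz
    rcases hz with e' | e' | e'
    · exact absurd e'.symm hwz
    · refine hr1.mono ?_
      intro k hk
      simp only [Finset.mem_insert, Finset.mem_singleton] at hk ⊢
      rcases hk with hk | hk | hk
      · exact Or.inl hk
      · exact Or.inr (Or.inl hk)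
      · rcases hsub k hk with e1 | e1 | e1
        · simp [e1]
        · exact absurd (e' ▸ e1 ▸ hk) hzs
        · simp [e1]
    · refine hq1.mono ?_
      intro k hk
      simp only [Finset.mem_insert, Finset.mem_singleton] at hk ⊢
      rcases hk with hk | hk | hk
      · exact Or.inl hk
      · exact Or.inr (Or.inl hk)
      · rcases hsub k hk with e1 | e1 | e1
        · simp [e1]
        · simp [e1]
        · exact absurd (e' ▸ e1 ▸ hk) hzs

/-- a family containing all five tetrahedra on five vertices is just that -/
theorem Good.five (hT : Good T) {V : Finset ℕ} (hV : V.card = 5) (h : ∀ z ∈ V, Fc T (V.erase z)) :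
    ∀ F ∈ T, F ⊆ V := by
  obtain ⟨z, hz⟩ : V.Nonempty := by rw [← Finset.card_pos]; omega
  have h0 : V.erase z ∈ T := mem_of_card hT.card4 (h z hz) (by rw [Finset.card_erase_of_mem hz]; omega)
  have : ∀ F, SC T ∅ (V.erase z) F → F ⊆ V := by
    intro F hF
    induction hF with
    | refl => exact Finset.erase_subset _ _
    | tail _ hbc ih =>
      obtain ⟨h1, h2, r, hr3, _, hr1, hr2⟩ := hbc
      have hrV := hr1.trans ih
      obtain ⟨a, b, hab, ha, hb, ha1, hb1, hall⟩ := hT.nbrs2 hr3 ⟨_, h1, hr1⟩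
      obtain ⟨c, d, hcd, he⟩ := Finset.card_eq_two.1 (show (V \ r).card = 2 by
        rw [Finset.card_sdiff_of_subset hrV]; omega)
      have hc : c ∈ V ∧ c ∉ r := Finset.mem_sdiff.1 (by rw [he]; simp)
      have hd : d ∈ V ∧ d ∉ r := Finset.mem_sdiff.1 (by rw [he]; simp)
      have key : ∀ c d, c ∈ V → c ∉ r → d ∈ V → d ∉ r → c ≠ d → c = a ∨ c = b := by
        intro c d hc hc' hd hd' hcd
        refine hall c hc' ((h d hd).mono ?_)
        intro k hk
        rcases Finset.mem_insert.1 hk with e | e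
        · rw [e]; exact Finset.mem_erase.2 ⟨hcd, hc⟩
        · exact Finset.mem_erase.2 ⟨fun e' => hd' (e' ▸ e), hrV e⟩
      obtain ⟨g, hg, rfl⟩ := tet_eq_insert (hT.card4 _ h2) hr3 hr2
      have k1 := key c d hc.1 hc.2 hd.1 hd.2 hcd
      have k2 := key d c hd.1 hd.2 hc.1 hc.2 hcd.symm
      have k3 := hall g hg ⟨_, h2, subset_rfl⟩
      have : g = c ∨ g = d := by
        rcases k1 with k1 | k1 <;> rcases k2 with k2 | k2 <;> rcases k3 with k3 | k3 <;> omega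
      apply Finset.insert_subset _ hrV
      rcases this with e | e <;> rw [e]
      · exact hc.1
      · exact hd.1
  intro F hF
  exact this F (hT.sc 3 ∅ (by simp) _ h0 F hF (by simp) (by simp))

/-- all edges have degree at least four -/
theorem RT.deg4 (h : RT T) {x y : ℕ} (hxy : x ≠ y) (he : Fc T {x, y}) : 4 ≤ (nb T {x, y}).card := by
  by_contra hcon
  obtain ⟨h3, hl⟩ := h.good.small_edge hxy he (by omega)
  set A := nb T {x, y} with hA
  have hxA : x ∉ A := fun h1 => (mem_nb.1 h1).1 (by simp)
  have hyA : y ∉ A := fun h1 => (mem_nb.1 h1).1 (by simp)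
  by_cases hFA : Fc T A
  · have hxyA : ∀ z ∈ A, Fc T (insert x (insert y (A.erase z))) := by
      intro z hz
      refine (hl (A.erase z) (by simp [hxA]) (by simp [hyA])).2 ⟨Finset.erase_subset _ _, ?_⟩
      intro e
      have := Finset.card_erase_lt_of_mem hz
      rw [e] at this
      omega
    have side : ∀ w, w ∉ A → (∀ z ∈ A, Fc T (insert w (A.erase z))) → Fc T (insert w A) := by
      intro w hw h1
      refine h.tet4 _ (by rw [Finset.card_insert_of_notMem hw]; omega) ?_
      intro k hk
      rcases Finset.mem_insert.1 hk with e | e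
      · subst e
        rw [Finset.erase_insert hw]; exact hFA
      · rw [Finset.erase_insert_of_ne (ne_of_mem_of_not_mem e hw).symm]
        exact h1 k e
    have hx := side x hxA (fun z hz => (hxyA z hz).mono (Finset.insert_subset_insert _ (Finset.subset_insert _ _)))
    have hy := side y hyA (fun z hz => (hxyA z hz).mono (Finset.subset_insert _ _))
    have hV : (insert x (insert y A)).card = 5 := by
      rw [Finset.card_insert_of_notMem (by simp [hxy, hxA]), Finset.card_insert_of_notMem hyA, h3]
    have all := h.good.five hV (by
      intro z hz
      simp only [Finset.mem_insert] at hz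
      by_cases hzx : z = x
      · subst hzx
        rw [Finset.erase_insert (by simp [hxy, hxA])]; exact hy
      by_cases hzy : z = y
      · subst hzy
        rw [Finset.erase_insert_of_ne hxy, Finset.erase_insert hyA]; exact hx
      · rw [Finset.erase_insert_of_ne (Ne.symm hzx), Finset.erase_insert_of_ne (Ne.symm hzy)]
        exact hxyA z (by tauto))
    obtain ⟨z, hz⟩ := h.big
    have sub : insert z (nb T {z}) ⊆ insert x (insert y A) := by
      intro k hk
      rcases Finset.mem_insert.1 hk with e | e
      · subst e
        obtain ⟨p, hp⟩ : (nb T {k}).Nonempty := by rw [← Finset.card_pos]; omega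
        obtain ⟨_, F, hF, hs⟩ := mem_nb.1 hp
        exact all F hF (hs (by simp))
      · obtain ⟨_, F, hF, hs⟩ := mem_nb.1 e
        exact all F hF (hs (by simp))
    have := Finset.card_le_card sub
    rw [Finset.card_insert_of_notMem (fun h1 => (mem_nb.1 h1).1 (by simp)), hV] at this
    omega
  · exact h.no_bs (u := x) (v := y) (A := A) ⟨h.good, hxy, h3, hxA, hyA, hFA, hl⟩

theorem RT.lcd_s (h : RT T) {x y : ℕ} (hxy : x ≠ y) (he : Fc T {x, y}) {s : Finset ℕ}
    (hall : ∀ w ∈ s, Fc T {x, y, w}) (hs : s ≠ ∅) (hxs : x ∉ s) (hys : y ∉ s)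
    (h1 : Fc T (insert x s)) (h2 : Fc T (insert y s)) : Fc T (insert x (insert y s)) := by
  have two : ∀ p ∈ s, ∀ q ∈ s, p ≠ q → p ≠ x → p ≠ y → q ≠ x → q ≠ y → Fc T {x, p, q} →
      Fc T {y, p, q} → Fc T {x, y, p, q} := by
    intro p hps q hqs hpq hpx hpy hqx hqy h1 h2
    have hp := hall p hps
    have hq := hall q hqs
    refine h.tet4 _ ?_ ?_
    · rw [Finset.card_insert_of_notMem (by simp [hxy, hpx.symm, hqx.symm]),
        Finset.card_insert_of_notMem (by simp [hpy.symm, hqy.symm]), Finset.card_pair hpq]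
    · intro z hz
      simp only [Finset.mem_insert, Finset.mem_singleton] at hz
      rcases hz with e | e | e | e
      · refine h2.mono ?_
        intro k; simp only [Finset.mem_erase, Finset.mem_insert, Finset.mem_singleton]; rw [e]; tauto
      · refine h1.mono ?_
        intro k; simp only [Finset.mem_erase, Finset.mem_insert, Finset.mem_singleton]; rw [e]; tauto
      · refine hq.mono ?_
        intro k; simp only [Finset.mem_erase, Finset.mem_insert, Finset.mem_singleton]; rw [e]; tauto
      · refine hp.mono ?_
        intro k; simp only [Finset.mem_erase, Finset.mem_insert, Finset.mem_singleton]; rw [e]; tauto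
  have hc := h1.card_le h.good.card4
  rw [Finset.card_insert_of_notMem hxs] at hc
  have hne : ∀ z ∈ s, z ≠ x ∧ z ≠ y := fun z hz => ⟨fun e => hxs (e ▸ hz), fun e => hys (e ▸ hz)⟩
  have hpos := Finset.card_pos.2 (Finset.nonempty_iff_ne_empty.2 hs)
  have hcases : s.card = 1 ∨ s.card = 2 ∨ s.card = 3 := by omega
  rcases hcases with hc | hc | hc
  · obtain ⟨p, rfl⟩ := Finset.card_eq_one.1 hc
    exact hall p (by simp)
  · obtain ⟨p, q, hpq, rfl⟩ := Finset.card_eq_two.1 hc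
    exact two p (by simp) q (by simp) hpq (hne p (by simp)).1 (hne p (by simp)).2 (hne q (by simp)).1 (hne q (by simp)).2 h1 h2
  · exfalso
    -- every pair of s gives a tet
    have pr : ∀ p ∈ s, ∀ q ∈ s, p ≠ q → Fc T {x, y, p, q} := by
      intro p hp q hq hpq
      refine two p hp q hq hpq (hne p hp).1 (hne p hp).2 (hne q hq).1 (hne q hq).2 (h1.mono ?_) (h2.mono ?_)
      · intro k; simp only [Finset.mem_insert, Finset.mem_singleton]
        rintro (e | e | e) <;> rw [e] <;> tauto
      · intro k; simp only [Finset.mem_insert, Finset.mem_singleton]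
        rintro (e | e | e) <;> rw [e] <;> tauto
    have hsn : ∀ p ∈ s, p ∈ nb T {x, y} := by
      intro p hp
      obtain ⟨q, hq, hqp⟩ := Finset.exists_mem_ne (s := s) (by omega) p
      refine mem_nb.2 ⟨by simp [hne p hp], (pr p hp q hq hqp.symm).mono ?_⟩
      intro k; simp only [Finset.mem_insert, Finset.mem_singleton]; tauto
    obtain ⟨p0, hp0⟩ := Finset.nonempty_iff_ne_empty.2 hs
    have closed : ∀ z, Relation.ReflTransGen (LA T {x, y}) p0 z → z ∈ s := by
      intro z hz
      induction hz with
      | refl => exact hp0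
      | tail _ hbc ih =>
        rename_i p z _
        obtain ⟨_, h4, h5⟩ := hbc
        simp only [Finset.mem_insert, Finset.mem_singleton, not_or] at h4
        obtain ⟨q, r, hqr, hqp, hrp, -, -, hq1, hr1, hal⟩ := h.good.edge_nb hxy (hsn p ih)
        by_cases hzp : z = p
        · exact hzp ▸ ih
        have k := hal z h4.1 h4.2 hzp (h5.mono (by
          intro k; simp only [Finset.mem_insert, Finset.mem_singleton]; tauto))
        obtain ⟨c, d, hcd, he'⟩ := Finset.card_eq_two.1 (show (s.erase p).card = 2 by
          rw [Finset.card_erase_of_mem ih]; omega)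
        have hc' := Finset.mem_erase.1 (show c ∈ s.erase p by rw [he']; simp)
        have hd' := Finset.mem_erase.1 (show d ∈ s.erase p by rw [he']; simp)
        have k1 := hal c (hne c hc'.2).1 (hne c hc'.2).2 hc'.1 (pr p ih c hc'.2 hc'.1.symm)
        have k2 := hal d (hne d hd'.2).1 (hne d hd'.2).2 hd'.1 (pr p ih d hd'.2 hd'.1.symm)
        have : z = c ∨ z = d := by
          rcases k1 with k1 | k1 <;> rcases k2 with k2 | k2 <;> rcases k with k3 | k3 <;> omega
        rcases this with e | e <;> rw [e]
        · exact hc'.2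
        · exact hd'.2
    have sub : nb T {x, y} ⊆ s := by
      intro z hz
      have k0 := mem_nb.1 (hsn p0 hp0)
      have k1 := mem_nb.1 hz
      exact closed z (h.good.conn {x, y} (Finset.card_le_two) p0 z k0.1 k1.1 k0.2 k1.2)
    have := Finset.card_le_card sub
    have := h.deg4 hxy he
    omega

theorem RT.lcd_of (h : RT T) {x y : ℕ} (hxy : x ≠ y) (he : Fc T {x, y})
    (hall : ∀ w, w ≠ x → w ≠ y → Fc T {x, w} → Fc T {y, w} → Fc T {x, y, w}) : LCd T x y := by
  intro s hs hxs hys h1 h2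
  refine h.lcd_s hxy he (fun w hw => hall w ?_ ?_ (h1.mono ?_) (h2.mono ?_)) hs hxs hys h1 h2
  · exact ne_of_mem_of_not_mem hw hxs
  · exact ne_of_mem_of_not_mem hw hys
  · exact Finset.insert_subset_insert _ (by simpa using hw)
  · exact Finset.insert_subset_insert _ (by simpa using hw)

/-- every edge has a common neighbour off its link -/
theorem RT.off (h : RT T) {x y : ℕ} (hxy : x ≠ y) (he : Fc T {x, y}) :
    ∃ w, w ≠ x ∧ w ≠ y ∧ Fc T {x, w} ∧ Fc T {y, w} ∧ ¬ Fc T {x, y, w} := by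
  by_contra hcon
  push Not at hcon
  have lc := h.lcd_of hxy he hcon
  obtain ⟨w, _, hw⟩ := exists_fresh T ∅
  have := h.no_ctr (w := w) ⟨h.good, hxy, he, hw, lc⟩
  have := h.deg4 hxy he
  omega

end

section
variable {T : Finset (Finset ℕ)}

theorem exists_bb (T : Finset (Finset ℕ)) (a : ℕ) : ∃ b : Bool → ℕ, b true ≠ b false ∧
    (∀ i, b i ≠ a) ∧ ∀ i, ∀ F ∈ T, b i ∉ F := by
  obtain ⟨x, hx, hx'⟩ := exists_fresh T {a}
  obtain ⟨y, hy, hy'⟩ := exists_fresh T {a, x}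
  simp only [Finset.mem_insert, Finset.mem_singleton, not_or] at hx hy
  refine ⟨fun i => if i then x else y, ?_, ?_, ?_⟩
  · simpa using Ne.symm hy.2
  · intro i; cases i
    · simpa using hy.1
    · simpa using hx
  · intro i; cases i
    · simpa using hy'
    · simpa using hx'

open Classical in
/-- edges of the link of `a` with a colour change -/
noncomputable def Zof (T : Finset (Finset ℕ)) (a : ℕ) (D : Finset ℕ → Bool) : Finset (Finset ℕ) :=
  (T.biUnion Finset.powerset).filter fun e =>
    e.card = 2 ∧ a ∉ e ∧ ∀ i, ∃ F ∈ T, D F = i ∧ insert a e ⊆ F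

theorem mem_Zof {a : ℕ} {D : Finset ℕ → Bool} {e : Finset ℕ} : e ∈ Zof T a D ↔
    e.card = 2 ∧ a ∉ e ∧ ∀ i, ∃ F ∈ T, D F = i ∧ insert a e ⊆ F := by
  unfold Zof
  rw [Finset.mem_filter, and_iff_right_iff_imp]
  rintro ⟨_, _, h⟩
  obtain ⟨F, hF, _, hs⟩ := h true
  exact Finset.mem_biUnion.2 ⟨F, hF, Finset.mem_powerset.2 ((Finset.subset_insert _ _).trans hs)⟩

theorem RT.L3 (h : RT T) {u v w : ℕ} (huv : u ≠ v) (he : Fc T {u, v}) (hvw : v ≠ w)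
    (hvwF : Fc T {v, w}) (huw : u ≠ w) (hn : ¬ Fc T {u, v, w})
    (honly : ∀ z, z ≠ u → z ≠ v → z ≠ w → Fc T {u, z} → Fc T {v, z} → Fc T {u, v, z}) :
    (nb T {u, v}).card ≤ (nb T {v, w}).card := by
  obtain ⟨b, hb1, hb2, hb3⟩ := exists_bb T v
  let D : Finset ℕ → Bool := fun F => decide (w ∈ F)
  have hZ : ∀ e, e ∈ Zof T v D ↔ e.card = 2 ∧ v ∉ e ∧ w ∉ e ∧ Fc T (insert v (insert w e)) := by
    intro e
    rw [mem_Zof]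
    constructor
    · rintro ⟨h1, h2, h3⟩
      obtain ⟨F, hF, hD, hs⟩ := h3 true
      obtain ⟨G, hG, hD', hs'⟩ := h3 false
      simp only [D, decide_eq_true_eq, decide_eq_false_iff_not] at hD hD'
      refine ⟨h1, h2, fun h4 => hD' (hs' (Finset.mem_insert_of_mem h4)), F, hF, ?_⟩
      rw [Finset.insert_comm]
      exact Finset.insert_subset hD hs
    · rintro ⟨h1, h2, h3, h4⟩
      refine ⟨h1, h2, ?_⟩
      have c3 := card3_of_pair h1 h2
      obtain ⟨x, y, hxy, hx, hy, hx1, hy1, hall⟩ := h.good.nbrs2 c3 (h4.mono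
        (Finset.insert_subset_insert _ (Finset.subset_insert _ _)))
      have hw : w ∉ insert v e := by simp [hvw.symm, h3]
      have hw1 := hall w hw (by rw [Finset.insert_comm]; exact h4)
      intro i
      cases i
      · rcases hw1 with e1 | e1
        · refine ⟨_, hy1, ?_, Finset.subset_insert _ _⟩
          simp only [D, decide_eq_false_iff_not]
          intro h5
          rcases Finset.mem_insert.1 h5 with e2 | e2
          · exact hxy (e1.symm.trans e2)
          · exact hw e2
        · refine ⟨_, hx1, ?_, Finset.subset_insert _ _⟩
          simp only [D, decide_eq_false_iff_not]
          intro h5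
          rcases Finset.mem_insert.1 h5 with e2 | e2
          · exact hxy (e2.symm.trans e1)
          · exact hw e2
      · rcases hw1 with e1 | e1
        · exact ⟨_, hx1, by simp [D, e1], Finset.subset_insert _ _⟩
        · exact ⟨_, hy1, by simp [D, e1], Finset.subset_insert _ _⟩
  have hpair : ∀ p q, p ≠ q → p ∉ ({v, w} : Finset ℕ) → q ∉ ({v, w} : Finset ℕ) →
      Fc T {v, w, p, q} → ({p, q} : Finset ℕ) ∈ Zof T v D := by
    intro p q hpq hp hq hF
    simp only [Finset.mem_insert, Finset.mem_singleton, not_or] at hp hq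
    exact (hZ _).2 ⟨Finset.card_pair hpq, by simp [Ne.symm hp.1, Ne.symm hq.1],
      by simp [Ne.symm hp.2, Ne.symm hq.2], hF⟩
  have hver : ∀ p, (∃ e ∈ Zof T v D, p ∈ e) ↔ p ∈ nb T {v, w} := by
    intro p
    constructor
    · rintro ⟨e, he, hp⟩
      obtain ⟨h1, h2, h3, h4⟩ := (hZ e).1 he
      refine mem_nb.2 ⟨?_, h4.mono ?_⟩
      · simp only [Finset.mem_insert, Finset.mem_singleton, not_or]
        exact ⟨ne_of_mem_of_not_mem hp h2, ne_of_mem_of_not_mem hp h3⟩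
      · intro k hk
        simp only [Finset.mem_insert, Finset.mem_singleton] at hk ⊢
        rcases hk with e | e | e
        · exact Or.inr (Or.inr (e ▸ hp))
        · exact Or.inl e
        · exact Or.inr (Or.inl e)
    · intro hp
      obtain ⟨q, r, hqr, hqp, hrp, hq, hr, hq1, hr1, -⟩ := h.good.edge_nb hvw hp
      exact ⟨_, hpair p q hqp.symm (mem_nb.1 hp).1 (mem_nb.1 hq).1 hq1, by simp⟩
  have E : EH T v b D (Zof T v D) :=
    { good := h.good
      bne := hb1
      ba := hb2
      fresh := hb3
      hZ := fun e => mem_Zof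
      Zne := by
        obtain ⟨p, hp⟩ := h.good.nb_nonempty hvwF
        obtain ⟨e, he, _⟩ := (hver p).2 hp
        exact ⟨e, he⟩
      Z2 := by
        intro p hp
        have hp := (hver p).1 hp
        obtain ⟨q, r, hqr, hqp, hrp, hq, hr, hq1, hr1, hall⟩ := h.good.edge_nb hvw hp
        refine ⟨q, r, hqr, hpair p q hqp.symm (mem_nb.1 hp).1 (mem_nb.1 hq).1 hq1,
          hpair p r hrp.symm (mem_nb.1 hp).1 (mem_nb.1 hr).1 hr1, ?_⟩
        intro z hz
        obtain ⟨h1, h2, h3, h4⟩ := (hZ _).1 hz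
        simp only [Finset.mem_insert, Finset.mem_singleton, not_or] at h2 h3
        refine hall z (Ne.symm h2.2) (Ne.symm h3.2) ?_ h4
        rintro rfl
        simp at h1
      Zc := by
        intro p q hp0 hq0
        have hp := mem_nb.1 ((hver p).1 hp0)
        have hq := mem_nb.1 ((hver q).1 hq0)
        have path := h.good.conn {v, w} Finset.card_le_two p q hp.1 hq.1 hp.2 hq.2
        clear hq hq0
        induction path with
        | refl => exact Relation.ReflTransGen.refl
        | tail _ hbc ih =>
          rename_i x y _
          by_cases hxy : x = y
          · exact hxy ▸ ih
          · refine ih.tail (hpair x y hxy hbc.1 hbc.2.1 (hbc.2.2.mono ?_))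
            intro k; simp only [Finset.mem_insert, Finset.mem_singleton]; tauto }
  have hub : ∀ i, u ≠ b i := fun i e => E.bFc he i (by simp [e])
  obtain ⟨w', hw'⟩ := exists_fresh (expn T v b D (Zof T v D)) ∅
  have noDw : ∀ F ∈ T, u ∈ F → v ∈ F → D F = false := by
    intro F hF h1 h2
    simp only [D, decide_eq_false_iff_not]
    intro h3
    refine hn ⟨F, hF, ?_⟩
    intro k; simp only [Finset.mem_insert, Finset.mem_singleton]
    rintro (e | e | e) <;> rw [e] <;> assumption
  have lift : ∀ s : Finset ℕ, (∀ i, b i ∉ s) → v ∉ s → Fc T (insert u (insert v s)) →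
      Fc (expn T v b D (Zof T v D)) (insert u (insert (b false) s)) := by
    rintro s hbs hvs ⟨F, hF, hs⟩
    rw [Finset.insert_comm]
    refine (E.M1 (not_b_insert hbs hub) false).2 ⟨by simp [huv.symm, hvs], F, hF,
      noDw F hF (hs (by simp)) (hs (by simp)), ?_⟩
    rw [Finset.insert_comm]; exact hs
  have C : CH (expn T v b D (Zof T v D)) u (b false) w' :=
    { good := E.good_expn
      ne := hub _
      edge := lift ∅ (by simp) (by simp) he
      fresh := hw'.2
      lc := by
        intro s hs hus hbs h1 h2
        have hbt : b true ∉ s := by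
          intro hbt
          have : Fc (expn T v b D (Zof T v D)) (insert (b true) {u}) := by
            refine h1.mono ?_
            intro k; simp only [Finset.mem_insert, Finset.mem_singleton]
            rintro (e | e)
            · exact Or.inr (e ▸ hbt)
            · exact Or.inl e
          obtain ⟨_, F, hF, hD, hs⟩ := (E.M1 (s := {u}) (by
            intro i; simpa using (hub i).symm) true).1 this
          have := noDw F hF (hs (by simp)) (hs (by simp))
          rw [hD] at this
          exact absurd this (by simp)
        have hbs' : ∀ i, b i ∉ s := allb (i := false) hbs hbt
        obtain ⟨h3, h4⟩ := (E.M0 (not_b_insert hbs' hub)).1 h1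
        obtain ⟨h5, F, hF, hD, hsF⟩ := (E.M1 hbs' false).1 h2
        refine lift s hbs' h5 (h.lcd_s huv he ?_ hs hus h5 h4 ⟨F, hF, hsF⟩)
        intro z hz
        refine honly z (ne_of_mem_of_not_mem hz hus) (ne_of_mem_of_not_mem hz h5) ?_
          (h4.mono (Finset.insert_subset_insert _ (by simpa using hz)))
          ⟨F, hF, (Finset.insert_subset_insert _ (by simpa using hz)).trans hsF⟩
        rintro rfl
        simp only [D, decide_eq_false_iff_not] at hD
        exact hD (hsF (by simp [hz])) }
  have key := h.no_exp_ctr E C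
  have e1 : (Zof T v D).biUnion id = nb T {v, w} := by
    ext p
    rw [← hver]
    simp
  rw [e1] at key
  refine le_trans (Finset.card_le_card ?_) key
  intro z hz
  obtain ⟨h1, h2⟩ := mem_nb.1 hz
  simp only [Finset.mem_insert, Finset.mem_singleton, not_or] at h1
  have hzb : ∀ i, z ≠ b i := fun i e => E.bFc h2 i (by simp [e])
  refine mem_nb.2 ⟨by simp [h1.1, hzb], ?_⟩
  have := lift {z} (by intro i; simpa using (hzb i).symm) (by simpa using Ne.symm h1.2) (h2.mono (by
    intro k; simp only [Finset.mem_insert, Finset.mem_singleton]; tauto))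
  exact this.mono (by intro k; simp only [Finset.mem_insert, Finset.mem_singleton]; tauto)

end

section
variable {T : Finset (Finset ℕ)}

theorem Good.label (hT : Good T) {z p q r : ℕ} (hzp : z ≠ p) (hq : q ∉ ({z, p} : Finset ℕ))
    (hr : r ∉ ({z, p} : Finset ℕ)) (hqF : Fc T (insert q {z, p})) (hrF : Fc T (insert r {z, p})) :
    ∃ ℓ : Finset ℕ → ZMod 2, ∀ x, x ≠ z → x ≠ p → ∀ F ∈ T, ∀ G ∈ T, F ≠ G →
      ({z, p, x} : Finset ℕ) ⊆ F → ({z, p, x} : Finset ℕ) ⊆ G →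
      ℓ F + ℓ G = (if x = q then 1 else 0) + (if x = r then 1 else 0) := by
  have path := hT.conn {z, p} Finset.card_le_two q r hq hr hqF hrF
  clear hr hrF
  induction path with
  | refl =>
    refine ⟨fun _ => 0, ?_⟩
    intro x _ _ F _ G _ _ _ _
    by_cases h : x = q
    · simp only [h, if_true]; decide
    · simp [h]
  | tail _ hbc ih =>
    rename_i s r _
    obtain ⟨ℓ, hℓ⟩ := ih
    by_cases hsr : s = r
    · subst hsr; exact ⟨ℓ, hℓ⟩
    obtain ⟨h1, h2, h3⟩ := hbc
    have h1' := h1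
    have h2' := h2
    simp only [Finset.mem_insert, Finset.mem_singleton, not_or] at h1' h2'
    have c4 : (insert s (insert r ({z, p} : Finset ℕ))).card = 4 := by
      rw [Finset.card_insert_of_notMem (by simp [hsr, h1']), Finset.card_insert_of_notMem h2,
        Finset.card_pair hzp]
    have hH := mem_of_card hT.card4 h3 c4.ge
    set H := insert s (insert r ({z, p} : Finset ℕ)) with hHd
    refine ⟨fun F => ℓ F + if F = H then 1 else 0, ?_⟩
    intro x hxz hxp F hF G hG hFG hxF hxG
    have e1 := hℓ x hxz hxp F hF G hG hFG hxF hxG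
    have key : ((if F = H then 1 else 0) + (if G = H then 1 else 0) : ZMod 2) =
        (if x = s then 1 else 0) + (if x = r then 1 else 0) := by
      by_cases hx : x = s ∨ x = r
      · have hsub : ({z, p, x} : Finset ℕ) ⊆ H := by
          intro k
          simp only [hHd, Finset.mem_insert, Finset.mem_singleton]
          rcases hx with e | e <;> subst e <;> tauto
        have c3 : ({z, p, x} : Finset ℕ).card = 3 := by
          rw [Finset.card_eq_three]; exact ⟨z, p, x, hzp, hxz.symm, hxp.symm, rfl⟩
        obtain ⟨A, hA, B, hB, hAB, _, _, hall⟩ := hT.two' c3 ⟨F, hF, hxF⟩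
        have a1 := hall F hF hxF
        have a2 := hall G hG hxG
        have a3 := hall H hH hsub
        have l : ((if F = H then 1 else 0) + (if G = H then 1 else 0) : ZMod 2) = 1 := by
          have : (F = H ∧ G ≠ H) ∨ (F ≠ H ∧ G = H) := by
            clear_value H
            clear * - a1 a2 a3 hFG hAB
            grind
          rcases this with ⟨e, e'⟩ | ⟨e, e'⟩ <;> simp [e, e']
        rw [l]
        rcases hx with e | e
        · simp [e, hsr]
        · simp [e, Ne.symm hsr]
      · have hxH : x ∉ H := by
          simp only [hHd, Finset.mem_insert, Finset.mem_singleton]; tauto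
        have f1 : F ≠ H := by rintro rfl; exact hxH (hxF (by simp))
        have f2 : G ≠ H := by rintro rfl; exact hxH (hxG (by simp))
        rw [not_or] at hx
        simp [f1, f2, hx.1, hx.2]
    have h2 : ∀ t : ZMod 2, t + t = 0 := by decide
    calc ℓ F + (if F = H then 1 else 0) + (ℓ G + if G = H then 1 else 0)
        = (ℓ F + ℓ G) + ((if F = H then 1 else 0) + (if G = H then 1 else 0)) := by ring
      _ = (if x = q then 1 else 0) + ((if x = s then 1 else 0) + (if x = s then 1 else 0))
          + (if x = r then 1 else 0) := by rw [e1, key]; ring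
      _ = _ := by rw [h2]; ring

theorem Good.colour (hT : Good T) {z : ℕ} (hz : (gen T).HasSphereLink 3 z) {X : Finset ℕ}
    (hX : X.card = 3) (hzX : z ∉ X) (hF : ∀ x ∈ X, Fc T (insert z (X.erase x))) :
    ∃ h : Finset ℕ → ZMod 2, ∀ p x, p ≠ z → x ≠ z → x ≠ p → ∀ F ∈ T, ∀ G ∈ T, F ≠ G →
      ({z, p, x} : Finset ℕ) ⊆ F → ({z, p, x} : Finset ℕ) ⊆ G →
      h F + h G = if p ∈ X ∧ x ∈ X then 1 else 0 := by
  classical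
  have h2 : ∀ t : ZMod 2, t + t = 0 := by decide
  have step : ∀ p, ∃ ℓ : Finset ℕ → ZMod 2, p ≠ z → ∀ x, x ≠ z → x ≠ p → ∀ F ∈ T, ∀ G ∈ T, F ≠ G →
      ({z, p, x} : Finset ℕ) ⊆ F → ({z, p, x} : Finset ℕ) ⊆ G →
      ℓ F + ℓ G = if p ∈ X ∧ x ∈ X then 1 else 0 := by
    intro p
    by_cases hp : p ∈ X
    · have hpz : p ≠ z := ne_of_mem_of_not_mem hp hzX
      have c2 : (X.erase p).card = 2 := by rw [Finset.card_erase_of_mem hp, hX]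
      obtain ⟨q, r, hqr, he⟩ := Finset.card_eq_two.1 c2
      have hXe : ∀ x, x ∈ X ↔ x = p ∨ x = q ∨ x = r := by
        intro x
        rw [← Finset.insert_erase hp, he]; simp
      have hq : q ∈ X.erase p := by simp [he]
      have hr : r ∈ X.erase p := by simp [he]
      have hqz : q ≠ z := ne_of_mem_of_not_mem (Finset.mem_of_mem_erase hq) hzX
      have hrz : r ≠ z := ne_of_mem_of_not_mem (Finset.mem_of_mem_erase hr) hzX
      have hqp := Finset.ne_of_mem_erase hq
      have hrp := Finset.ne_of_mem_erase hr
      obtain ⟨ℓ, hℓ⟩ := hT.label (z := z) (p := p) (q := q) (r := r) hpz.symm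
        (by simp [hqz, hqp]) (by simp [hrz, hrp])
        ((hF r (Finset.mem_of_mem_erase hr)).mono (by
          intro k; simp only [Finset.mem_insert, Finset.mem_singleton, Finset.mem_erase, hXe]
          rintro (e | e | e) <;> subst e <;> simp_all [Ne.symm hrp]))
        ((hF q (Finset.mem_of_mem_erase hq)).mono (by
          intro k; simp only [Finset.mem_insert, Finset.mem_singleton, Finset.mem_erase, hXe]
          rintro (e | e | e) <;> subst e <;> simp_all [Ne.symm hqr, Ne.symm hqp]))
      refine ⟨ℓ, fun _ x hx1 hx2 F hF G hG hFG h1 h2 => ?_⟩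
      rw [hℓ x hx1 hx2 F hF G hG hFG h1 h2]
      simp only [hp, true_and, hXe, hx2, false_or]
      by_cases e1 : x = q
      · subst e1; simp [hqr]
      · simp [e1]
    · exact ⟨fun _ => 0, fun _ x _ _ F _ G _ _ _ _ => by simp [hp]⟩
  choose ℓ hℓ using step
  let c : ℕ → ℕ → ZMod 2 := fun p q =>
    if h : ∃ F ∈ T, ({z, p, q} : Finset ℕ) ⊆ F then ℓ p h.choose + ℓ q h.choose else 0
  have hc : ∀ p q, p ≠ z → q ≠ z → ∀ F ∈ T, ({z, p, q} : Finset ℕ) ⊆ F →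
      c p q = ℓ p F + ℓ q F := by
    intro p q hp hq F hF hs
    have h : ∃ F ∈ T, ({z, p, q} : Finset ℕ) ⊆ F := ⟨F, hF, hs⟩
    have hcc : c p q = ℓ p h.choose + ℓ q h.choose := dif_pos h
    rw [hcc]
    obtain ⟨hG, hGs⟩ := h.choose_spec
    set G := h.choose
    by_cases hpq : p = q
    · subst hpq; rw [h2, h2]
    by_cases hGF : G = F
    · rw [hGF]
    have e1 := hℓ p hp q hq (Ne.symm hpq) G hG F hF hGF hGs hs
    have hcm : ({z, q, p} : Finset ℕ) = {z, p, q} := by rw [Finset.pair_comm]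
    have e2 := hℓ q hq p hp hpq G hG F hF hGF (hcm ▸ hGs) (hcm ▸ hs)
    simp only [and_comm (a := q ∈ X)] at e2
    have e3 := e1.trans e2.symm
    generalize ℓ p G = t1 at *
    generalize ℓ p F = t2 at *
    generalize ℓ q G = t3 at *
    generalize ℓ q F = t4 at *
    clear * - e3
    revert t1 t2 t3 t4
    decide
  obtain ⟨f⟩ := hz
  have hsub : ∀ s ∈ ((gen T).lk {z}).faces, ∃ F ∈ T, z ∈ F ∧ s ⊆ F ∧ z ∉ s := by
    intro s hs
    obtain ⟨_, h1, F, hF, h3⟩ := mem_lk_gen.1 hs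
    refine ⟨F, hF, h3 (by simp), Finset.subset_union_left.trans h3, fun hzs => ?_⟩
    have : z ∈ s ∩ {z} := by simp [hzs]
    rw [h1] at this; simp at this
  have tri : ∀ {F : Finset ℕ} {p q : ℕ}, z ∈ F → p ∈ F → q ∈ F → ({z, p, q} : Finset ℕ) ⊆ F := by
    intro F p q h1 h2 h3 k
    simp only [Finset.mem_insert, Finset.mem_singleton]
    rintro (e | e | e) <;> subst e <;> assumption
  obtain ⟨g, hg⟩ := sphere_cocycle ((gen T).lk {z}) c (by
    intro s hs p hp q hq r hr
    obtain ⟨F, hF, hzF, hsF, hzs⟩ := hsub s hs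
    have np := ne_of_mem_of_not_mem hp hzs
    have nq := ne_of_mem_of_not_mem hq hzs
    have nr := ne_of_mem_of_not_mem hr hzs
    rw [hc p q np nq F hF (tri hzF (hsF hp) (hsF hq)), hc q r nq nr F hF (tri hzF (hsF hq) (hsF hr)),
      hc p r np nr F hF (tri hzF (hsF hp) (hsF hr))]
    calc _ = ℓ p F + (ℓ q F + ℓ q F) + ℓ r F := by ring
      _ = _ := by rw [h2]; ring) f
  have hind : ∀ F ∈ T, z ∈ F → ∀ p ∈ F, ∀ q ∈ F, p ≠ z → q ≠ z → ℓ p F + g p = ℓ q F + g q := by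
    intro F hF hzF p hp q hq np nq
    have e1 := hg {p, q} (mem_lk_gen.2 ⟨by simp, by
        ext k; simp only [Finset.mem_inter, Finset.mem_insert, Finset.mem_singleton,
          Finset.notMem_empty, iff_false]
        rintro ⟨h1, rfl⟩
        rcases h1 with e | e
        · exact np e.symm
        · exact nq e.symm, F, hF, by
        intro k; simp only [Finset.mem_union, Finset.mem_insert, Finset.mem_singleton]
        rintro ((e | e) | e) <;> subst e <;> assumption⟩) p (by simp) q (by simp)
    rw [hc p q np nq F hF (tri hzF hp hq)] at e1
    generalize ℓ p F = t1 at *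
    generalize ℓ q F = t2 at *
    generalize g p = t3 at *
    generalize g q = t4 at *
    clear * - e1
    revert t1 t2 t3 t4
    decide
  let col : Finset ℕ → ZMod 2 := fun F =>
    if h : ∃ p ∈ F, p ≠ z then ℓ h.choose F + g h.choose else 0
  have hcol : ∀ F ∈ T, z ∈ F → ∀ p ∈ F, p ≠ z → col F = ℓ p F + g p := by
    intro F hF hzF p hp np
    have h : ∃ p ∈ F, p ≠ z := ⟨p, hp, np⟩
    have e : col F = ℓ h.choose F + g h.choose := dif_pos h
    rw [e]
    exact hind F hF hzF _ h.choose_spec.1 p hp h.choose_spec.2 np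
  refine ⟨col, fun p x np nx hxp F hF G hG hFG h1 h3 => ?_⟩
  rw [hcol F hF (h1 (by simp)) p (h1 (by simp)) np, hcol G hG (h3 (by simp)) p (h3 (by simp)) np,
    ← hℓ p np x nx hxp F hF G hG hFG h1 h3]
  calc _ = ℓ p F + ℓ p G + (g p + g p) := by ring
    _ = _ := by rw [h2]; ring

theorem RT.L2 (h : RT T) {z : ℕ} (hz : (gen T).HasSphereLink 3 z) {X : Finset ℕ}
    (hX : X.card = 3) (hzX : z ∉ X) (hF : ∀ x ∈ X, Fc T (insert z (X.erase x))) : Fc T X := by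
  by_contra hn
  obtain ⟨col, hcol⟩ := h.good.colour hz hX hzX hF
  obtain ⟨b, hb1, hb2, hb3⟩ := exists_bb T z
  have hbX : ∀ i, b i ∉ X := by
    intro i hi
    obtain ⟨y, hy, hyb⟩ : ∃ y ∈ X, y ≠ b i := by
      by_contra hcon
      push Not at hcon
      have : X ⊆ {b i} := fun y hy => by simp [hcon y hy]
      have := Finset.card_le_card this
      rw [hX] at this; simp at this
    obtain ⟨F, hFT, hs⟩ := hF y hy
    exact hb3 i F hFT (hs (Finset.mem_insert_of_mem (Finset.mem_erase.2 ⟨hyb.symm, hi⟩)))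
  let D : Finset ℕ → Bool := fun F => decide (col F = 1)
  have hsubs : ∀ s : Finset ℕ, (∃ e ∈ X.powersetCard 2, s ⊆ e) ↔ s ⊆ X ∧ s ≠ X := by
    intro s
    constructor
    · rintro ⟨e, he, hse⟩
      rw [Finset.mem_powersetCard] at he
      refine ⟨hse.trans he.1, ?_⟩
      rintro rfl
      have := Finset.card_le_card hse
      omega
    · rintro ⟨h1, h2⟩
      obtain ⟨y, hy, hys⟩ := Finset.exists_of_ssubset (Finset.ssubset_iff_subset_ne.2 ⟨h1, h2⟩)
      refine ⟨X.erase y, Finset.mem_powersetCard.2 ⟨Finset.erase_subset _ _, by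
        rw [Finset.card_erase_of_mem hy, hX]⟩, fun k hk => Finset.mem_erase.2 ⟨?_, h1 hk⟩⟩
      rintro rfl
      exact hys hk
  have hpair : ∀ p q, ({p, q} : Finset ℕ) ∈ X.powersetCard 2 ↔ p ≠ q ∧ p ∈ X ∧ q ∈ X := by
    intro p q
    rw [Finset.mem_powersetCard, Finset.insert_subset_iff, Finset.singleton_subset_iff]
    constructor
    · rintro ⟨h1, h2⟩
      refine ⟨?_, h1⟩
      rintro rfl
      simp at h2
    · rintro ⟨h1, h2⟩
      exact ⟨h2, Finset.card_pair h1⟩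
  have hver : ∀ p, (∃ e ∈ X.powersetCard 2, p ∈ e) → p ∈ X := by
    rintro p ⟨e, he, hp⟩
    exact (Finset.mem_powersetCard.1 he).1 hp
  have E : EH T z b D (X.powersetCard 2) :=
    { good := h.good
      bne := hb1
      ba := hb2
      fresh := hb3
      hZ := by
        intro e
        constructor
        · intro he
          have hz' : z ∉ e := fun h1 => hzX ((Finset.mem_powersetCard.1 he).1 h1)
          have hc := (Finset.mem_powersetCard.1 he).2
          refine ⟨hc, hz', ?_⟩
          obtain ⟨p, q, hpq, rfl⟩ := Finset.card_eq_two.1 hc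
          obtain ⟨_, hp, hq⟩ := (hpair p q).1 he
          have hpz := ne_of_mem_of_not_mem hp hzX
          have hqz := ne_of_mem_of_not_mem hq hzX
          have hFc : Fc T (insert z {p, q}) := by
            obtain ⟨h1, h2⟩ := (hsubs {p, q}).1 ⟨_, he, Finset.Subset.refl _⟩
            obtain ⟨y, hy, hys⟩ := Finset.exists_of_ssubset (Finset.ssubset_iff_subset_ne.2 ⟨h1, h2⟩)
            refine (hF y hy).mono (Finset.insert_subset_insert _ fun k hk =>
              Finset.mem_erase.2 ⟨?_, h1 hk⟩)
            rintro rfl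
            exact hys hk
          obtain ⟨A, hA, B, hB, hAB, hrA, hrB, _⟩ := h.good.two' (card3_of_pair hc hz') hFc
          have e1 := hcol p q hpz hqz hpq.symm A hA B hB hAB hrA hrB
          rw [if_pos ⟨hp, hq⟩] at e1
          have e2 : (col A = 1 ∧ ¬ col B = 1) ∨ (¬ col A = 1 ∧ col B = 1) := by
            generalize col A = t1 at *
            generalize col B = t2 at *
            clear * - e1
            revert t1 t2
            decide
          intro i
          rcases e2 with ⟨e2, e3⟩ | ⟨e2, e3⟩ <;> cases i
          · exact ⟨B, hB, by simp [D, e3], hrB⟩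
          · exact ⟨A, hA, by simp [D, e2], hrA⟩
          · exact ⟨A, hA, by simp [D, e2], hrA⟩
          · exact ⟨B, hB, by simp [D, e3], hrB⟩
        · rintro ⟨hc, hz', hi⟩
          obtain ⟨p, q, hpq, rfl⟩ := Finset.card_eq_two.1 hc
          simp only [Finset.mem_insert, Finset.mem_singleton, not_or] at hz'
          obtain ⟨A, hA, hDA, hrA⟩ := hi true
          obtain ⟨B, hB, hDB, hrB⟩ := hi false
          simp only [D, decide_eq_true_eq, decide_eq_false_iff_not] at hDA hDB
          have hAB : A ≠ B := by rintro rfl; exact hDB hDA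
          have e1 := hcol p q (Ne.symm hz'.1) (Ne.symm hz'.2) hpq.symm A hA B hB hAB hrA hrB
          by_contra hcon
          rw [hpair] at hcon
          rw [if_neg (fun h1 => hcon ⟨hpq, h1⟩), hDA] at e1
          generalize col B = t2 at *
          clear * - e1 hDB
          revert t2
          decide
      Zne := Finset.powersetCard_nonempty.2 (by omega)
      Z2 := by
        intro p hp
        have hp := hver p hp
        have c2 : (X.erase p).card = 2 := by rw [Finset.card_erase_of_mem hp, hX]
        obtain ⟨q, r, hqr, he⟩ := Finset.card_eq_two.1 c2
        have hm : ∀ x, ({p, x} : Finset ℕ) ∈ X.powersetCard 2 ↔ x = q ∨ x = r := by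
          intro x
          have : x ∈ X.erase p ↔ x = q ∨ x = r := by rw [he]; simp
          rw [← this, hpair, Finset.mem_erase]
          constructor
          · rintro ⟨h1, _, h3⟩; exact ⟨h1.symm, h3⟩
          · rintro ⟨h1, h3⟩; exact ⟨h1.symm, hp, h3⟩
        exact ⟨q, r, hqr, (hm q).2 (Or.inl rfl), (hm r).2 (Or.inr rfl), fun x hx => (hm x).1 hx⟩
      Zc := by
        intro p q hp hq
        by_cases hpq : p = q
        · subst hpq; exact Relation.ReflTransGen.refl
        · exact Relation.ReflTransGen.single ((hpair p q).2 ⟨hpq, hver p hp, hver q hq⟩) }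
  have B : BH (expn T z b D (X.powersetCard 2)) (b true) (b false) X :=
    { good := E.good_expn
      ne := hb1
      card3 := hX
      hu := hbX _
      hv := hbX _
      hA := fun h1 => hn ((E.M0 hbX).1 h1).2
      hl := by
        intro s h1 h2
        have hbs : ∀ i, b i ∉ s := by
          intro i; cases i
          · exact h2
          · exact h1
        exact (E.M2 hbs true).trans (hsubs s) }
  have h4 := h.no_exp_bs E B
  have h3 : ((X.powersetCard 2).biUnion id).card ≤ X.card := Finset.card_le_card (by
    intro k hk
    obtain ⟨e, he, hk⟩ := Finset.mem_biUnion.1 hk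
    exact hver k ⟨e, he, hk⟩)
  omega

/-- friendly form -/
theorem RT.L2' (h : RT T) {z p q r : ℕ} (hz : (gen T).HasSphereLink 3 z) (hpq : p ≠ q)
    (hpr : p ≠ r) (hqr : q ≠ r) (hzp : z ≠ p) (hzq : z ≠ q) (hzr : z ≠ r)
    (h1 : Fc T {z, p, q}) (h2 : Fc T {z, p, r}) (h3 : Fc T {z, q, r}) : Fc T {p, q, r} := by
  refine h.L2 hz (Finset.card_eq_three.2 ⟨p, q, r, hpq, hpr, hqr, rfl⟩) (by simp [hzp, hzq, hzr]) ?_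
  intro x hx
  simp only [Finset.mem_insert, Finset.mem_singleton] at hx
  rcases hx with e | e | e <;> subst e
  · refine h3.mono (Finset.insert_subset_insert _ ?_)
    intro k; simp only [Finset.mem_erase, Finset.mem_insert, Finset.mem_singleton]; tauto
  · refine h2.mono (Finset.insert_subset_insert _ ?_)
    intro k; simp only [Finset.mem_erase, Finset.mem_insert, Finset.mem_singleton]; tauto
  · refine h1.mono (Finset.insert_subset_insert _ ?_)
    intro k; simp only [Finset.mem_erase, Finset.mem_insert, Finset.mem_singleton]; tauto
end

section
variable {T : Finset (Finset ℕ)}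

theorem mem_nb1 {u p : ℕ} : p ∈ nb T {u} ↔ p ≠ u ∧ Fc T {p, u} := by
  rw [mem_nb]; simp

theorem mem_nb2 {u v p : ℕ} : p ∈ nb T {u, v} ↔ p ≠ u ∧ p ≠ v ∧ Fc T {p, u, v} := by
  rw [mem_nb]; simp [and_assoc]

theorem RT.unique_sing (h : RT T) {u v : ℕ}
    (hne : u ≠ v)
    (hone : {w | ({w} : Finset ℕ) ∈ ((gen T).lk {u, v}).faces ∧ (gen T).IsSingular w}.ncard ≤ 1)
    {m : ℕ} (hmu : m ≠ u) (hmv : m ≠ v) (hn : ¬ Fc T {u, v, m}) :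
    (nb T {u, v} ∩ nb T {u, m} ∩ nb T {v, m}).card ≤ 1 := by
  have hfin : {w | ({w} : Finset ℕ) ∈ ((gen T).lk {u, v}).faces ∧
      (gen T).IsSingular w}.Finite := by
    refine (nb T {u, v}).finite_toSet.subset ?_
    rintro w ⟨hw, _⟩
    exact mem_nb.2 (mem_lk_gen_singleton.1 hw)
  rw [← Set.ncard_coe_finset]
  refine (Set.ncard_le_ncard ?_ hfin).trans hone
  intro z hz
  simp only [Finset.coe_inter, Set.mem_inter_iff, Finset.mem_coe] at hz
  obtain ⟨⟨h1, h2⟩, h3⟩ := hz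
  refine ⟨mem_lk_gen_singleton.2 (mem_nb.1 h1), ?_⟩
  rw [mem_nb2] at h1 h2 h3
  refine ⟨mem_gen.2 ⟨h1.2.2.mono (by simp), by simp⟩, fun hs => hn ?_⟩
  exact h.L2' hs hne hmu.symm hmv.symm h1.1 h1.2.1 h2.2.1 h1.2.2 h2.2.2 h3.2.2

theorem RT.count (h : RT T) {u v : ℕ} (hne : u ≠ v) (he : Fc T {u, v})
    (hone : {w | ({w} : Finset ℕ) ∈ ((gen T).lk {u, v}).faces ∧ (gen T).IsSingular w}.ncard ≤ 1)
    {m : ℕ} (hmu : m ≠ u) (hmv : m ≠ v) (hvm : Fc T {v, m}) (hn : ¬ Fc T {u, v, m}) :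
    (nb T {u, v}).card + 1 + (nb T {v, m}).card ≤
      (nb T {v}).card + (nb T {u, v} \ nb T {u, m}).card := by
  have hs := h.unique_sing hne hone hmu hmv hn
  set C := nb T {u, v} with hC
  have hsub : insert u (insert m (C ∪ (nb T {v, m} \ C))) ⊆ nb T {v} := by
    intro k hk
    simp only [Finset.mem_insert, Finset.mem_union, Finset.mem_sdiff] at hk
    rw [mem_nb1]
    rcases hk with rfl | rfl | hk | ⟨hk, _⟩
    · exact ⟨hne, he⟩
    · exact ⟨hmv, by rw [Finset.pair_comm]; exact hvm⟩
    · rw [hC, mem_nb2] at hk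
      exact ⟨hk.2.1, hk.2.2.mono (by intro x; simp only [Finset.mem_insert, Finset.mem_singleton]; tauto)⟩
    · rw [mem_nb2] at hk
      exact ⟨hk.1, hk.2.2.mono (by intro x; simp only [Finset.mem_insert, Finset.mem_singleton]; tauto)⟩
  have huC : u ∉ C ∪ (nb T {v, m} \ C) := by
    simp only [Finset.mem_union, Finset.mem_sdiff, not_or, not_and]
    refine ⟨fun hk => ?_, fun hk => ?_⟩
    · rw [hC, mem_nb2] at hk; exact absurd rfl hk.1
    · rw [mem_nb2] at hk; exact absurd hk.2.2 hn
  have hmC : m ∉ C ∪ (nb T {v, m} \ C) := by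
    simp only [Finset.mem_union, Finset.mem_sdiff, not_or, not_and]
    refine ⟨fun hk => ?_, fun hk => ?_⟩
    · rw [hC, mem_nb2] at hk
      refine absurd (hk.2.2.mono ?_) hn
      intro x; simp only [Finset.mem_insert, Finset.mem_singleton]; tauto
    · rw [mem_nb2] at hk; exact absurd rfl hk.2.1
  have c1 := Finset.card_le_card hsub
  rw [Finset.card_insert_of_notMem (by simp only [Finset.mem_insert, not_or]; exact ⟨hmu.symm, huC⟩),
    Finset.card_insert_of_notMem hmC, Finset.card_union_of_disjoint Finset.disjoint_sdiff] at c1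
  have c2 := Finset.card_sdiff_add_card_inter (nb T {v, m}) C
  have c3 : (nb T {v, m} ∩ C).card ≤
      (C ∩ nb T {u, m} ∩ nb T {v, m}).card + (C \ nb T {u, m}).card := by
    refine (Finset.card_le_card ?_).trans (Finset.card_union_le _ _)
    intro k; simp only [Finset.mem_inter, Finset.mem_union, Finset.mem_sdiff]; tauto
  omega

theorem RT.around (h : RT T) {u v : ℕ} (hne : u ≠ v) (he : Fc T {u, v})
    {m : ℕ} (hmu : m ≠ u) (hmv : m ≠ v) (hum : Fc T {u, m}) (hn : ¬ Fc T {u, v, m}) :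
    (nb T {u, v} \ nb T {u, m}).card + 6 ≤ (nb T {u}).card ∧
      (nb T {u, v}).card + 2 ≤ (nb T {u}).card := by
  have d4 := h.deg4 hmu.symm hum
  set C := nb T {u, v} with hC
  have hvu : v ∈ nb T {u} := mem_nb1.2 ⟨hne.symm, by rw [Finset.pair_comm]; exact he⟩
  have hmu' : m ∈ nb T {u} := mem_nb1.2 ⟨hmu, by rw [Finset.pair_comm]; exact hum⟩
  have hmC : m ∉ C := by
    intro hk
    rw [hC, mem_nb2] at hk
    refine absurd (hk.2.2.mono ?_) hn
    intro x; simp only [Finset.mem_insert, Finset.mem_singleton]; tauto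
  have hvC : v ∉ C := by
    intro hk
    rw [hC, mem_nb2] at hk
    exact hk.2.1 rfl
  have hCu : C ⊆ nb T {u} := by
    intro k hk
    rw [hC, mem_nb2] at hk
    exact mem_nb1.2 ⟨hk.1, hk.2.2.mono (by
      intro x; simp only [Finset.mem_insert, Finset.mem_singleton]; tauto)⟩
  have hmn : m ∉ nb T {u, m} := fun hk => (mem_nb2.1 hk).2.1 rfl
  have hvn : v ∉ nb T {u, m} := by
    intro hk
    refine hn ((mem_nb2.1 hk).2.2.mono ?_)
    intro x; simp only [Finset.mem_insert, Finset.mem_singleton]; tauto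
  have hnu : nb T {u, m} ⊆ nb T {u} := by
    intro k hk
    rw [mem_nb2] at hk
    exact mem_nb1.2 ⟨hk.1, hk.2.2.mono (by
      intro x; simp only [Finset.mem_insert, Finset.mem_singleton]; tauto)⟩
  constructor
  · have hsub : insert v (insert m ((C \ nb T {u, m}) ∪ nb T {u, m})) ⊆ nb T {u} := by
      intro k hk
      simp only [Finset.mem_insert, Finset.mem_union, Finset.mem_sdiff] at hk
      rcases hk with rfl | rfl | ⟨hk, _⟩ | hk
      · exact hvu
      · exact hmu'
      · exact hCu hk
      · exact hnu hk
    have c1 := Finset.card_le_card hsub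
    rw [Finset.card_insert_of_notMem (by simp [hmv.symm, hvC, hvn]),
      Finset.card_insert_of_notMem (by simp [hmC, hmn]),
      Finset.card_union_of_disjoint Finset.sdiff_disjoint] at c1
    omega
  · have hsub : insert v (insert m C) ⊆ nb T {u} := by
      intro k hk
      simp only [Finset.mem_insert] at hk
      rcases hk with rfl | rfl | hk
      · exact hvu
      · exact hmu'
      · exact hCu hk
    have c1 := Finset.card_le_card hsub
    rw [Finset.card_insert_of_notMem (by simp [hmv.symm, hvC]),
      Finset.card_insert_of_notMem hmC] at c1
    omega

theorem RT.tet4' (h : RT T) {u v a c : ℕ} (huv : u ≠ v) (hua : u ≠ a) (huc : u ≠ c)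
    (hva : v ≠ a) (hvc : v ≠ c) (hac : a ≠ c) (h1 : Fc T {v, a, c}) (h2 : Fc T {u, a, c})
    (h3 : Fc T {u, v, c}) (h4 : Fc T {u, v, a}) : Fc T {u, v, a, c} := by
  have c4 : ({u, v, a, c} : Finset ℕ).card = 4 := by
    rw [Finset.card_insert_of_notMem (by simp [huv, hua, huc]),
      Finset.card_insert_of_notMem (by simp [hva, hvc]), Finset.card_pair hac]
  refine h.tet4 {u, v, a, c} c4 ?_
  intro y hy
  simp only [Finset.mem_insert, Finset.mem_singleton] at hy
  rcases hy with rfl | rfl | rfl | rfl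
  · refine h1.mono fun x hx => ?_
    simp only [Finset.mem_erase, Finset.mem_insert, Finset.mem_singleton] at hx ⊢
    obtain ⟨n1, n2⟩ := hx
    clear * - n1 n2
    tauto
  · refine h2.mono fun x hx => ?_
    simp only [Finset.mem_erase, Finset.mem_insert, Finset.mem_singleton] at hx ⊢
    obtain ⟨n1, n2⟩ := hx
    clear * - n1 n2
    tauto
  · refine h3.mono fun x hx => ?_
    simp only [Finset.mem_erase, Finset.mem_insert, Finset.mem_singleton] at hx ⊢
    obtain ⟨n1, n2⟩ := hx
    clear * - n1 n2
    tauto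
  · refine h4.mono fun x hx => ?_
    simp only [Finset.mem_erase, Finset.mem_insert, Finset.mem_singleton] at hx ⊢
    obtain ⟨n1, n2⟩ := hx
    clear * - n1 n2
    tauto

theorem RT.part2 (h : RT T) {u v : ℕ} (hne : u ≠ v) (he : Fc T {u, v})
    (hu : (gen T).HasSphereLink 3 u) {w : ℕ} (hwu : w ≠ u) (hwv : w ≠ v) (huw : Fc T {u, w})
    (hvw : Fc T {v, w}) (hn : ¬ Fc T {u, v, w})
    (hc : (nb T {u}).card = (nb T {u, v}).card + 2) :
    nb T {u, v} ⊆ nb T {u, w} ∧ (nb T {u, v}).card ≤ (nb T {v, w}).card := by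
  have hall : ∀ k, k ≠ u → k ≠ v → k ≠ w → Fc T {u, k} → Fc T {u, v, k} := by
    intro k h1 h2 h3 h4
    by_contra h5
    have hsub : insert v (insert w (insert k (nb T {u, v}))) ⊆ nb T {u} := by
      intro x hx
      simp only [Finset.mem_insert] at hx
      rw [mem_nb1]
      rcases hx with rfl | rfl | rfl | hx
      · exact ⟨hne.symm, by rw [Finset.pair_comm]; exact he⟩
      · exact ⟨hwu, by rw [Finset.pair_comm]; exact huw⟩
      · exact ⟨h1, by rw [Finset.pair_comm]; exact h4⟩
      · rw [mem_nb2] at hx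
        exact ⟨hx.1, hx.2.2.mono (by
          intro x; simp only [Finset.mem_insert, Finset.mem_singleton]; tauto)⟩
    have c1 := Finset.card_le_card hsub
    have n1 : k ∉ nb T {u, v} := by
      intro hk
      refine h5 ((mem_nb2.1 hk).2.2.mono ?_)
      intro x; simp only [Finset.mem_insert, Finset.mem_singleton]; tauto
    have n2 : w ∉ nb T {u, v} := by
      intro hk
      refine hn ((mem_nb2.1 hk).2.2.mono ?_)
      intro x; simp only [Finset.mem_insert, Finset.mem_singleton]; tauto
    have n3 : v ∉ nb T {u, v} := fun hk => (mem_nb2.1 hk).2.1 rfl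
    rw [Finset.card_insert_of_notMem (by simp [hwv.symm, h2.symm, n3]),
      Finset.card_insert_of_notMem (by simp [h3.symm, n2]),
      Finset.card_insert_of_notMem n1] at c1
    omega
  refine ⟨?_, h.L3 hne he hwv.symm hvw hwu.symm hn fun k h1 h2 h3 h4 _ => hall k h1 h2 h3 h4⟩
  intro a ha
  obtain ⟨q, r, hqr, hqa, hra, hq, hr, hq1, hr1, honly⟩ := h.good.edge_nb hne ha
  obtain ⟨hau, hav, haF⟩ := mem_nb2.1 ha
  by_contra hcon
  have hua : Fc T {u, a} := haF.mono (by
    intro x; simp only [Finset.mem_insert, Finset.mem_singleton]; tauto)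
  have d4 := h.deg4 hau.symm hua
  obtain ⟨c, hc1, hc2⟩ : ∃ c ∈ nb T {u, a}, c ∉ ({v, q, r} : Finset ℕ) := by
    by_contra hh
    push Not at hh
    have := Finset.card_le_card (show nb T {u, a} ⊆ {v, q, r} from hh)
    have h3 : ({v, q, r} : Finset ℕ).card ≤ 3 := Finset.card_le_three
    omega
  simp only [Finset.mem_insert, Finset.mem_singleton, not_or] at hc2
  obtain ⟨hcu, hca, hcF⟩ := mem_nb2.1 hc1
  have hcw : c ≠ w := by
    rintro rfl
    refine hcon (mem_nb2.2 ⟨hau, hca.symm, hcF.mono ?_⟩)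
    intro x; simp only [Finset.mem_insert, Finset.mem_singleton]; tauto
  have hcv := hall c hcu hc2.1 hcw (hcF.mono (by
    intro x; simp only [Finset.mem_insert, Finset.mem_singleton]; tauto))
  have huva : Fc T {u, v, a} := haF.mono (by
    intro x; simp only [Finset.mem_insert, Finset.mem_singleton]; tauto)
  have huac : Fc T {u, a, c} := hcF.mono (by
    intro x; simp only [Finset.mem_insert, Finset.mem_singleton]; tauto)
  have hvac : Fc T {v, a, c} := h.L2' hu hav.symm (Ne.symm hc2.1) hca.symm hne hau.symm
    hcu.symm huva hcv huac
  have hF := h.tet4' hne hau.symm hcu.symm hav.symm (Ne.symm hc2.1) hca.symm hvac huac hcv huva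
  rcases honly c hcu hc2.1 hca hF with e | e
  · exact hc2.2.1 e
  · exact hc2.2.2 e
end

/-- Lemma 3.11: degree bounds for an edge `uv` with `u` non-singular where `lk(uv)`
has at most one singular vertex. -/
theorem statement10 (K : SComplex) (u v : ℕ) (hK : InClassR K)
    (huv : ({u, v} : Finset ℕ) ∈ K.faces) (hne : u ≠ v)
    (huns : K.HasSphereLink 3 u)
    (hone : {w | ({w} : Finset ℕ) ∈ (K.lk {u, v}).faces ∧ K.IsSingular w}.ncard ≤ 1) :
    (K.deg {u} = 6 → 9 ≤ K.deg {v}) ∧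
    (K.deg {u} = 7 ∧ K.deg {u, v} = 5 → 11 ≤ K.deg {v}) ∧
    (K.deg {u} = 7 ∧ K.deg {u, v} = 4 → 8 ≤ K.deg {v}) := by
  obtain ⟨T, hT, rfl⟩ := exists_good hK.1
  rw [deg_gen, deg_gen, deg_gen]
  have he := (mem_gen.1 huv).1
  have main : 5 ≤ (nb T {u}).card → ∃ w, 4 ≤ (nb T {u, v}).card ∧ 4 ≤ (nb T {v, w}).card ∧
      (nb T {u, v}).card + 1 + (nb T {v, w}).card ≤
        (nb T {v}).card + (nb T {u, v} \ nb T {u, w}).card ∧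
      (nb T {u, v} \ nb T {u, w}).card + 6 ≤ (nb T {u}).card ∧
      (nb T {u, v}).card + 2 ≤ (nb T {u}).card ∧
      ((nb T {u}).card = (nb T {u, v}).card + 2 →
        (nb T {u, v} \ nb T {u, w}).card = 0 ∧ (nb T {u, v}).card ≤ (nb T {v, w}).card) := by
    intro h5
    have h : RT T := hK.rt hT ⟨u, h5⟩
    obtain ⟨w, hwu, hwv, huw, hvw, hn⟩ := h.off hne he
    have ha := h.around hne he hwu hwv huw hn
    refine ⟨w, h.deg4 hne he, h.deg4 hwv.symm hvw, h.count hne he hone hwu hwv hvw hn,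
      ha.1, ha.2, fun hc => ?_⟩
    have hp := h.part2 hne he huns hwu hwv huw hvw hn hc
    exact ⟨by rw [Finset.card_eq_zero, Finset.sdiff_eq_empty_iff_subset]; exact hp.1, hp.2⟩
  refine ⟨fun h6 => ?_, fun h7 => ?_, fun h7 => ?_⟩
  all_goals
    obtain ⟨w, h1, h2, h3, h4, h5, h8⟩ := main (by omega)
    omega

end SComplex
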